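/- Assume RH and LI. Then the set M of real numbers x ≥ 2 with ∏_{p≤x}(1−1/p)^{-1} > e^γ log x has a logarithmic density δ(M) (i.e. its lower and upper logarithmic densities coincide), the set N = {x ≥ 2 : π(x) > Li(x)} has a logarithmic density δ(N), and δ(M) = 1 − δ(N). -/

import Mathlib

open Filter MeasureTheory Real Set

/-- The Mertens product `∏_{p ≤ x} (1 - 1/p)⁻¹`. -/
noncomputable def mertensProd (x : ℝ) : ℝ :=
  ∏ p ∈ Finset.filter Nat.Prime (Finset.Iic ⌊x⌋₊), ((1 : ℝ) - 1 / p)⁻¹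

/-- `ρ` is a nontrivial zero of `ζ`. -/
def IsNontrivialZetaZero (ρ : ℂ) : Prop :=
  riemannZeta ρ = 0 ∧ 0 < ρ.re ∧ ρ.re < 1

/-- The Linear Independence hypothesis: the positive imaginary parts of the
nontrivial zeros of `ζ` are linearly independent over `ℚ`. -/
def LinearIndependenceHypothesis : Prop :=
  LinearIndependent ℚ
    (fun ρ : {s : ℂ // IsNontrivialZetaZero s ∧ 0 < s.im} => (ρ : ℂ).im)

/-- The set `M` of real `x ≥ 2` with `∏_{p≤x}(1-1/p)⁻¹ > e^γ log x`. -/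
def MertensSet : Set ℝ :=
  {x : ℝ | 2 ≤ x ∧ Real.exp Real.eulerMascheroniConstant * Real.log x < mertensProd x}

/-- The set `N` of real `x ≥ 2` with `π(x) > Li(x)`, where `Li(x) = ∫_2^x dt / log t`. -/
noncomputable def PiLiSet : Set ℝ :=
  {x : ℝ | 2 ≤ x ∧ (∫ t in Set.Icc 2 x, 1 / Real.log t) < (Nat.primeCounting ⌊x⌋₊ : ℝ)}

/-- `S` has logarithmic density `d`: `(1/log x) ∫_{S ∩ [2,x]} dt/t → d` as `x → ∞`
(so, in particular, the lower and upper logarithmic densities coincide). -/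
def HasLogDensity (S : Set ℝ) (d : ℝ) : Prop :=
  Tendsto (fun x : ℝ => (∫ t in S ∩ Set.Icc 2 x, 1 / t) / Real.log x) atTop (nhds d)

open scoped FourierTransform InnerProductSpace in
/-- The `L²` Fourier transform agrees almost everywhere with the Fourier integral on `L¹ ∩ L²`. -/
theorem fourier_toLp_ae_eq {f : ℝ → ℂ} (hf : Integrable f) (hf2 : MemLp f 2) :
    ((𝓕 (hf2.toLp f) : Lp ℂ 2 (volume : Measure ℝ)) : ℝ → ℂ) =ᵐ[volume] 𝓕 f := by
  have hcont : Continuous (𝓕 f) :=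
    VectorFourier.fourierIntegral_continuous Real.continuous_fourierChar
      (by fun_prop) hf
  refine ae_eq_of_integral_contDiff_smul_eq ?_ hcont.locallyIntegrable ?_
  · exact (Lp.memLp _).locallyIntegrable (by norm_num)
  intro g hg hgc
  have hg' : ContDiff ℝ (↑(⊤ : ℕ∞)) (fun x => (g x : ℂ)) := Complex.ofRealCLM.contDiff.comp hg
  have hgc' : HasCompactSupport (fun x => (g x : ℂ)) := hgc.comp_left (g := Complex.ofReal) rfl
  set φ := hgc'.toSchwartzMap hg' with hφ
  have hφv : ∀ x, φ x = (g x : ℂ) := fun x => rfl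
  have h1 := Lp.fourier_toTemperedDistribution_eq (hf2.toLp f)
  have h2 := congrArg (fun T => T φ) h1
  simp only [TemperedDistribution.fourier_apply, Lp.toTemperedDistribution_apply] at h2
  have h3 : ∫ x, (𝓕 φ) x • (hf2.toLp f : ℝ → ℂ) x = ∫ x, (𝓕 φ) x • f x := by
    refine integral_congr_ae ?_
    filter_upwards [hf2.coeFn_toLp] with x hx
    rw [hx]
  rw [h3] at h2
  have h4 : ∫ x, (𝓕 φ) x • f x = ∫ x, φ x • 𝓕 f x := by
    have := VectorFourier.integral_fourierIntegral_smul_eq_flip (L := innerₗ ℝ)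
      (μ := volume) (ν := volume) (f := φ) (g := f) Real.continuous_fourierChar
      (by fun_prop) φ.integrable hf
    rw [SchwartzMap.fourier_coe]
    simpa using! this
  rw [h4] at h2
  simpa [hφv] using h2.symm

open scoped FourierTransform InnerProductSpace in
/-- Parseval's identity on `L¹ ∩ L²`. -/
theorem integral_conj_fourier_mul_fourier {f g : ℝ → ℂ} (hf : Integrable f) (hf2 : MemLp f 2)
    (hg : Integrable g) (hg2 : MemLp g 2) :
    ∫ x, starRingEnd ℂ (𝓕 f x) * 𝓕 g x = ∫ x, starRingEnd ℂ (f x) * g x := by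
  have h := Lp.inner_fourier_eq (hf2.toLp f) (hg2.toLp g)
  rw [L2.inner_def, L2.inner_def] at h
  have h1 : ∫ x, starRingEnd ℂ (𝓕 f x) * 𝓕 g x =
      ∫ a, inner ℂ ((𝓕 (hf2.toLp f) : Lp ℂ 2 (volume : Measure ℝ)) a)
        ((𝓕 (hg2.toLp g) : Lp ℂ 2 (volume : Measure ℝ)) a) := by
    refine integral_congr_ae ?_
    filter_upwards [fourier_toLp_ae_eq hf hf2, fourier_toLp_ae_eq hg hg2] with x h1 h2
    rw [h1, h2]
    simp [mul_comm]
  have h2 : ∫ x, starRingEnd ℂ (f x) * g x =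
      ∫ a, inner ℂ ((hf2.toLp f) a) ((hg2.toLp g) a) := by
    refine integral_congr_ae ?_
    filter_upwards [hf2.coeFn_toLp, hg2.coeFn_toLp] with x h1 h2
    rw [h1, h2]
    simp [mul_comm]
  rw [h1, h2, h]

open scoped FourierTransform InnerProductSpace in
theorem memLp_two_fourier {f : ℝ → ℂ} (hf : Integrable f) (hf2 : MemLp f 2) :
    MemLp (𝓕 f) 2 :=
  (memLp_congr_ae (fourier_toLp_ae_eq hf hf2)).1 (Lp.memLp _)

/-- Shifting a vertical contour between two lines in a strip on which the integrand decays. -/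
theorem integral_vertical_eq {F : ℂ → ℂ} {σ τ : ℝ} (hστ : σ ≤ τ)
    (hF : DifferentiableOn ℂ F {s : ℂ | s.re ∈ Icc σ τ})
    (hσ : Integrable fun t : ℝ => F (σ + t * Complex.I))
    (hτ : Integrable fun t : ℝ => F (τ + t * Complex.I))
    (hdec : ∀ ε > 0, ∃ T : ℝ, ∀ t : ℝ, T ≤ |t| → ∀ x ∈ Icc σ τ, ‖F (x + t * Complex.I)‖ ≤ ε) :
    ∫ t : ℝ, F (σ + t * Complex.I) = ∫ t : ℝ, F (τ + t * Complex.I) := by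
  have hh : ∀ s : ℝ → ℝ, (Tendsto (fun T => |s T|) atTop atTop) →
      Tendsto (fun T : ℝ => ∫ x in σ..τ, F (x + s T * Complex.I)) atTop (nhds 0) := by
    intro s hs
    rw [Metric.tendsto_atTop']
    intro ε hε
    obtain ⟨T, hT⟩ := hdec (ε / (2 * (|τ - σ| + 1))) (by positivity)
    obtain ⟨N, hN⟩ := (tendsto_atTop.1 hs T).exists_forall_of_atTop
    refine ⟨N, fun n hn => ?_⟩
    rw [dist_zero_right]
    calc ‖∫ x in σ..τ, F (x + s n * Complex.I)‖ ≤ (ε / (2 * (|τ - σ| + 1))) * |τ - σ| := by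
          refine intervalIntegral.norm_integral_le_of_norm_le_const fun x hx => ?_
          rw [uIoc_of_le hστ] at hx
          exact hT _ (hN n hn.le) x ⟨hx.1.le, hx.2⟩
      _ < ε := by
          rw [div_mul_eq_mul_div, div_lt_iff₀ (by positivity)]
          nlinarith [abs_nonneg (τ - σ)]
  have h1 := hh (fun T => T) tendsto_abs_atTop_atTop
  have h2 := hh (fun T => -T) (by simpa using tendsto_abs_atTop_atTop)
  have h3 := intervalIntegral_tendsto_integral hσ tendsto_neg_atTop_atBot tendsto_id
  have h4 := intervalIntegral_tendsto_integral hτ tendsto_neg_atTop_atBot tendsto_id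
  have key : ∀ T : ℝ, (∫ t in (-T)..T, F (τ + t * Complex.I)) -
      (∫ t in (-T)..T, F (σ + t * Complex.I)) = Complex.I * ((∫ x in σ..τ, F (x + (-T : ℝ) * Complex.I)) -
        ∫ x in σ..τ, F (x + T * Complex.I)) := by
    intro T
    have := Complex.integral_boundary_rect_eq_zero_of_differentiableOn F
      (⟨σ, -T⟩ : ℂ) (⟨τ, T⟩ : ℂ) (hF.mono fun s hs => by
        have := hs.1
        simpa [uIcc_of_le hστ] using this)
    simp only [smul_eq_mul] at this
    linear_combination (-Complex.I) * this + ((∫ t in (-T)..T, F (τ + t * Complex.I)) -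
      (∫ t in (-T)..T, F (σ + t * Complex.I))) * Complex.I_sq
  have h5 := ((h2.sub h1).const_mul Complex.I)
  have h6 := h4.sub h3
  simp only [id] at h6
  rw [tendsto_congr key] at h6
  have := tendsto_nhds_unique h5 h6
  simp only [sub_zero, mul_zero] at this
  exact (sub_eq_zero.1 this.symm).symm

theorem differentiable_integral_mul_cexp {φ : ℝ → ℂ} (hφ : Integrable φ) {N : ℝ}
    (hs : ∀ u, u ∉ Icc 0 N → φ u = 0) :
    Differentiable ℂ fun s : ℂ => ∫ u, φ u * Complex.exp (s * u) := by
  intro s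
  refine (hasDerivAt_integral_of_dominated_loc_of_deriv_le
    (F := fun (s : ℂ) (u : ℝ) => φ u * Complex.exp (s * u))
    (F' := fun (s : ℂ) (u : ℝ) => φ u * (Complex.exp (s * u) * u))
    (bound := fun u => ‖φ u‖ * (rexp ((|s.re| + 1) * N) * N))
    (s := Metric.ball s 1) (Metric.ball_mem_nhds s one_pos) ?_ ?_ ?_ ?_ ?_ ?_).2.differentiableAt
  · refine Eventually.of_forall fun z => hφ.aestronglyMeasurable.mul ?_
    exact (by fun_prop : Continuous fun u : ℝ => Complex.exp (z * u)).aestronglyMeasurable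
  · refine (hφ.norm.mul_const (rexp (|s.re| * N))).mono' (hφ.aestronglyMeasurable.mul
      (by fun_prop : Continuous fun u : ℝ => Complex.exp (s * u)).aestronglyMeasurable)
      (Eventually.of_forall fun u => ?_)
    by_cases hu : u ∈ Icc 0 N
    · rw [norm_mul, Complex.norm_exp]
      gcongr
      simp only [Complex.mul_re, Complex.ofReal_re, Complex.ofReal_im, mul_zero, sub_zero]
      calc s.re * u ≤ |s.re| * u := by gcongr; exacts [hu.1, le_abs_self _]
        _ ≤ |s.re| * N := by gcongr; exact hu.2
    · simp [hs u hu]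
  · exact hφ.aestronglyMeasurable.mul
      (by fun_prop : Continuous fun u : ℝ => Complex.exp (s * u) * u).aestronglyMeasurable
  · refine Eventually.of_forall fun u z hz => ?_
    by_cases hu : u ∈ Icc 0 N
    · rw [norm_mul, norm_mul, Complex.norm_exp]
      have hz' : |z.re| ≤ |s.re| + 1 := by
        have h1 : |z.re - s.re| ≤ ‖z - s‖ := by simpa using Complex.abs_re_le_norm (z - s)
        have h2 : ‖z - s‖ < 1 := by simpa [dist_eq_norm] using hz
        have := abs_sub_abs_le_abs_sub z.re s.re
        linarith
      gcongr
      · simp only [Complex.mul_re, Complex.ofReal_re, Complex.ofReal_im, mul_zero, sub_zero]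
        calc z.re * u ≤ |z.re| * u := by gcongr; exacts [hu.1, le_abs_self _]
          _ ≤ (|s.re| + 1) * N := mul_le_mul hz' hu.2 hu.1 (by positivity)
      · simpa [abs_of_nonneg hu.1] using hu.2
    · simp [hs u hu]
  · exact hφ.norm.mul_const _
  · refine Eventually.of_forall fun u z hz => ?_
    refine HasDerivAt.const_mul _ ?_
    have := (hasDerivAt_mul_const (x := z) (u : ℂ)).cexp
    simpa using this

theorem integrable_indicator_mul {G : ℝ → ℂ} (hGm : AEStronglyMeasurable G) {B N : ℝ}
    (hGb : ∀ u ∈ Icc 0 N, ‖G u‖ ≤ B) {w : ℝ → ℂ} (hw : Continuous w) :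
    Integrable (fun u => (Icc 0 N).indicator G u * w u) ∧
      MemLp (fun u => (Icc 0 N).indicator G u * w u) 2 := by
  have hm : AEStronglyMeasurable fun u => (Icc 0 N).indicator G u * w u :=
    (hGm.indicator measurableSet_Icc).mul hw.aestronglyMeasurable
  have h0 : ∀ v : ℝ → ℝ, Continuous v → Integrable ((Icc 0 N).indicator v) := fun v hv =>
    (integrable_indicator_iff measurableSet_Icc).2 hv.continuousOn.integrableOn_Icc
  refine ⟨(h0 (fun u => B * ‖w u‖) (by fun_prop)).mono' hm (Eventually.of_forall fun u => ?_),
    (memLp_two_iff_integrable_sq_norm hm).2 <|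
      (h0 (fun u => (B * ‖w u‖) ^ 2) (by fun_prop)).mono' (hm.norm.pow 2)
      (Eventually.of_forall fun u => ?_)⟩
  · by_cases hu : u ∈ Icc 0 N
    · simp only [indicator_of_mem hu, norm_mul]
      gcongr
      exact hGb u hu
    · simp [hu]
  · by_cases hu : u ∈ Icc 0 N
    · simp only [indicator_of_mem hu, norm_mul, norm_pow, norm_norm]
      gcongr
      exact hGb u hu
    · simp [hu]

open scoped FourierTransform in
theorem lintegral_sq_mul_exp_le_aux {G : ℝ → ℂ} {D : ℂ → ℂ} {C σ : ℝ} (hσ : 0 < σ) (hσ1 : σ < 1)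
    (hGm : AEStronglyMeasurable G) (hG0 : ∀ u < 0, G u = 0)
    (hGb : ∀ u, 0 ≤ u → ‖G u‖ ≤ C * rexp (u / 2))
    (hD : DifferentiableOn ℂ D {s | 0 < s.re})
    (hDG : ∀ t : ℝ, D (1 + t * Complex.I) = ∫ u : ℝ, G u * Complex.exp (-(1 + t * Complex.I) * u))
    (hdec : ∀ ε > 0, ∃ T : ℝ, ∀ t : ℝ, T ≤ |t| → ∀ x ∈ Icc σ 1, ‖D (x + t * Complex.I)‖ ≤ ε)
    (hDσ : Integrable fun t : ℝ => ‖D (σ + t * Complex.I)‖ ^ 2) (N : ℕ) :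
    IntegrableOn (fun u => ‖G u‖ ^ 2 * rexp (-2 * σ * u)) (Icc (0 : ℝ) N) ∧
      ∫ u in Icc (0 : ℝ) N, ‖G u‖ ^ 2 * rexp (-2 * σ * u) ≤
      ∫ t : ℝ, ‖D (σ + t * Complex.I)‖ ^ 2 := by
  have hC : 0 ≤ C := by simpa using (norm_nonneg _).trans (hGb 0 le_rfl)
  have hB : ∀ u ∈ Icc (0 : ℝ) N, ‖G u‖ ≤ C * rexp (N / 2) := fun u hu =>
    (hGb u hu.1).trans (by gcongr; exact hu.2)
  set K : ℝ → ℂ := (Icc (0 : ℝ) N).indicator G with hK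
  have hKw : ∀ w : ℝ → ℂ, Continuous w → Integrable (fun u => K u * w u) ∧
      MemLp (fun u => K u * w u) 2 := fun w hw => integrable_indicator_mul hGm hB hw
  set φ : ℝ → ℂ := fun u => starRingEnd ℂ (K u) * rexp (-2 * σ * u) with hφ
  have hφi : Integrable φ := by
    have := (hKw (fun u => (rexp (-2 * σ * u) : ℂ)) (by fun_prop)).1
    have h2 := (Complex.conjLIE.toContinuousLinearEquiv.toContinuousLinearMap.integrable_comp this)
    refine h2.congr (Eventually.of_forall fun u => ?_)
    simp only [φ, Complex.conjLIE_apply, ContinuousLinearEquiv.coe_coe,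
      LinearIsometryEquiv.coe_toContinuousLinearEquiv, map_mul, Complex.conj_ofReal]
  set φt : ℂ → ℂ := fun s => ∫ u, φ u * Complex.exp (s * u) with hφt
  have hφtd : Differentiable ℂ φt :=
    differentiable_integral_mul_cexp (N := N) hφi fun u hu => by
      simp only [φ, K, indicator_of_notMem hu, map_zero, zero_mul]
  set H : ℝ → ℝ → ℂ := fun τ u => K u * (rexp ((τ - 2 * σ) * u) : ℂ) with hH
  have hHi : ∀ τ, Integrable (H τ) := fun τ => (hKw _ (by fun_prop)).1
  have hH2 : ∀ τ, MemLp (H τ) 2 := fun τ => (hKw _ (by fun_prop)).2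
  have hFH : ∀ τ ξ : ℝ, starRingEnd ℂ (𝓕 (H τ) ξ) = φt (τ + (2 * π * ξ : ℝ) * Complex.I) := by
    intro τ ξ
    rw [Real.fourier_eq', ← integral_conj]
    refine integral_congr_ae (Eventually.of_forall fun u => ?_)
    simp only [hφ, hH, smul_eq_mul, map_mul, ← Complex.exp_conj, Complex.conj_ofReal,
      Complex.conj_I, Complex.ofReal_exp]
    rw [mul_comm, mul_assoc, ← Complex.exp_add, mul_assoc (starRingEnd ℂ (K u)),
      ← Complex.exp_add]
    congr 2
    simp
    ring
  set F1 : ℝ → ℂ := fun u => G u * (rexp (-u) : ℂ) with hF1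
  have hF1m : AEStronglyMeasurable F1 :=
    hGm.mul (by fun_prop : Continuous fun u : ℝ => (rexp (-u) : ℂ)).aestronglyMeasurable
  have hF1b : ∀ u, ‖F1 u‖ ≤ (Ici (0 : ℝ)).indicator (fun u => C * rexp (-(1 / 2) * u)) u := by
    intro u
    by_cases hu : 0 ≤ u
    · rw [indicator_of_mem (mem_Ici.2 hu), hF1]
      simp only [norm_mul, Complex.norm_real, norm_eq_abs, abs_exp]
      calc ‖G u‖ * rexp (-u) ≤ C * rexp (u / 2) * rexp (-u) := by gcongr; exact hGb u hu
        _ = _ := by rw [mul_assoc, ← Real.exp_add]; congr 2; ring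
    · simp [hF1, hG0 u (not_le.1 hu), indicator_of_notMem (show u ∉ Ici (0 : ℝ) from hu)]
  have hF1i : Integrable F1 := by
    refine Integrable.mono' ?_ hF1m (Eventually.of_forall hF1b)
    rw [integrable_indicator_iff measurableSet_Ici, integrableOn_Ici_iff_integrableOn_Ioi]
    exact (integrableOn_exp_mul_Ioi (by norm_num) 0).const_mul C
  have hF12 : MemLp F1 2 := by
    rw [memLp_two_iff_integrable_sq_norm hF1m]
    have : Integrable ((Ici (0 : ℝ)).indicator (fun u => C ^ 2 * rexp (-1 * u))) := by
      rw [integrable_indicator_iff measurableSet_Ici, integrableOn_Ici_iff_integrableOn_Ioi]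
      exact (integrableOn_exp_mul_Ioi (by norm_num) 0).const_mul _
    refine this.mono' (hF1m.norm.pow 2) (Eventually.of_forall fun u => ?_)
    have h1 := hF1b u
    by_cases hu : 0 ≤ u
    · rw [indicator_of_mem (mem_Ici.2 hu)] at h1 ⊢
      rw [norm_pow, norm_norm]
      refine (pow_le_pow_left₀ (norm_nonneg _) h1 2).trans_eq ?_
      rw [mul_pow, ← Real.exp_nat_mul]
      congr 2; push_cast; ring
    · rw [indicator_of_notMem (show u ∉ Ici (0 : ℝ) from hu)] at h1 ⊢
      rw [norm_pow, norm_norm, le_antisymm h1 (norm_nonneg _)]; simp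
  have hFF1 : ∀ ξ : ℝ, 𝓕 F1 ξ = D (1 + (2 * π * ξ : ℝ) * Complex.I) := by
    intro ξ
    rw [Real.fourier_eq', hDG]
    refine integral_congr_ae (Eventually.of_forall fun u => ?_)
    simp only [hF1, smul_eq_mul, Complex.ofReal_exp]
    rw [mul_comm, mul_assoc, ← Complex.exp_add]
    congr 2
    simp
    ring
  set I : ℝ := ∫ u in Icc (0 : ℝ) N, ‖G u‖ ^ 2 * rexp (-2 * σ * u) with hI
  have hIK : I = ∫ u, ‖K u‖ ^ 2 * rexp (-2 * σ * u) := by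
    rw [hI, ← integral_indicator measurableSet_Icc]
    congr 1
    ext u
    by_cases hu : u ∈ Icc (0 : ℝ) N
    · simp [K, hu]
    · simp [K, hu]
  have hconjH : ∀ (τ τ' : ℝ) (a : ℝ → ℂ), (∀ u, K u ≠ 0 → a u = K u * (rexp (-(τ * u)) : ℂ)) →
      ∫ u, starRingEnd ℂ (H τ u) * a u = (I : ℂ) := by
    intro τ _ a ha
    rw [hIK, ← integral_complex_ofReal]
    refine integral_congr_ae (Eventually.of_forall fun u => ?_)
    by_cases hu : K u = 0
    · simp [hH, hu]
    · simp only [hH, ha u hu, map_mul, Complex.conj_ofReal]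
      have h1 : rexp (-2 * σ * u) = rexp ((τ - 2 * σ) * u) * rexp (-(τ * u)) := by
        rw [← Real.exp_add]; congr 1; ring
      rw [h1]
      push_cast
      rw [← Complex.conj_mul']
      ring
  have hP1 : ∫ ξ : ℝ, φt (1 + (2 * π * ξ : ℝ) * Complex.I) * D (1 + (2 * π * ξ : ℝ) * Complex.I) =
      (I : ℂ) := by
    have := integral_conj_fourier_mul_fourier (hHi 1) (hH2 1) hF1i hF12
    rw [hconjH 1 1 F1 (fun u hu => ?_)] at this
    · rw [← this]
      refine integral_congr_ae (Eventually.of_forall fun ξ => ?_)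
      simp only [hFH, hFF1, Complex.ofReal_one]
    · have : u ∈ Icc (0 : ℝ) N := by
        by_contra h
        exact hu (by simp [K, h])
      simp [hF1, K, this]
  have hPσ : ∫ ξ : ℝ, ‖φt (σ + (2 * π * ξ : ℝ) * Complex.I)‖ ^ 2 = I := by
    have h1 := integral_conj_fourier_mul_fourier (hHi σ) (hH2 σ) (hHi σ) (hH2 σ)
    rw [hconjH σ σ (H σ) (fun u hu => ?_)] at h1
    · apply Complex.ofReal_injective
      rw [← h1, ← integral_complex_ofReal]
      refine integral_congr_ae (Eventually.of_forall fun ξ => ?_)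
      simp only []
      rw [← hFH σ ξ, RCLike.norm_conj]
      rw [Complex.conj_mul']
      push_cast; rfl
    · simp only [hH]
      congr 3
      ring
  have hφσ2 : MemLp (fun ξ : ℝ => φt (σ + (2 * π * ξ : ℝ) * Complex.I)) 2 := by
    have := memLp_two_fourier (hHi σ) (hH2 σ)
    refine this.of_le ((hφtd.continuous.comp (by fun_prop)).aestronglyMeasurable)
      (Eventually.of_forall fun ξ => ?_)
    rw [← hFH σ ξ, RCLike.norm_conj]
  have hφ12 : MemLp (fun ξ : ℝ => φt (1 + (2 * π * ξ : ℝ) * Complex.I)) 2 := by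
    have := memLp_two_fourier (hHi 1) (hH2 1)
    refine this.of_le ((hφtd.continuous.comp (by fun_prop)).aestronglyMeasurable)
      (Eventually.of_forall fun ξ => ?_)
    have := hFH 1 ξ
    rw [Complex.ofReal_one] at this
    rw [← this, RCLike.norm_conj]
  have hDcont : ∀ τ : ℝ, 0 < τ → Continuous fun t : ℝ => D (τ + t * Complex.I) := by
    intro τ hτ
    refine hD.continuousOn.comp_continuous (by fun_prop) fun t => ?_
    simpa using hτ
  have hDξ : MemLp (fun ξ : ℝ => D (σ + (2 * π * ξ : ℝ) * Complex.I)) 2 := by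
    rw [memLp_two_iff_integrable_sq_norm
      (f := fun ξ : ℝ => D (σ + (2 * π * ξ : ℝ) * Complex.I))
      (((hDcont σ hσ).comp (continuous_const_mul (2 * π))).aestronglyMeasurable)]
    exact hDσ.comp_mul_left' (by positivity)
  have hD1 : MemLp (fun ξ : ℝ => D (1 + (2 * π * ξ : ℝ) * Complex.I)) 2 := by
    have := memLp_two_fourier hF1i hF12
    rwa [show 𝓕 F1 = _ from funext hFF1] at this
  have hshift : ∫ ξ : ℝ, φt (σ + (2 * π * ξ : ℝ) * Complex.I) *
      D (σ + (2 * π * ξ : ℝ) * Complex.I) = (I : ℂ) := by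
    rw [← hP1]
    have hi1 : Integrable fun ξ : ℝ => φt (σ + (2 * π * ξ : ℝ) * Complex.I) *
      D (σ + (2 * π * ξ : ℝ) * Complex.I) := hφσ2.integrable_mul hDξ
    have hi2 : Integrable fun ξ : ℝ => φt (1 + (2 * π * ξ : ℝ) * Complex.I) *
      D (1 + (2 * π * ξ : ℝ) * Complex.I) := hφ12.integrable_mul hD1
    have h2pi : (2 * π) ≠ 0 := by positivity
    have hj1 := (integrable_comp_mul_left_iff (fun t : ℝ => φt (σ + t * Complex.I) *
      D (σ + t * Complex.I)) h2pi).1 hi1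
    have hj2 := (integrable_comp_mul_left_iff (fun t : ℝ => φt (1 + t * Complex.I) *
      D (1 + t * Complex.I)) h2pi).1 hi2
    have hbd : ∃ B : ℝ, 0 < B ∧ ∀ x ∈ Icc σ 1, ∀ t : ℝ, ‖φt (x + t * Complex.I)‖ ≤ B := by
      refine ⟨(∫ u, ‖φ u‖ * rexp N) + 1, by positivity, fun x hx t => ?_⟩
      refine le_add_of_le_of_nonneg (norm_integral_le_of_norm_le (hφi.norm.mul_const _)
        (Eventually.of_forall fun u => ?_)) zero_le_one
      by_cases hu : u ∈ Icc (0 : ℝ) N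
      · rw [norm_mul, Complex.norm_exp]
        gcongr
        simp only [Complex.mul_re, Complex.add_re, Complex.ofReal_re, Complex.I_re, mul_zero,
          Complex.ofReal_im, Complex.I_im, mul_one, sub_self, add_zero, sub_zero]
        calc x * u ≤ 1 * u := by gcongr; exacts [hu.1, hx.2]
          _ ≤ N := by linarith [hu.2]
      · simp [hφ, K, hu]
    obtain ⟨B, hB0, hBφ⟩ := hbd
    have hv := integral_vertical_eq (F := fun s => φt s * D s) hσ1.le
      (hφtd.differentiableOn.mul (hD.mono fun s hs => hσ.trans_le hs.1)) hj1
      (by simpa using hj2) (fun ε hε => by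
        obtain ⟨T, hT⟩ := hdec (ε / B) (by positivity)
        refine ⟨T, fun t ht x hx => ?_⟩
        rw [norm_mul]
        calc _ ≤ B * (ε / B) := by
              gcongr
              exacts [hBφ x hx t, hT t ht x hx]
          _ = ε := by field_simp)
    have hl := Measure.integral_comp_mul_left (fun t : ℝ => φt (σ + t * Complex.I) *
      D (σ + t * Complex.I)) (2 * π)
    have hr := Measure.integral_comp_mul_left (fun t : ℝ => φt (1 + t * Complex.I) *
      D (1 + t * Complex.I)) (2 * π)
    rw [hl, hr]
    congr 1
  refine ⟨?_, ?_⟩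
  · have := (memLp_two_iff_integrable_sq_norm (hH2 σ).1).1 (hH2 σ)
    have h2 := this.integrableOn (s := Icc (0 : ℝ) N)
    refine h2.congr_fun (fun u hu => ?_) measurableSet_Icc
    simp only [hH, K, indicator_of_mem hu, norm_mul, Complex.norm_real, norm_eq_abs, abs_exp]
    rw [mul_pow, ← Real.exp_nat_mul]
    congr 2
    push_cast; ring
  · have hi1 := (memLp_two_iff_integrable_sq_norm hφσ2.1).1 hφσ2
    have hi2 := (memLp_two_iff_integrable_sq_norm hDξ.1).1 hDξ
    have h1 : I ≤ ∫ ξ : ℝ, (‖φt (σ + (2 * π * ξ : ℝ) * Complex.I)‖ ^ 2 / 2 +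
        ‖D (σ + (2 * π * ξ : ℝ) * Complex.I)‖ ^ 2 / 2) := by
      have := norm_integral_le_of_norm_le ((hi1.div_const 2).add (hi2.div_const 2))
          (Eventually.of_forall fun ξ : ℝ => show ‖φt (σ + (2 * π * ξ : ℝ) * Complex.I) *
            D (σ + (2 * π * ξ : ℝ) * Complex.I)‖ ≤ _ by
            simp only [norm_mul, Pi.add_apply]
            nlinarith [sq_nonneg (‖φt (σ + (2 * π * ξ : ℝ) * Complex.I)‖ -
              ‖D (σ + (2 * π * ξ : ℝ) * Complex.I)‖)])
      rw [hshift] at this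
      refine (le_abs_self I).trans ?_
      simpa using this
    rw [integral_add (hi1.div_const 2) (hi2.div_const 2), integral_div, integral_div, hPσ] at h1
    have h2 := Measure.integral_comp_mul_left (fun t : ℝ => ‖D (σ + t * Complex.I)‖ ^ 2) (2 * π)
    rw [h2, smul_eq_mul] at h1
    have h3 : |(2 * π)⁻¹| ≤ 1 := by
      rw [abs_of_pos (by positivity)]
      exact inv_le_one_of_one_le₀ (by linarith [pi_gt_three])
    have h4 : 0 ≤ ∫ t : ℝ, ‖D (σ + t * Complex.I)‖ ^ 2 := integral_nonneg fun t => by positivity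
    nlinarith

/-- A Paley–Wiener type inequality: the weighted mean square of a function is controlled by the
mean square of the analytic continuation of its Laplace transform. -/
theorem lintegral_sq_mul_exp_le {G : ℝ → ℂ} {D : ℂ → ℂ} {C σ : ℝ} (hσ : 0 < σ) (hσ1 : σ < 1)
    (hGm : AEStronglyMeasurable G) (hG0 : ∀ u < 0, G u = 0)
    (hGb : ∀ u, 0 ≤ u → ‖G u‖ ≤ C * rexp (u / 2))
    (hD : DifferentiableOn ℂ D {s | 0 < s.re})
    (hDG : ∀ t : ℝ, D (1 + t * Complex.I) = ∫ u : ℝ, G u * Complex.exp (-(1 + t * Complex.I) * u))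
    (hdec : ∀ ε > 0, ∃ T : ℝ, ∀ t : ℝ, T ≤ |t| → ∀ x ∈ Icc σ 1, ‖D (x + t * Complex.I)‖ ≤ ε) :
    ∫⁻ u, ENNReal.ofReal (‖G u‖ ^ 2 * rexp (-2 * σ * u)) ≤
      ∫⁻ t : ℝ, ENNReal.ofReal (‖D (σ + t * Complex.I)‖ ^ 2) := by
  by_cases hfin : ∫⁻ t : ℝ, ENNReal.ofReal (‖D (σ + t * Complex.I)‖ ^ 2) = ⊤
  · rw [hfin]; exact le_top
  have hDcont : ∀ τ : ℝ, 0 < τ → Continuous fun t : ℝ => D (τ + t * Complex.I) := by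
    intro τ hτ
    refine hD.continuousOn.comp_continuous (by fun_prop) fun t => ?_
    simpa using hτ
  have hDσ : Integrable fun t : ℝ => ‖D (σ + t * Complex.I)‖ ^ 2 := by
    refine ⟨((hDcont σ hσ).norm.pow 2).aestronglyMeasurable, ?_⟩
    rw [hasFiniteIntegral_iff_ofReal (Eventually.of_forall fun t => by positivity)]
    exact lt_top_iff_ne_top.2 hfin
  have hmeas : AEMeasurable fun u => ENNReal.ofReal (‖G u‖ ^ 2 * rexp (-2 * σ * u)) :=
    ((hGm.norm.pow 2).mul (by fun_prop : Continuous fun u : ℝ =>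
      rexp (-2 * σ * u)).aestronglyMeasurable).aemeasurable.ennreal_ofReal
  have hN : ∀ N : ℕ, ∫⁻ u in Icc (0 : ℝ) N, ENNReal.ofReal (‖G u‖ ^ 2 * rexp (-2 * σ * u)) ≤
      ∫⁻ t : ℝ, ENNReal.ofReal (‖D (σ + t * Complex.I)‖ ^ 2) := by
    intro N
    have hb := lintegral_sq_mul_exp_le_aux hσ hσ1 hGm hG0 hGb hD hDG hdec hDσ N
    rw [← ofReal_integral_eq_lintegral_ofReal hb.1 (Eventually.of_forall fun t => by positivity),
      ← ofReal_integral_eq_lintegral_ofReal hDσ (Eventually.of_forall fun t => by positivity)]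
    exact ENNReal.ofReal_le_ofReal hb.2
  have hconv : Tendsto (fun N : ℕ => ∫⁻ u, (Icc (0 : ℝ) N).indicator
      (fun u => ENNReal.ofReal (‖G u‖ ^ 2 * rexp (-2 * σ * u))) u) atTop
      (nhds (∫⁻ u, ENNReal.ofReal (‖G u‖ ^ 2 * rexp (-2 * σ * u)))) := by
    refine lintegral_tendsto_of_tendsto_of_monotone (fun N => hmeas.indicator measurableSet_Icc)
      (Eventually.of_forall fun u => ?_) (Eventually.of_forall fun u => ?_)
    · intro a b hab
      refine indicator_le_indicator_of_subset (Icc_subset_Icc_right (by exact_mod_cast hab))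
        (fun _ => zero_le) u
    · rcases lt_or_ge u 0 with hu | hu
      · simp [hG0 u hu, not_le.2 hu, indicator]
      · obtain ⟨M, hM⟩ := exists_nat_ge u
        refine tendsto_const_nhds.congr' ?_
        filter_upwards [eventually_ge_atTop M] with n hn
        rw [indicator_of_mem]
        exact ⟨hu, hM.trans (by exact_mod_cast hn)⟩
  refine le_of_tendsto' hconv fun N => ?_
  rw [lintegral_indicator measurableSet_Icc]
  exact hN N

/-- The integral `∫_1^∞ {x} x^{-s-1} dx`. -/
noncomputable def fractIntegral (s : ℂ) : ℂ :=
  ∫ t in Ioi (1 : ℝ), ((Int.fract t : ℝ) : ℂ) * (t : ℂ) ^ (-(s + 1))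

theorem norm_fract_mul_cpow_le (s : ℂ) {t : ℝ} (ht : t ∈ Ioi (1 : ℝ)) :
    ‖((Int.fract t : ℝ) : ℂ) * (t : ℂ) ^ (-(s + 1))‖ ≤ t ^ (-(s.re + 1)) := by
  have ht0 : (0 : ℝ) < t := one_pos.trans ht
  rw [norm_mul, Complex.norm_cpow_eq_rpow_re_of_pos ht0, Complex.norm_real, norm_eq_abs,
    abs_of_nonneg (Int.fract_nonneg t)]
  simp only [Complex.neg_re, Complex.add_re, Complex.one_re]
  exact mul_le_of_le_one_left (by positivity) (Int.fract_lt_one t).le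

theorem aestronglyMeasurable_fract_mul_cpow (s : ℂ) :
    AEStronglyMeasurable (fun t : ℝ => ((Int.fract t : ℝ) : ℂ) * (t : ℂ) ^ (-(s + 1)))
      (volume.restrict (Ioi 1)) := by
  refine (Complex.measurable_ofReal.comp measurable_fract).aestronglyMeasurable.mul ?_
  refine ContinuousOn.aestronglyMeasurable (fun t ht => ?_) measurableSet_Ioi
  exact (Complex.continuousAt_ofReal_cpow_const _ _
    (Or.inr (one_pos.trans ht).ne')).continuousWithinAt

theorem integrableOn_fract_mul_cpow {s : ℂ} (hs : 0 < s.re) :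
    IntegrableOn (fun t : ℝ => ((Int.fract t : ℝ) : ℂ) * (t : ℂ) ^ (-(s + 1))) (Ioi 1) := by
  refine Integrable.mono' (integrableOn_Ioi_rpow_of_lt (a := -(s.re + 1)) (by linarith) one_pos)
    (aestronglyMeasurable_fract_mul_cpow s) ?_
  filter_upwards [ae_restrict_mem measurableSet_Ioi] with t ht
  exact norm_fract_mul_cpow_le s ht

theorem norm_fractIntegral_le {s : ℂ} (hs : 0 < s.re) : ‖fractIntegral s‖ ≤ 1 / s.re := by
  have h := norm_integral_le_of_norm_le
    (integrableOn_Ioi_rpow_of_lt (a := -(s.re + 1)) (by linarith) one_pos)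
    ((ae_restrict_mem measurableSet_Ioi).mono fun t ht => norm_fract_mul_cpow_le s ht)
  rw [integral_Ioi_rpow_of_lt (by linarith) one_pos] at h
  refine h.trans_eq ?_
  rw [Real.one_rpow]
  have : -(s.re + 1) + 1 = - s.re := by ring
  rw [this]; field_simp

theorem differentiableOn_fractIntegral : DifferentiableOn ℂ fractIntegral {s | 0 < s.re} := by
  intro s hs
  set F : ℝ → ℂ := (Ioi (1 : ℝ)).indicator fun t => ((Int.fract t : ℝ) : ℂ) with hF
  have hFb : ∀ t, ‖F t‖ ≤ 1 := by
    intro t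
    refine (norm_indicator_le_norm_self _ _).trans ?_
    rw [Complex.norm_real, norm_eq_abs, abs_of_nonneg (Int.fract_nonneg t)]
    exact (Int.fract_lt_one t).le
  have hFm : Measurable F :=
    (Complex.measurable_ofReal.comp measurable_fract).indicator measurableSet_Ioi
  have hmel : ∀ s, mellin F (-s) = fractIntegral s := by
    intro s
    rw [mellin, fractIntegral]
    have : ∀ t : ℝ, (t : ℂ) ^ (-s - 1) • F t = (Ioi (1 : ℝ)).indicator
        (fun t => ((Int.fract t : ℝ) : ℂ) * (t : ℂ) ^ (-(s + 1))) t := by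
      intro t
      by_cases ht : t ∈ Ioi (1 : ℝ)
      · rw [hF, indicator_of_mem ht, indicator_of_mem ht, smul_eq_mul, mul_comm]
        congr 2; ring
      · rw [hF, indicator_of_notMem ht, indicator_of_notMem ht, smul_zero]
    simp_rw [this]
    rw [setIntegral_indicator measurableSet_Ioi]
    congr 2
    rw [inter_eq_right.2 (Ioi_subset_Ioi zero_le_one)]
  have hd : DifferentiableAt ℂ (mellin F) (-s) := by
    refine mellin_differentiableAt_of_isBigO_rpow (a := 0) (b := (-s).re - 1) ?_ ?_ ?_ ?_ ?_
    · refine (LocallyIntegrable.mono (locallyIntegrable_const (1 : ℝ)) hFm.aestronglyMeasurable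
        (Eventually.of_forall fun t => ?_)).locallyIntegrableOn _
      simpa using hFb t
    · refine Asymptotics.IsBigO.of_bound 1 (Eventually.of_forall fun t => ?_)
      simpa using hFb t
    · simpa using hs
    · refine Asymptotics.IsBigO.of_bound 1 ?_
      filter_upwards [mem_nhdsWithin_of_mem_nhds (Iio_mem_nhds (zero_lt_one' ℝ))] with t ht
      rw [hF, indicator_of_notMem (show t ∉ Ioi (1 : ℝ) from fun h => lt_asymm (mem_Ioi.1 h) (mem_Iio.1 ht))]
      simp only [norm_zero]
      positivity
    · linarith
  have := (hd.comp s (differentiable_neg s)).differentiableWithinAt (s := {s : ℂ | 0 < s.re})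
  exact this.congr (fun z _ => (hmel z).symm) (hmel s).symm

theorem riemannZeta₁_eq_of_one_lt_re {s : ℂ} (hs : 1 < s.re) :
    riemannZeta₁ s = s - s * (s - 1) * fractIntegral s := by
  have h1 : s ≠ 1 := by rintro rfl; simp at hs
  have h1' : s - 1 ≠ 0 := sub_ne_zero.2 h1
  have hz := riemannZeta_eq_inv_sub_mul h1
  have hsum : ∀ n : ℕ, ∑ k ∈ Finset.Icc 1 n, (1 : ℕ → ℂ) k = n := by intro n; simp
  have hL := LSeries_eq_mul_integral (1 : ℕ → ℂ) zero_le_one hs (LSeriesSummable_one_iff.2 hs) (by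
    simp_rw [hsum]
    refine Asymptotics.IsBigO.of_bound 1 (Eventually.of_forall fun n => ?_)
    simp)
  rw [LSeries_one_eq_riemannZeta hs] at hL
  have hInt : ∫ (t : ℝ) in Ioi 1, (∑ k ∈ Finset.Icc 1 ⌊t⌋₊, (1 : ℕ → ℂ) k) * (t : ℂ) ^ (-(s + 1)) =
      ∫ (t : ℝ) in Ioi 1, ((t : ℂ) ^ (-s) - ((Int.fract t : ℝ) : ℂ) * (t : ℂ) ^ (-(s + 1))) := by
    refine setIntegral_congr_fun measurableSet_Ioi fun t ht => ?_
    have ht0 : (0 : ℝ) < t := one_pos.trans ht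
    simp only [hsum]
    have h2 : (t : ℂ) ^ (-s) = t * (t : ℂ) ^ (-(s + 1)) := by
      have ht' : (t : ℂ) ≠ 0 := by exact_mod_cast ht0.ne'
      rw [neg_add', Complex.cpow_sub _ _ ht', Complex.cpow_one]
      field_simp
    rw [h2, ← sub_mul]
    congr 1
    rw [← Complex.ofReal_sub, Int.self_sub_fract, ← natCast_floor_eq_intCast_floor ht0.le]
    simp
  rw [hInt, integral_sub (integrableOn_Ioi_cpow_of_lt (by simpa using hs) one_pos)
    (integrableOn_fract_mul_cpow (by linarith)), integral_Ioi_cpow_of_lt (by simpa using hs) one_pos,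
    hz] at hL
  have h3 : (-s + 1) ≠ 0 := by
    intro h; apply h1'; linear_combination -h
  simp only [Complex.ofReal_one, Complex.one_cpow] at hL
  rw [inv_mul_eq_iff_eq_mul₀ h1'] at hL
  rw [hL, fractIntegral]
  have h4 : (-1 : ℂ) / (-s + 1) = 1 / (s - 1) := by
    rw [div_eq_div_iff h3 h1']; ring
  rw [h4]
  field_simp

theorem riemannZeta₁_eq {s : ℂ} (hs : 0 < s.re) :
    riemannZeta₁ s = s - s * (s - 1) * fractIntegral s := by
  have hopen : IsOpen {s : ℂ | 0 < s.re} := isOpen_lt continuous_const Complex.continuous_re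
  have hpre : IsPreconnected {s : ℂ | 0 < s.re} := (convex_halfSpace_re_gt 0).isPreconnected
  refine AnalyticOnNhd.eqOn_of_preconnected_of_eventuallyEq (z₀ := 2)
    (differentiable_riemannZeta₁.differentiableOn.analyticOnNhd hopen)
    (DifferentiableOn.analyticOnNhd (differentiableOn_id.sub
      ((differentiableOn_id.mul (differentiableOn_id.sub_const 1)).mul
        differentiableOn_fractIntegral)) hopen) hpre (by simp) ?_ hs
  have : {s : ℂ | 1 < s.re} ∈ nhds (2 : ℂ) :=
    (isOpen_lt continuous_const Complex.continuous_re).mem_nhds (by simp)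
  filter_upwards [this] with z hz
  exact riemannZeta₁_eq_of_one_lt_re hz

theorem norm_riemannZeta₁_le {s : ℂ} (hs : 0 < s.re) :
    ‖riemannZeta₁ s‖ ≤ ‖s‖ + ‖s‖ * (‖s‖ + 1) / s.re := by
  rw [riemannZeta₁_eq hs]
  refine (norm_sub_le _ _).trans ?_
  rw [norm_mul, norm_mul, div_eq_mul_one_div]
  gcongr
  · exact (norm_sub_le _ _).trans (by simp)
  · exact norm_fractIntegral_le hs

theorem riemannZeta₁_half_ne_zero : riemannZeta₁ (1 / 2) ≠ 0 := by
  intro h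
  rw [riemannZeta₁_eq (by norm_num)] at h
  have h1 : fractIntegral (1 / 2) =
      ((∫ t in Ioi (1 : ℝ), Int.fract t * t ^ (-(3 / 2 : ℝ)) : ℝ) : ℂ) := by
    rw [fractIntegral, ← integral_complex_ofReal]
    refine setIntegral_congr_fun measurableSet_Ioi fun t ht => ?_
    have ht0 : (0 : ℝ) ≤ t := (one_pos.trans ht).le
    simp only [Complex.ofReal_mul]
    rw [Complex.ofReal_cpow ht0]
    congr 2
    push_cast; norm_num
  have h2 : 0 ≤ ∫ t in Ioi (1 : ℝ), Int.fract t * t ^ (-(3 / 2 : ℝ)) :=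
    setIntegral_nonneg measurableSet_Ioi fun t ht =>
      mul_nonneg (Int.fract_nonneg t) (rpow_nonneg (one_pos.trans ht).le _)
  rw [h1] at h
  have h3 := congrArg Complex.re h
  norm_num at h3
  linarith

theorem norm_riemannZeta₁_two_add_ge (t : ℝ) : 1 / 3 ≤ ‖riemannZeta₁ (2 + t * Complex.I)‖ := by
  have hre : 1 < (2 + t * Complex.I).re := by simp
  have h1 : (2 + t * Complex.I) - 1 ≠ 0 := by
    intro h; have := congrArg Complex.re h; norm_num at this
  have hz := riemannZeta_eq_inv_sub_mul (sub_ne_zero.1 h1)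
  have hz' : riemannZeta₁ (2 + t * Complex.I) =
      ((2 + t * Complex.I) - 1) * riemannZeta (2 + t * Complex.I) := by
    rw [hz]; field_simp
  rw [hz', norm_mul]
  have h2 : 1 ≤ ‖(2 + t * Complex.I) - 1‖ := by
    refine le_trans ?_ (Complex.abs_re_le_norm _)
    norm_num
  have h3 : 1 / 3 ≤ ‖riemannZeta (2 + t * Complex.I)‖ := by
    have hs := zeta_eq_tsum_one_div_nat_add_one_cpow hre
    have hsum : Summable fun n : ℕ => 1 / ((n : ℂ) + 1) ^ (2 + t * Complex.I) := by
      have := (summable_nat_add_iff 1).2 (Complex.summable_one_div_nat_cpow.2 hre)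
      simpa using this
    have hnorm : ∀ n : ℕ, ‖1 / ((n : ℂ) + 1) ^ (2 + t * Complex.I)‖ = 1 / ((n : ℝ) + 1) ^ 2 := by
      intro n
      have : ((n : ℂ) + 1) = ((n + 1 : ℝ) : ℂ) := by push_cast; rfl
      rw [norm_div, norm_one, this, Complex.norm_cpow_eq_rpow_re_of_pos (by positivity)]
      simp
    have hz2 : HasSum (fun n : ℕ => 1 / ((n : ℝ) + 1) ^ 2) (π ^ 2 / 6) := by
      have := (hasSum_nat_add_iff' 1).2 hasSum_zeta_two
      simpa using this
    have hz3 : ∑' n : ℕ, 1 / ((n + 1 : ℕ) + 1 : ℝ) ^ 2 = π ^ 2 / 6 - 1 := by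
      have := hz2.summable.tsum_eq_zero_add
      rw [hz2.tsum_eq] at this
      norm_num at this
      norm_num
      linarith
    rw [hs, hsum.tsum_eq_zero_add]
    have h4 : ‖∑' n : ℕ, 1 / (((n + 1 : ℕ) : ℂ) + 1) ^ (2 + t * Complex.I)‖ ≤ π ^ 2 / 6 - 1 := by
      rw [← hz3]
      have hs' : Summable fun n : ℕ => 1 / ((n + 1 : ℕ) + 1 : ℝ) ^ 2 :=
        (summable_nat_add_iff 1).2 hz2.summable
      refine tsum_of_norm_bounded hs'.hasSum fun n => (hnorm (n + 1)).le
    have h5 := norm_sub_norm_le (1 / (((0 : ℕ) : ℂ) + 1) ^ (2 + t * Complex.I))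
      (-(∑' n : ℕ, 1 / (((n + 1 : ℕ) : ℂ) + 1) ^ (2 + t * Complex.I)))
    rw [sub_neg_eq_add, norm_neg] at h5
    have h6 : ‖(1 / (((0 : ℕ) : ℂ) + 1) ^ (2 + t * Complex.I))‖ = 1 := by simp
    rw [h6] at h5
    have hpi : π ^ 2 < 10 := by
      have := pi_lt_d2
      nlinarith [pi_pos]
    linarith
  nlinarith [norm_nonneg (riemannZeta (2 + t * Complex.I))]

/-- Splitting off a zero of an entire function together with its multiplicity. -/
theorem exists_eq_sub_pow_mul {f : ℂ → ℂ} (hf : Differentiable ℂ f) (h0 : f ≠ 0) (a : ℂ) :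
    ∃ g : ℂ → ℂ, Differentiable ℂ g ∧ g a ≠ 0 ∧
      ∀ z, f z = (z - a) ^ analyticOrderNatAt f a * g z := by
  have hfa : ∀ z, AnalyticAt ℂ f z := fun z ↦ hf.analyticAt z
  have htop : analyticOrderAt f a ≠ ⊤ := fun h ↦ h0 ((AnalyticOnNhd.analyticOrderAt_eq_top_iff_eq_zero a hfa).1 h)
  obtain ⟨k, hk, hka, hfk⟩ := (hfa a).analyticOrderAt_ne_top.1 htop
  set m := analyticOrderNatAt f a with hm
  set g : ℂ → ℂ := Function.update (fun z ↦ f z / (z - a) ^ m) a (k a) with hg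
  have hgk : g =ᶠ[nhds a] k := by
    filter_upwards [hfk] with z hz
    rcases eq_or_ne z a with rfl | hza
    · simp [hg]
    · have : (z - a) ^ m ≠ 0 := pow_ne_zero _ (sub_ne_zero.2 hza)
      rw [hg, Function.update_of_ne hza, hz, smul_eq_mul]
      field_simp
  refine ⟨g, fun z ↦ ?_, by simpa [hg] using hka, fun z ↦ ?_⟩
  · rcases eq_or_ne z a with rfl | hza
    · exact (hk.congr hgk.symm).differentiableAt
    · have h1 : g =ᶠ[nhds z] fun z ↦ f z / (z - a) ^ m := by
        filter_upwards [isOpen_ne.mem_nhds hza] with w hw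
        rw [hg, Function.update_of_ne hw]
      refine DifferentiableAt.congr_of_eventuallyEq ?_ h1
      have : (z - a) ^ m ≠ 0 := pow_ne_zero _ (sub_ne_zero.2 hza)
      exact (hf z).div (by fun_prop) this
  · rcases eq_or_ne z a with rfl | hza
    · have := hfk.self_of_nhds
      rw [this, hgk.self_of_nhds]; rfl
    · have : (z - a) ^ m ≠ 0 := pow_ne_zero _ (sub_ne_zero.2 hza)
      rw [hg, Function.update_of_ne hza]
      field_simp

/-- Splitting off finitely many zeros of an entire function. -/
theorem exists_eq_prod_mul {f : ℂ → ℂ} (hf : Differentiable ℂ f) (h0 : f ≠ 0) (S : Finset ℂ) :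
    ∃ g : ℂ → ℂ, Differentiable ℂ g ∧ (∀ a ∈ S, g a ≠ 0) ∧
      ∀ z, f z = (∏ a ∈ S, (z - a) ^ analyticOrderNatAt f a) * g z := by
  suffices ∃ g : ℂ → ℂ, Differentiable ℂ g ∧ g ≠ 0 ∧ (∀ a ∈ S, g a ≠ 0) ∧
      (∀ a ∉ S, analyticOrderNatAt g a = analyticOrderNatAt f a) ∧
      ∀ z, f z = (∏ a ∈ S, (z - a) ^ analyticOrderNatAt f a) * g z by
    obtain ⟨g, h1, -, h2, -, h3⟩ := this
    exact ⟨g, h1, h2, h3⟩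
  classical
  induction S using Finset.induction_on with
  | empty => exact ⟨f, hf, h0, by simp, by simp, by simp⟩
  | insert b S hb ih =>
    obtain ⟨g, hg, hg0, hgS, hgo, hfg⟩ := ih
    obtain ⟨k, hk, hkb, hgk⟩ := exists_eq_sub_pow_mul hg hg0 b
    have hk0 : k ≠ 0 := fun h ↦ hkb (by simp [h])
    refine ⟨k, hk, hk0, ?_, ?_, ?_⟩
    · intro a ha
      rcases Finset.mem_insert.1 ha with rfl | ha
      · exact hkb
      · intro h
        exact hgS a ha (by rw [hgk, h, mul_zero])
    · intro a ha
      rw [Finset.mem_insert, not_or] at ha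
      rw [← hgo a ha.2]
      have e : g = (fun z ↦ (z - b) ^ analyticOrderNatAt g b) * k := by
        ext z; exact hgk z
      have hp : AnalyticAt ℂ (fun z ↦ (z - b) ^ analyticOrderNatAt g b) a := by fun_prop
      have hp0 : analyticOrderAt (fun z ↦ (z - b) ^ analyticOrderNatAt g b) a = 0 :=
        hp.analyticOrderAt_eq_zero.2 (pow_ne_zero _ (sub_ne_zero.2 ha.1))
      conv_rhs => rw [e]
      rw [analyticOrderNatAt, analyticOrderNatAt, analyticOrderAt_mul hp (hk.analyticAt a), hp0,
        zero_add]
    · intro z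
      rw [Finset.prod_insert hb, hfg, hgk, hgo b hb]
      ring

/-- Jensen's bound on the number of zeros in a disc. -/
theorem sum_order_mul_log_le {f : ℂ → ℂ} (hf : Differentiable ℂ f) {c : ℂ} {r R L : ℝ}
    (hr : 0 < r) (hrR : r < R) (hfc : f c ≠ 0)
    (hB : ∀ z ∈ Metric.sphere c R, ‖f z‖ ≤ rexp L * ‖f c‖)
    (S : Finset ℂ) (hS : ∀ a ∈ S, a ∈ Metric.closedBall c r) :
    (∑ a ∈ S, (analyticOrderNatAt f a : ℝ)) * Real.log (R / r) ≤ L := by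
  have h0 : f ≠ 0 := fun h ↦ hfc (by simp [h])
  obtain ⟨g, hg, -, hfg⟩ := exists_eq_prod_mul hf h0 S
  set m := analyticOrderNatAt f
  have hR : 0 < R := hr.trans hrR
  have hfcp : 0 < ‖f c‖ := norm_pos_iff.2 hfc
  set G : ℂ → ℂ := fun z ↦
    (∏ a ∈ S, ((R ^ 2 - (starRingEnd ℂ) (a - c) * (z - c)) / R) ^ m a) * g z with hG
  have hGd : Differentiable ℂ G := by
    refine Differentiable.mul (Differentiable.fun_finsetProd fun a _ ↦ ?_) hg
    fun_prop
  have hGs : ∀ z ∈ Metric.sphere c R, ‖G z‖ ≤ rexp L * ‖f c‖ := by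
    intro z hz
    refine le_trans (le_of_eq ?_) (hB z hz)
    rw [hfg z, hG]
    simp only [norm_mul, norm_prod, norm_pow]
    congr 1
    refine Finset.prod_congr rfl fun a _ ↦ ?_
    congr 1
    have hw : ‖z - c‖ = R := by simpa [dist_eq_norm] using hz
    have h1 : ((R : ℂ) ^ 2 - (starRingEnd ℂ) (a - c) * (z - c)) =
        (z - c) * (starRingEnd ℂ) (z - a) := by
      have : ((R : ℂ) ^ 2) = (z - c) * (starRingEnd ℂ) (z - c) := by
        rw [Complex.mul_conj, Complex.normSq_eq_norm_sq, hw]; push_cast; rfl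
      rw [this]; simp only [map_sub]; ring
    rw [h1, norm_div, norm_mul, hw, RCLike.norm_conj, Complex.norm_real, Real.norm_of_nonneg hR.le]
    field_simp
  have hGc : ‖G c‖ ≤ rexp L * ‖f c‖ := by
    refine Complex.norm_le_of_forall_mem_frontier_norm_le Metric.isBounded_ball
      (hGd.diffContOnCl (s := Metric.ball c R)) (fun z hz ↦ hGs z ?_) (subset_closure (Metric.mem_ball_self hR))
    rwa [frontier_ball c hR.ne'] at hz
  have h2 : ‖f c‖ * (R / r) ^ (∑ a ∈ S, m a) ≤ ‖G c‖ := by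
    rw [hfg c, hG]
    simp only [norm_mul, norm_prod, norm_pow, sub_self, mul_zero, sub_zero]
    rw [mul_right_comm]
    gcongr
    rw [← Finset.prod_pow_eq_pow_sum, ← Finset.prod_mul_distrib]
    refine Finset.prod_le_prod (fun a _ ↦ by positivity) fun a ha ↦ ?_
    rw [← mul_pow]
    have h3 : ‖c - a‖ ≤ r := by
      have := hS a ha; rw [Metric.mem_closedBall, dist_comm, dist_eq_norm] at this; exact this
    have : ‖((R : ℂ) ^ 2) / R‖ = R := by
      rw [norm_div, norm_pow, Complex.norm_real, Real.norm_of_nonneg hR.le]; field_simp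
    rw [this]
    gcongr
    calc ‖c - a‖ * (R / r) ≤ r * (R / r) := by gcongr
      _ = R := by field_simp
  have h3 : (R / r) ^ (∑ a ∈ S, m a) ≤ rexp L := by
    have := h2.trans hGc
    rw [mul_comm] at this
    exact le_of_mul_le_mul_right this hfcp
  have h4 := Real.log_le_log (by positivity) h3
  rw [Real.log_exp, Real.log_pow] at h4
  exact_mod_cast h4

/-- The logarithmic derivative of an entire function is approximated by the sum over nearby
zeros. -/
theorem exists_norm_logDeriv_sub_sum_le {r' r R : ℝ} (hr' : 0 < r') (hr'r : r' < r) (hrR : r < R)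
    (hq : R - r ≤ r) :
    ∃ K : ℝ, 0 < K ∧ ∀ (f : ℂ → ℂ) (_ : Differentiable ℂ f) (c : ℂ) (L : ℝ) (_ : 0 < L)
      (_ : f c ≠ 0) (_ : ∀ z ∈ Metric.sphere c R, ‖f z‖ ≤ rexp L * ‖f c‖) (S : Finset ℂ)
      (_ : ∀ a ∈ S, a ∈ Metric.closedBall c r)
      (_ : ∀ a ∈ Metric.closedBall c r, f a = 0 → a ∈ S) (z : ℂ) (_ : z ∈ Metric.closedBall c r')
      (_ : f z ≠ 0),
      ‖logDeriv f z - ∑ a ∈ S, (analyticOrderNatAt f a : ℂ) / (z - a)‖ ≤ K * L := by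
  have hr : 0 < r := hr'.trans hr'r
  have hR : 0 < R := hr.trans hrR
  have hRr : 0 < R - r := sub_pos.2 hrR
  set q := r / (R - r) with hqd
  have hq1 : 1 ≤ q := (one_le_div hRr).2 hq
  have hlq : 0 ≤ Real.log q := Real.log_nonneg hq1
  have hlR : 0 < Real.log (R / r) := Real.log_pos ((one_lt_div hr).2 hrR)
  set K₀ := 1 + Real.log q / Real.log (R / r) with hK₀
  have hK₀p : 0 < K₀ := by positivity
  set r₂ := (r' + r) / 2 with hr₂
  have h1 : r' < r₂ := by rw [hr₂]; linarith
  have h2 : r₂ < r := by rw [hr₂]; linarith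
  have hr₂p : 0 < r₂ := hr'.trans h1
  have h1' := sub_pos.2 h1
  have h2' := sub_pos.2 h2
  refine ⟨2 * K₀ * r₂ / (r - r₂) / (r₂ - r'), by positivity, ?_⟩
  intro f hf c L hL hfc hB S hS hS' z hz hfz
  have h0 : f ≠ 0 := fun h ↦ hfc (by simp [h])
  have hn := sum_order_mul_log_le hf hr hrR hfc hB S hS
  obtain ⟨g, hg, hgS, hfg⟩ := exists_eq_prod_mul hf h0 S
  set m := analyticOrderNatAt f
  have hgc : g c ≠ 0 := fun h ↦ hfc (by rw [hfg, h, mul_zero])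
  have hgcp : 0 < ‖g c‖ := norm_pos_iff.2 hgc
  have hgb : ∀ a ∈ Metric.closedBall c r, g a ≠ 0 := by
    intro a ha h
    exact hgS a (hS' a ha (by rw [hfg, h, mul_zero])) h
  have hgs : ∀ w ∈ Metric.sphere c R, ‖g w‖ ≤ rexp (K₀ * L) * ‖g c‖ := by
    intro w hw
    have hw' : ‖w - c‖ = R := by simpa [dist_eq_norm] using hw
    have e1 : (R - r) ^ (∑ a ∈ S, m a) * ‖g w‖ ≤ ‖f w‖ := by
      rw [hfg w, norm_mul, norm_prod, ← Finset.prod_pow_eq_pow_sum]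
      gcongr with a ha
      rw [norm_pow]
      gcongr
      have h3 : ‖a - c‖ ≤ r := by simpa [dist_eq_norm] using hS a ha
      have h4 : ‖w - c‖ ≤ ‖w - a‖ + ‖a - c‖ := norm_sub_le_norm_sub_add_norm_sub _ _ _
      linarith
    have e2 : ‖f c‖ ≤ r ^ (∑ a ∈ S, m a) * ‖g c‖ := by
      rw [hfg c, norm_mul, norm_prod, ← Finset.prod_pow_eq_pow_sum]
      gcongr with a ha
      rw [norm_pow]
      gcongr
      have := hS a ha; rwa [Metric.mem_closedBall, dist_comm, dist_eq_norm] at this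
    have e3 : q ^ (∑ a ∈ S, m a) ≤ rexp ((K₀ - 1) * L) := by
      rw [← Real.log_le_iff_le_exp (by positivity), Real.log_pow]
      push_cast
      have : (K₀ - 1) * L = L / Real.log (R / r) * Real.log q := by rw [hK₀]; ring
      rw [this]
      gcongr
      rwa [le_div_iff₀ hlR]
    have e4 : (R - r) ^ (∑ a ∈ S, m a) * ‖g w‖ ≤
        (R - r) ^ (∑ a ∈ S, m a) * (rexp (K₀ * L) * ‖g c‖) := by
      calc _ ≤ ‖f w‖ := e1
        _ ≤ rexp L * ‖f c‖ := hB w hw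
        _ ≤ rexp L * (r ^ (∑ a ∈ S, m a) * ‖g c‖) := by gcongr
        _ = (R - r) ^ (∑ a ∈ S, m a) * (rexp L * (q ^ (∑ a ∈ S, m a)) * ‖g c‖) := by
          rw [hqd, div_pow]; field_simp
        _ ≤ (R - r) ^ (∑ a ∈ S, m a) * (rexp L * rexp ((K₀ - 1) * L) * ‖g c‖) := by gcongr
        _ = _ := by rw [← Real.exp_add]; ring_nf
    exact le_of_mul_le_mul_left e4 (by positivity)
  have hgball : ∀ w ∈ Metric.ball c R, ‖g w‖ ≤ rexp (K₀ * L) * ‖g c‖ := by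
    intro w hw
    refine Complex.norm_le_of_forall_mem_frontier_norm_le Metric.isBounded_ball
      (hg.diffContOnCl (s := Metric.ball c R)) (fun z hz ↦ hgs z ?_) (subset_closure hw)
    rwa [frontier_ball c hR.ne'] at hz
  have hgb' : ∀ a ∈ Metric.ball c r, g a ≠ 0 := fun a ha ↦ hgb a (Metric.ball_subset_closedBall ha)
  have hld : DifferentiableOn ℂ (fun w ↦ deriv g w / g w) (Metric.ball c r) := fun w hw ↦
    ((hg.analyticAt w).deriv.differentiableAt.div (hg w) (hgb' w hw)).differentiableWithinAt
  obtain ⟨h, hhc, hh⟩ := hld.isExactOn_ball.with_val_at c 0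
  have hexp : ∀ w ∈ Metric.ball c r, g w = g c * Complex.exp (h w) := by
    have hder : ∀ w ∈ Metric.ball c r, HasDerivAt (fun w ↦ g w * Complex.exp (-h w)) 0 w := by
      intro w hw
      have h3 := ((hg w).hasDerivAt).mul ((hh w hw).neg.cexp)
      refine h3.congr_deriv ?_
      have := hgb' w hw
      field_simp
      ring
    intro w hw
    have h3 := (convex_ball c r).is_const_of_fderivWithin_eq_zero (𝕜 := ℂ)
      (f := fun w ↦ g w * Complex.exp (-h w))
      (fun w hw ↦ (hder w hw).differentiableAt.differentiableWithinAt)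
      (fun w hw ↦ by
        rw [fderivWithin_of_isOpen Metric.isOpen_ball hw]
        ext; simp [(hder w hw).deriv]) hw (Metric.mem_ball_self hr)
    simp only [hhc, neg_zero, Complex.exp_zero, mul_one] at h3
    rw [← h3, mul_assoc, ← Complex.exp_add]; simp
  have hre : ∀ w ∈ Metric.ball c r, (h w).re ≤ K₀ * L := by
    intro w hw
    have h3 := hgball w (Metric.ball_subset_ball hrR.le hw)
    rw [hexp w hw, norm_mul, Complex.norm_exp, mul_comm] at h3
    exact Real.exp_le_exp.1 (le_of_mul_le_mul_right h3 hgcp)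
  have hbc : ∀ w ∈ Metric.closedBall c r₂, ‖h w‖ ≤ 2 * K₀ * r₂ / (r - r₂) * L := by
    intro w hw
    have hw2 : ‖w - c‖ ≤ r₂ := by simpa [dist_eq_norm] using hw
    have h3 := Complex.borelCaratheodory_zero (f := fun x ↦ h (c + x)) (M := K₀ * L) (R := r)
      (z := w - c) (by positivity) ?_ ?_ hr (by rw [mem_ball_zero_iff]; linarith) (by simpa using hhc)
    · simp only [add_sub_cancel] at h3
      refine h3.trans ?_
      have h5 : 0 < r - ‖w - c‖ := by linarith
      calc 2 * (K₀ * L) * ‖w - c‖ / (r - ‖w - c‖) ≤ 2 * (K₀ * L) * r₂ / (r - r₂) := by gcongr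
        _ = _ := by ring
    · intro x hx
      have : c + x ∈ Metric.ball c r := by simpa [dist_eq_norm] using hx
      exact ((hh _ this).differentiableAt.comp x (by fun_prop)).differentiableWithinAt
    · intro x hx
      have : c + x ∈ Metric.ball c r := by simpa [dist_eq_norm] using hx
      exact hre _ this
  have hz' : ‖z - c‖ ≤ r' := by simpa [dist_eq_norm] using hz
  have hzr : z ∈ Metric.ball c r := by rw [mem_ball_iff_norm]; linarith
  have hsub : ∀ w ∈ Metric.closedBall z (r₂ - r'), w ∈ Metric.closedBall c r₂ := by
    intro w hw
    rw [mem_closedBall_iff_norm] at hw ⊢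
    have : ‖w - c‖ ≤ ‖w - z‖ + ‖z - c‖ := norm_sub_le_norm_sub_add_norm_sub _ _ _
    linarith
  have hdh : ‖deriv h z‖ ≤ 2 * K₀ * r₂ / (r - r₂) * L / (r₂ - r') := by
    refine Complex.norm_deriv_le_of_forall_mem_sphere_norm_le h1' ?_ fun w hw ↦
      hbc w (hsub w (Metric.sphere_subset_closedBall hw))
    refine DifferentiableOn.diffContOnCl fun w hw ↦ ?_
    have hw1 := hsub w (Metric.closure_ball_subset_closedBall hw)
    exact (hh w (Metric.closedBall_subset_ball h2 hw1)).differentiableAt.differentiableWithinAt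
  have hgz := hgb' z hzr
  have hza : ∀ a ∈ S, (z - a) ^ m a ≠ 0 := fun a ha h ↦ by
    apply hfz; rw [hfg, Finset.prod_eq_zero ha h, zero_mul]
  have hlog : logDeriv f z = ∑ a ∈ S, (m a : ℂ) / (z - a) + logDeriv g z := by
    have e : f = fun z ↦ (∏ a ∈ S, (z - a) ^ m a) * g z := funext hfg
    rw [e, logDeriv_mul z (Finset.prod_ne_zero_iff.2 hza) hgz
      (DifferentiableAt.fun_finsetProd fun a _ ↦ by fun_prop) (hg z),
      logDeriv_prod hza (fun a _ ↦ by fun_prop)]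
    congr 1
    refine Finset.sum_congr rfl fun a _ ↦ ?_
    rw [logDeriv_fun_pow (by fun_prop)]
    simp [logDeriv_apply, div_eq_mul_inv]
  rw [hlog, add_sub_cancel_left, logDeriv_apply, ← (hh z hzr).deriv]
  refine hdh.trans (le_of_eq ?_)
  ring

/-- The point `1/2 + iγ` of the critical line. -/
noncomputable def criticalPoint (γ : ℝ) : ℂ := 1 / 2 + γ * Complex.I

@[simp] theorem criticalPoint_re (γ : ℝ) : (criticalPoint γ).re = 1 / 2 := by
  simp [criticalPoint]

@[simp] theorem criticalPoint_im (γ : ℝ) : (criticalPoint γ).im = γ := by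
  simp [criticalPoint]

theorem criticalPoint_injective : Function.Injective criticalPoint := fun a b h ↦ by
  simpa using congrArg Complex.im h

theorem criticalPoint_ne_zero (γ : ℝ) : criticalPoint γ ≠ 0 := fun h ↦ by
  simpa using congrArg Complex.re h

/-- The multiplicity of the zero `1/2 + iγ` of `ζ`. -/
noncomputable def zetaOrd (γ : ℝ) : ℕ := analyticOrderNatAt riemannZeta₁ (criticalPoint γ)

/-- The ordinates of the zeros of `ζ` on the critical line. -/
def zetaOrdinates : Set ℝ := {γ | riemannZeta₁ (criticalPoint γ) = 0}

theorem riemannZeta₁_eq_mul {s : ℂ} (hs : s ≠ 1) : riemannZeta₁ s = (s - 1) * riemannZeta s := by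
  rw [riemannZeta_eq_inv_sub_mul hs]
  have := sub_ne_zero.2 hs
  field_simp

theorem riemannZeta_eq_zero_of_riemannZeta₁ {s : ℂ} (h : riemannZeta₁ s = 0) :
    s ≠ 1 ∧ riemannZeta s = 0 := by
  have h1 : s ≠ 1 := by
    rintro rfl
    simp [riemannZeta₁_one] at h
  refine ⟨h1, ?_⟩
  rw [riemannZeta_eq_inv_sub_mul h1, h, mul_zero]

theorem mem_zetaOrdinates_iff {γ : ℝ} : γ ∈ zetaOrdinates ↔ riemannZeta (criticalPoint γ) = 0 := by
  refine ⟨fun h ↦ (riemannZeta_eq_zero_of_riemannZeta₁ h).2, fun h ↦ ?_⟩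
  have : criticalPoint γ ≠ 1 := fun h ↦ by
    have := congrArg Complex.re h
    norm_num at this
  rw [zetaOrdinates, mem_ofPred_eq, riemannZeta₁_eq_mul this, h, mul_zero]

theorem zetaOrd_eq_zero {γ : ℝ} (h : γ ∉ zetaOrdinates) : zetaOrd γ = 0 := by
  have : analyticOrderAt riemannZeta₁ (criticalPoint γ) = 0 :=
    analyticOrderAt_eq_zero.2 (Or.inr h)
  simp [zetaOrd, analyticOrderNatAt, this]

theorem finite_zetaOrdinates_Icc (a b : ℝ) : (zetaOrdinates ∩ Icc a b).Finite := by
  have hc : IsCompact (criticalPoint '' Icc a b) := by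
    refine isCompact_Icc.image ?_
    unfold criticalPoint
    fun_prop
  refine Set.Finite.of_finite_image (f := criticalPoint) (hc.inter_riemannZetaZeros_finite.subset ?_)
    criticalPoint_injective.injOn
  rintro _ ⟨γ, ⟨h1, h2⟩, rfl⟩
  exact ⟨mem_image_of_mem _ h2, mem_zetaOrdinates_iff.1 h1⟩

theorem countable_zetaOrdinates : zetaOrdinates.Countable := by
  have : zetaOrdinates = ⋃ n : ℕ, zetaOrdinates ∩ Icc (-(n : ℝ)) n := by
    ext γ
    simp only [mem_iUnion, mem_inter_iff, mem_Icc, exists_and_left]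
    refine ⟨fun h ↦ ⟨h, ?_⟩, fun h ↦ h.1⟩
    obtain ⟨n, hn⟩ := exists_nat_ge |γ|
    exact ⟨n, abs_le.1 hn⟩
  rw [this]
  exact countable_iUnion fun n ↦ (finite_zetaOrdinates_Icc _ _).countable

theorem re_eq_half_of_riemannZeta₁_eq_zero (hRH : RiemannHypothesis) {s : ℂ} (hs : 0 < s.re)
    (h : riemannZeta₁ s = 0) : s.re = 1 / 2 := by
  obtain ⟨h1, h2⟩ := riemannZeta_eq_zero_of_riemannZeta₁ h
  refine hRH s h2 ?_ h1
  rintro ⟨n, rfl⟩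
  have : (-2 * ((n : ℂ) + 1)).re = -2 * (n + 1) := by simp
  rw [this] at hs
  have : (0 : ℝ) ≤ n := n.cast_nonneg
  linarith

theorem zero_notMem_zetaOrdinates : (0 : ℝ) ∉ zetaOrdinates := by
  intro h
  apply riemannZeta₁_half_ne_zero
  simpa [zetaOrdinates, criticalPoint] using h

theorem neg_mem_zetaOrdinates {γ : ℝ} (h : γ ∈ zetaOrdinates) : -γ ∈ zetaOrdinates := by
  rw [mem_zetaOrdinates_iff] at h ⊢
  have : criticalPoint (-γ) = (starRingEnd ℂ) (criticalPoint γ) := by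
    apply Complex.ext <;> simp
  rw [this, riemannZeta_conj, h, map_zero]

/-- The ordinates of zeros close to height `t`. -/
noncomputable def zetaNear (t : ℝ) : Finset ℝ :=
  (finite_zetaOrdinates_Icc (t - 5 / 8) (t + 5 / 8)).toFinset

theorem mem_zetaNear {t γ : ℝ} : γ ∈ zetaNear t ↔ γ ∈ zetaOrdinates ∧ |γ - t| ≤ 5 / 8 := by
  simp only [zetaNear, Finite.mem_toFinset, mem_inter_iff, mem_Icc, abs_le]
  refine and_congr_right fun _ ↦ ⟨fun h ↦ ⟨by linarith [h.1], by linarith [h.2]⟩,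
    fun h ↦ ⟨by linarith [h.1], by linarith [h.2]⟩⟩

theorem exists_zero_estimates (hRH : RiemannHypothesis) : ∃ C : ℝ, 1 ≤ C ∧ ∀ t : ℝ,
    (∑ γ ∈ zetaNear t, (zetaOrd γ : ℝ)) ≤ C * (1 + |t|) ^ (1 / 4 : ℝ) ∧
    ∀ x : ℝ, 1 / 2 < x → x ≤ 3 / 2 →
      ‖logDeriv riemannZeta₁ (x + t * Complex.I) -
        ∑ γ ∈ zetaNear t, (zetaOrd γ : ℂ) / (x + t * Complex.I - criticalPoint γ)‖ ≤
          C * (1 + |t|) ^ (1 / 4 : ℝ) := by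
  obtain ⟨K, hK, hmain⟩ := exists_norm_logDeriv_sub_sum_le (r' := 3 / 2) (r := 13 / 8) (R := 15 / 8)
    (by norm_num) (by norm_num) (by norm_num) (by norm_num)
  have hlog : 0 < Real.log ((15 / 8) / (13 / 8)) := Real.log_pos (by norm_num)
  set A : ℝ := 675 ^ (1 / 8 : ℝ) / (1 / 8) with hA
  have hA0 : 0 < A := by positivity
  refine ⟨max 1 (max (K * A) (A / Real.log ((15 / 8) / (13 / 8)))), le_max_left _ _, fun t ↦ ?_⟩
  set C := max 1 (max (K * A) (A / Real.log ((15 / 8) / (13 / 8))))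
  have hC1 : K * A ≤ C := (le_max_left _ _).trans (le_max_right _ _)
  have hC2 : A / Real.log ((15 / 8) / (13 / 8)) ≤ C := (le_max_right _ _).trans (le_max_right _ _)
  set L := Real.log (27 * (5 + |t|) ^ 2) with hL
  have ht := abs_nonneg t
  have hbig : 1 < 27 * (5 + |t|) ^ 2 := by nlinarith
  have hL0 : 0 < L := Real.log_pos hbig
  have hexpL : rexp L = 27 * (5 + |t|) ^ 2 := Real.exp_log (by positivity)
  have hLA : L ≤ A * (1 + |t|) ^ (1 / 4 : ℝ) := by
    have h1 : 27 * (5 + |t|) ^ 2 ≤ 675 * (1 + |t|) ^ 2 := by nlinarith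
    calc L ≤ Real.log (675 * (1 + |t|) ^ 2) := Real.log_le_log (by positivity) h1
      _ ≤ (675 * (1 + |t|) ^ 2) ^ (1 / 8 : ℝ) / (1 / 8) :=
        Real.log_le_rpow_div (by positivity) (by norm_num)
      _ = A * (1 + |t|) ^ (1 / 4 : ℝ) := by
        rw [Real.mul_rpow (by norm_num) (by positivity), ← Real.rpow_natCast,
          ← Real.rpow_mul (by positivity), hA]
        norm_num
        ring
  set c : ℂ := 2 + t * Complex.I with hc
  have hcn : 1 / 3 ≤ ‖riemannZeta₁ c‖ := norm_riemannZeta₁_two_add_ge t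
  have hc0 : riemannZeta₁ c ≠ 0 := norm_pos_iff.1 (by linarith)
  have hB : ∀ z ∈ Metric.sphere c (15 / 8), ‖riemannZeta₁ z‖ ≤ rexp L * ‖riemannZeta₁ c‖ := by
    intro z hz
    have hz' : ‖z - c‖ = 15 / 8 := by simpa [dist_eq_norm] using hz
    have h1 : 1 / 8 ≤ z.re := by
      have h2 := (abs_le.1 (Complex.abs_re_le_norm (z - c))).1
      simp [hc] at h2
      have : (z - c).re = z.re - 2 := by simp [hc]
      rw [hz'] at h2
      linarith
    have h2 : ‖z‖ ≤ 4 + |t| := by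
      have h3 : ‖c‖ ≤ 2 + |t| := by
        refine (norm_add_le _ _).trans ?_
        simp
      have : ‖z‖ ≤ ‖z - c‖ + ‖c‖ := by simpa using norm_add_le (z - c) c
      linarith
    have h3 := norm_riemannZeta₁_le (s := z) (by linarith)
    rw [hexpL]
    have h4 : ‖z‖ * (‖z‖ + 1) / z.re ≤ 8 * (‖z‖ * (‖z‖ + 1)) := by
      rw [div_le_iff₀ (by linarith)]
      have : 0 ≤ ‖z‖ * (‖z‖ + 1) := by positivity
      nlinarith
    have h5 := norm_nonneg z
    calc ‖riemannZeta₁ z‖ ≤ 9 * (5 + |t|) ^ 2 := by nlinarith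
      _ = 27 * (5 + |t|) ^ 2 * (1 / 3) := by ring
      _ ≤ _ := by gcongr
  classical
  set S : Finset ℂ := (zetaNear t).image criticalPoint with hS
  have hdist : ∀ γ : ℝ, ‖criticalPoint γ - c‖ ^ 2 = 9 / 4 + (γ - t) ^ 2 := by
    intro γ
    rw [← Complex.normSq_eq_norm_sq, Complex.normSq_apply]
    simp [hc]
    ring
  have hSin : ∀ a ∈ S, a ∈ Metric.closedBall c (13 / 8) := by
    intro a ha
    obtain ⟨γ, hγ, rfl⟩ := Finset.mem_image.1 ha
    rw [mem_closedBall_iff_norm]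
    refine le_of_sq_le_sq ?_ (by norm_num)
    rw [hdist]
    have := (sq_le_sq₀ (abs_nonneg _) (by norm_num)).2 (mem_zetaNear.1 hγ).2
    rw [sq_abs] at this
    linarith
  have hSz : ∀ a ∈ Metric.closedBall c (13 / 8), riemannZeta₁ a = 0 → a ∈ S := by
    intro a ha h0
    rw [mem_closedBall_iff_norm] at ha
    have h1 : 0 < a.re := by
      have h2 := (abs_le.1 (Complex.abs_re_le_norm (a - c))).1
      have : (a - c).re = a.re - 2 := by simp [hc]
      linarith
    have h2 := re_eq_half_of_riemannZeta₁_eq_zero hRH h1 h0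
    have h3 : a = criticalPoint a.im := by
      apply Complex.ext <;> simp [h2]
    rw [hS, h3, Finset.mem_image]
    refine ⟨a.im, mem_zetaNear.2 ⟨by rw [h3] at h0; exact h0, ?_⟩, rfl⟩
    refine abs_le_of_sq_le_sq ?_ (by norm_num)
    have h4 := hdist a.im
    rw [← h3] at h4
    have := (sq_le_sq₀ (norm_nonneg _) (by norm_num)).2 ha
    nlinarith
  constructor
  · have h1 := sum_order_mul_log_le differentiable_riemannZeta₁ (r := 13 / 8) (R := 15 / 8)
      (by norm_num) (by norm_num) hc0 hB S hSin
    rw [hS, Finset.sum_image criticalPoint_injective.injOn, ← le_div_iff₀ hlog] at h1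
    calc _ ≤ L / Real.log ((15 / 8) / (13 / 8)) := h1
      _ ≤ A * (1 + |t|) ^ (1 / 4 : ℝ) / Real.log ((15 / 8) / (13 / 8)) := by gcongr
      _ = A / Real.log ((15 / 8) / (13 / 8)) * (1 + |t|) ^ (1 / 4 : ℝ) := by ring
      _ ≤ _ := by gcongr
  · intro x hx1 hx2
    have h1 := hmain riemannZeta₁ differentiable_riemannZeta₁ c L hL0 hc0 hB S hSin hSz
      (x + t * Complex.I) ?_ ?_
    · rw [hS, Finset.sum_image criticalPoint_injective.injOn] at h1
      calc _ ≤ K * L := h1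
        _ ≤ K * (A * (1 + |t|) ^ (1 / 4 : ℝ)) := by gcongr
        _ = (K * A) * (1 + |t|) ^ (1 / 4 : ℝ) := by ring
        _ ≤ _ := by gcongr
    · rw [mem_closedBall_iff_norm, hc]
      have : (x : ℂ) + t * Complex.I - (2 + t * Complex.I) = ((x - 2 : ℝ) : ℂ) := by push_cast; ring
      rw [this, Complex.norm_real, Real.norm_eq_abs, abs_le]
      constructor <;> linarith
    · intro h
      have := re_eq_half_of_riemannZeta₁_eq_zero hRH (by simp; linarith) h
      simp at this
      linarith

theorem ofReal_exp_cpow (u : ℝ) (z : ℂ) : ((rexp u : ℝ) : ℂ) ^ z = Complex.exp (u * z) := by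
  rw [Complex.cpow_def_of_ne_zero (by exact_mod_cast (Real.exp_pos u).ne'),
    ← Complex.ofReal_log (Real.exp_pos u).le, Real.log_exp]

theorem integral_Ioi_one_eq {E : Type*} [NormedAddCommGroup E] [NormedSpace ℝ E] (F : ℝ → E) :
    ∫ x in Ioi (1 : ℝ), F x = ∫ u in Ioi (0 : ℝ), rexp u • F (rexp u) := by
  have him : rexp '' Ioi 0 = Ioi 1 := by
    ext x
    simp only [mem_image, mem_Ioi]
    refine ⟨?_, fun h ↦ ⟨Real.log x, Real.log_pos h, Real.exp_log (by linarith)⟩⟩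
    rintro ⟨u, hu, rfl⟩
    exact Real.one_lt_exp_iff.2 hu
  rw [← him, integral_image_eq_integral_abs_deriv_smul measurableSet_Ioi
    (fun x _ ↦ (Real.hasDerivAt_exp x).hasDerivWithinAt) Real.exp_injective.injOn]
  simp only [abs_exp]

theorem measurable_psi : Measurable Chebyshev.psi := Chebyshev.psi_mono.measurable

theorem norm_psi_mul_le {u : ℝ} : Chebyshev.psi (rexp u) ≤ (Real.log 4 + 4) * rexp u :=
  Chebyshev.psi_le_const_mul_self (Real.exp_pos u).le

/-- The normalised error term of the prime number theorem in logarithmic scale. -/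
noncomputable def psiErr (u : ℝ) : ℝ := (Chebyshev.psi (rexp u) - rexp u) * rexp (-(u / 2))

theorem measurable_psiErr : Measurable psiErr := by
  unfold psiErr
  have := measurable_psi
  fun_prop

theorem abs_psiErr_le (u : ℝ) : |psiErr u| ≤ 9 * rexp (u / 2) := by
  have h1 := norm_psi_mul_le (u := u)
  have h2 := Chebyshev.psi_nonneg (rexp u)
  have h3 := Real.exp_pos u
  have h4 : Real.log 4 ≤ 3 := by
    have := Real.log_le_sub_one_of_pos (show (0 : ℝ) < 4 by norm_num)
    linarith
  have h5 : |Chebyshev.psi (rexp u) - rexp u| ≤ 9 * rexp u := by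
    rw [abs_le]
    constructor <;> nlinarith
  rw [psiErr, abs_mul, abs_exp]
  calc _ ≤ 9 * rexp u * rexp (-(u / 2)) := by gcongr
    _ = 9 * (rexp u * rexp (-(u / 2))) := by ring
    _ = _ := by rw [← Real.exp_add]; ring_nf

theorem integral_psi_mul_cexp {w : ℂ} (hw : 1 < w.re) :
    ∫ u in Ioi (0 : ℝ), (Chebyshev.psi (rexp u) : ℂ) * Complex.exp (-w * u) =
      (-deriv riemannZeta w / riemannZeta w) / w := by
  have hw0 : w ≠ 0 := fun h ↦ by rw [h] at hw; norm_num at hw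
  have h := LSeries_eq_mul_integral_of_nonneg (fun n ↦ ArithmeticFunction.vonMangoldt n)
    zero_le_one hw ?_ (fun n ↦ ArithmeticFunction.vonMangoldt_nonneg)
  · rw [ArithmeticFunction.LSeries_vonMangoldt_eq_deriv_riemannZeta_div hw] at h
    rw [h, mul_div_cancel_left₀ _ hw0, integral_Ioi_one_eq]
    refine setIntegral_congr_fun measurableSet_Ioi fun u _ ↦ ?_
    have h1 : (∑ k ∈ Finset.Icc 1 ⌊rexp u⌋₊, ((ArithmeticFunction.vonMangoldt k : ℝ) : ℂ)) =
        Chebyshev.psi (rexp u) := by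
      rw [Chebyshev.psi]
      push_cast
      rfl
    simp only [h1, ofReal_exp_cpow, Complex.real_smul]
    rw [mul_left_comm, Complex.ofReal_exp, ← Complex.exp_add]
    congr 2
    ring
  · refine Asymptotics.IsBigO.of_bound (Real.log 4 + 4) (Eventually.of_forall fun n ↦ ?_)
    have h1 := Chebyshev.psi_le_const_mul_self (x := n) n.cast_nonneg
    have h2 := Chebyshev.psi_nonneg n
    have h3 : ∑ k ∈ Finset.Icc 1 n, ArithmeticFunction.vonMangoldt k = Chebyshev.psi n := by
      rw [Chebyshev.psi, Nat.floor_natCast]; rfl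
    rw [h3, Real.rpow_one, Real.norm_of_nonneg h2, Real.norm_of_nonneg n.cast_nonneg]
    exact h1

theorem logDeriv_riemannZeta₁ {w : ℂ} (hw : 1 < w.re) :
    logDeriv riemannZeta₁ w = 1 / (w - 1) + deriv riemannZeta w / riemannZeta w := by
  have hw1 : w ≠ 1 := fun h ↦ by rw [h] at hw; norm_num at hw
  have h1 : riemannZeta₁ =ᶠ[nhds w] fun s ↦ (s - 1) * riemannZeta s := by
    filter_upwards [isOpen_ne.mem_nhds hw1] with s hs using riemannZeta₁_eq_mul hs
  rw [(logDeriv_congr_nhds h1).self_of_nhds, logDeriv_mul (f := fun s : ℂ ↦ s - 1) w (sub_ne_zero.2 hw1)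
    (riemannZeta_ne_zero_of_one_le_re hw.le) (by fun_prop) (differentiableAt_riemannZeta hw1)]
  simp [logDeriv_apply]

/-- The Laplace transform of `psiErr`. -/
theorem integral_psiErr_mul_cexp {s : ℂ} (hs : 1 / 2 < s.re) :
    IntegrableOn (fun u : ℝ ↦ (psiErr u : ℂ) * Complex.exp (-s * u)) (Ioi 0) ∧
    ∫ u in Ioi (0 : ℝ), (psiErr u : ℂ) * Complex.exp (-s * u) =
      -(1 / (s + 1 / 2)) * (logDeriv riemannZeta₁ (s + 1 / 2) + 1) := by
  set w := s + 1 / 2 with hw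
  have hwr : w.re = s.re + 1 / 2 := by simp [hw]
  have hw1 : 1 < w.re := by linarith
  have hw0 : w ≠ 0 := fun h ↦ by rw [h] at hw1; norm_num at hw1
  have hw1' : w - 1 ≠ 0 := fun h ↦ by
    rw [sub_eq_zero] at h; rw [h] at hw1; norm_num at hw1
  have hre : (1 - w).re < 0 := by simp; linarith
  have i1 := integrableOn_exp_mul_complex_Ioi hre 0
  have e1 := integral_exp_mul_complex_Ioi hre 0
  have i2 : IntegrableOn (fun u : ℝ ↦ (Chebyshev.psi (rexp u) : ℂ) * Complex.exp (-w * u))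
      (Ioi 0) := by
    refine Integrable.mono' (g := fun u ↦ (Real.log 4 + 4) * rexp ((1 - w).re * u))
      ((integrableOn_exp_mul_Ioi hre 0).const_mul _) ?_ (Eventually.of_forall fun u ↦ ?_)
    · have := measurable_psi
      exact (by fun_prop : Measurable fun u : ℝ ↦
        (Chebyshev.psi (rexp u) : ℂ) * Complex.exp (-w * u)).aestronglyMeasurable
    · rw [norm_mul, Complex.norm_real, Real.norm_of_nonneg (Chebyshev.psi_nonneg _),
        Complex.norm_exp]
      have : (-w * u).re = (1 - w).re * u - u := by simp; ring
      rw [this, Real.exp_sub]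
      calc _ ≤ (Real.log 4 + 4) * rexp u * (rexp ((1 - w).re * u) / rexp u) := by
            gcongr; exact norm_psi_mul_le
        _ = _ := by field_simp
  have he : ∀ u : ℝ, (psiErr u : ℂ) * Complex.exp (-s * u) =
      (Chebyshev.psi (rexp u) : ℂ) * Complex.exp (-w * u) - Complex.exp ((1 - w) * u) := by
    intro u
    rw [psiErr]
    push_cast
    rw [mul_assoc, ← Complex.exp_add, sub_mul, ← Complex.exp_add, hw]
    congr 2 <;> ring_nf
  simp only [he]
  refine ⟨i2.sub i1, ?_⟩
  rw [integral_sub i2 i1, e1, integral_psi_mul_cexp hw1, logDeriv_riemannZeta₁ hw1]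
  have h1w : 1 - w ≠ 0 := by rw [← neg_sub]; exact neg_ne_zero.2 hw1'
  have hz := riemannZeta_ne_zero_of_one_le_re hw1.le
  simp only [Complex.ofReal_zero, mul_zero, Complex.exp_zero]
  field_simp
  ring

/-- The coefficient of `e^{iγu}` in the explicit formula. -/
noncomputable def zetaCoeff (γ : ℝ) : ℂ := -(zetaOrd γ) / criticalPoint γ

/-- The trigonometric polynomial over a finite set of ordinates. -/
noncomputable def zetaPoly (T : Finset ℝ) (u : ℝ) : ℂ :=
  ∑ γ ∈ T, zetaCoeff γ * Complex.exp (γ * Complex.I * u)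

theorem continuous_zetaPoly (T : Finset ℝ) : Continuous (zetaPoly T) := by
  unfold zetaPoly
  fun_prop

theorem norm_zetaPoly_le (T : Finset ℝ) (u : ℝ) : ‖zetaPoly T u‖ ≤ ∑ γ ∈ T, ‖zetaCoeff γ‖ := by
  refine (norm_sum_le _ _).trans (Finset.sum_le_sum fun γ _ ↦ ?_)
  rw [norm_mul, Complex.norm_exp]
  simp

/-- The explicit formula remainder. -/
noncomputable def psiRem (T : Finset ℝ) (u : ℝ) : ℂ :=
  if 0 ≤ u then (psiErr u : ℂ) - zetaPoly T u else 0

/-- The Laplace transform of `psiRem`. -/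
noncomputable def psiRemLaplace (T : Finset ℝ) (s : ℂ) : ℂ :=
  -(1 / (s + 1 / 2)) * (logDeriv riemannZeta₁ (s + 1 / 2) + 1) -
    ∑ γ ∈ T, zetaCoeff γ / (s - γ * Complex.I)

theorem measurable_psiRem (T : Finset ℝ) : Measurable (psiRem T) := by
  unfold psiRem
  have := measurable_psiErr
  have := (continuous_zetaPoly T).measurable
  exact Measurable.ite measurableSet_Ici (by fun_prop) measurable_const

theorem norm_psiRem_le (T : Finset ℝ) {u : ℝ} (hu : 0 ≤ u) :
    ‖psiRem T u‖ ≤ (9 + ∑ γ ∈ T, ‖zetaCoeff γ‖) * rexp (u / 2) := by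
  rw [psiRem, if_pos hu]
  have h0 : 0 ≤ ∑ γ ∈ T, ‖zetaCoeff γ‖ := Finset.sum_nonneg fun _ _ ↦ norm_nonneg _
  have h1 : 1 ≤ rexp (u / 2) := Real.one_le_exp (by linarith)
  calc _ ≤ ‖(psiErr u : ℂ)‖ + ‖zetaPoly T u‖ := norm_sub_le _ _
    _ ≤ 9 * rexp (u / 2) + ∑ γ ∈ T, ‖zetaCoeff γ‖ := by
      gcongr
      · rw [Complex.norm_real]; exact abs_psiErr_le u
      · exact norm_zetaPoly_le T u
    _ ≤ _ := by nlinarith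

theorem psiRemLaplace_eq_integral (T : Finset ℝ) {s : ℂ} (hs : 1 / 2 < s.re) :
    psiRemLaplace T s = ∫ u : ℝ, psiRem T u * Complex.exp (-s * u) := by
  obtain ⟨i1, e1⟩ := integral_psiErr_mul_cexp hs
  have hre : ∀ γ : ℝ, (γ * Complex.I - s).re < 0 := fun γ ↦ by simp; linarith
  have i2 : ∀ γ ∈ T, IntegrableOn (fun u : ℝ ↦
      zetaCoeff γ * Complex.exp ((γ * Complex.I - s) * u)) (Ioi 0) := fun γ _ ↦
    (integrableOn_exp_mul_complex_Ioi (hre γ) 0).const_mul _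
  have h1 : ∫ u : ℝ, psiRem T u * Complex.exp (-s * u) = ∫ u in Ioi (0 : ℝ),
      ((psiErr u : ℂ) * Complex.exp (-s * u) -
        ∑ γ ∈ T, zetaCoeff γ * Complex.exp ((γ * Complex.I - s) * u)) := by
    rw [← integral_Ici_eq_integral_Ioi, ← integral_indicator measurableSet_Ici]
    congr 1
    ext u
    rw [indicator_apply, psiRem]
    simp only [mem_Ici]
    split_ifs
    · rw [sub_mul, zetaPoly, Finset.sum_mul]
      congr 1
      refine Finset.sum_congr rfl fun γ _ ↦ ?_
      rw [mul_assoc, ← Complex.exp_add]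
      ring_nf
    · simp
  rw [h1, integral_sub i1 (integrable_finsetSum _ i2), integral_finsetSum _ i2, e1, psiRemLaplace]
  congr 1
  refine Finset.sum_congr rfl fun γ _ ↦ ?_
  rw [integral_const_mul, integral_exp_mul_complex_Ioi (hre γ), ← neg_sub s]
  simp only [Complex.ofReal_zero, mul_zero, Complex.exp_zero, div_neg, neg_div, neg_neg]
  ring

theorem differentiableOn_psiRemLaplace (hRH : RiemannHypothesis) (T : Finset ℝ) :
    DifferentiableOn ℂ (psiRemLaplace T) {s | 0 < s.re} := by
  intro s hs
  rw [mem_ofPred_eq] at hs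
  have h0 : s + 1 / 2 ≠ 0 := fun h ↦ by
    have := congrArg Complex.re h
    simp at this
    linarith
  have h1 : riemannZeta₁ (s + 1 / 2) ≠ 0 := fun h ↦ by
    have := re_eq_half_of_riemannZeta₁_eq_zero hRH (by simp; linarith) h
    simp at this
    linarith
  refine DifferentiableAt.differentiableWithinAt ?_
  have hl : DifferentiableAt ℂ (logDeriv riemannZeta₁) (s + 1 / 2) :=
    (differentiable_riemannZeta₁.analyticAt _).deriv.differentiableAt.div
      (differentiable_riemannZeta₁ _) h1
  have hl' : DifferentiableAt ℂ (fun s : ℂ ↦ logDeriv riemannZeta₁ (s + 1 / 2)) s :=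
    hl.comp s (by fun_prop)
  unfold psiRemLaplace
  refine DifferentiableAt.sub (DifferentiableAt.mul ?_ (hl'.add_const _))
    (DifferentiableAt.fun_sum fun γ _ ↦ ?_)
  · have : DifferentiableAt ℂ (fun s : ℂ ↦ s + 1 / 2) s := by fun_prop
    exact ((differentiableAt_const (1 : ℂ)).fun_div this h0).fun_neg
  · refine (differentiableAt_const _).div (by fun_prop) fun h ↦ ?_
    have := congrArg Complex.re h
    simp at this
    linarith

theorem norm_sub_criticalPoint_sq (x t γ : ℝ) :
    ‖((x + 1 / 2 : ℝ) : ℂ) + t * Complex.I - criticalPoint γ‖ ^ 2 = x ^ 2 + (t - γ) ^ 2 := by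
  rw [← Complex.normSq_eq_norm_sq, Complex.normSq_apply]
  simp
  ring

theorem norm_criticalPoint_ge (γ : ℝ) : 1 / 2 ≤ ‖criticalPoint γ‖ := by
  have := Complex.abs_re_le_norm (criticalPoint γ)
  rw [criticalPoint_re, abs_of_pos (by norm_num)] at this
  exact this

theorem norm_psiRemLaplace_le {C : ℝ} (hC1 : 1 ≤ C) (hC : ∀ t : ℝ, ∀ x : ℝ, 1 / 2 < x → x ≤ 3 / 2 →
      ‖logDeriv riemannZeta₁ (x + t * Complex.I) -
        ∑ γ ∈ zetaNear t, (zetaOrd γ : ℂ) / (x + t * Complex.I - criticalPoint γ)‖ ≤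
          C * (1 + |t|) ^ (1 / 4 : ℝ)) (T : Finset ℝ) {x : ℝ} (hx : 0 < x) (hx1 : x ≤ 1) (t : ℝ) :
    ‖psiRemLaplace T (x + t * Complex.I)‖ ≤ 3 / (1 + |t|) *
      ((2 + 4 * ∑ γ ∈ T, (zetaOrd γ : ℝ)) * (C * (1 + |t|) ^ (1 / 4 : ℝ)) +
        ∑ γ ∈ zetaNear t \ T, (zetaOrd γ : ℝ) / √(x ^ 2 + (t - γ) ^ 2)) := by
  set w : ℂ := ((x + 1 / 2 : ℝ) : ℂ) + t * Complex.I with hw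
  have hsw : (x : ℂ) + t * Complex.I + 1 / 2 = w := by rw [hw]; push_cast; ring
  have hnorm : ∀ γ : ℝ, ‖w - criticalPoint γ‖ = √(x ^ 2 + (t - γ) ^ 2) := fun γ ↦ by
    rw [← norm_sub_criticalPoint_sq, Real.sqrt_sq (norm_nonneg _)]
  have hwρ : ∀ γ : ℝ, w - criticalPoint γ ≠ 0 := fun γ ↦ by
    rw [← norm_pos_iff, hnorm]
    positivity
  have hwn : (1 + |t|) / 3 ≤ ‖w‖ := by
    refine le_of_sq_le_sq ?_ (norm_nonneg _)
    rw [← Complex.normSq_eq_norm_sq, Complex.normSq_apply]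
    simp only [hw, Complex.add_re, Complex.ofReal_re, Complex.mul_re, Complex.I_re, mul_zero,
      Complex.ofReal_im, Complex.I_im, mul_one, sub_self, add_zero, Complex.add_im, Complex.mul_im,
      zero_add]
    have h1 : |t| ^ 2 = t ^ 2 := sq_abs t
    nlinarith [abs_nonneg t, sq_nonneg (|t| - 1 / 8)]
  have hw0 : w ≠ 0 := norm_pos_iff.1 (lt_of_lt_of_le (by positivity) hwn)
  set M := ∑ γ ∈ T, (zetaOrd γ : ℝ) with hM
  have hM0 : 0 ≤ M := Finset.sum_nonneg fun _ _ ↦ Nat.cast_nonneg _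
  set F : ℝ → ℂ := fun γ ↦ (zetaOrd γ : ℂ) / (w - criticalPoint γ) with hF
  set E := logDeriv riemannZeta₁ w - ∑ γ ∈ zetaNear t, F γ with hE
  have hEb : ‖E‖ ≤ C * (1 + |t|) ^ (1 / 4 : ℝ) := by
    have := hC t (x + 1 / 2) (by linarith) (by linarith)
    rwa [← hw] at this
  have key : psiRemLaplace T (x + t * Complex.I) = -(1 / w) * (E + 1 + ∑ γ ∈ zetaNear t \ T, F γ -
      ∑ γ ∈ T \ zetaNear t, F γ - ∑ γ ∈ T, (zetaOrd γ : ℂ) / criticalPoint γ) := by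
    have h1 : ∑ γ ∈ zetaNear t, F γ + ∑ γ ∈ T \ zetaNear t, F γ =
        ∑ γ ∈ T, F γ + ∑ γ ∈ zetaNear t \ T, F γ := by
      have h3 := Finset.sum_inter_add_sum_sdiff (zetaNear t) T F
      have h4 := Finset.sum_inter_add_sum_sdiff T (zetaNear t) F
      rw [Finset.inter_comm] at h4
      linear_combination h4 - h3
    have h2 : ∑ γ ∈ T, zetaCoeff γ / (x + t * Complex.I - γ * Complex.I) =
        -(1 / w) * (∑ γ ∈ T, F γ + ∑ γ ∈ T, (zetaOrd γ : ℂ) / criticalPoint γ) := by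
      rw [← Finset.sum_add_distrib, Finset.mul_sum]
      refine Finset.sum_congr rfl fun γ _ ↦ ?_
      have h3 : (x : ℂ) + t * Complex.I - γ * Complex.I = w - criticalPoint γ := by
        rw [hw, criticalPoint]; push_cast; ring
      have := hwρ γ
      have := criticalPoint_ne_zero γ
      rw [h3, zetaCoeff, hF]
      field_simp
      ring
    rw [psiRemLaplace, hsw, h2]
    rw [show logDeriv riemannZeta₁ w = E + ∑ γ ∈ zetaNear t, F γ by rw [hE]; ring]
    linear_combination (-(1 / w)) * h1
  have b1 : ‖∑ γ ∈ zetaNear t \ T, F γ‖ ≤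
      ∑ γ ∈ zetaNear t \ T, (zetaOrd γ : ℝ) / √(x ^ 2 + (t - γ) ^ 2) := by
    refine (norm_sum_le _ _).trans (le_of_eq (Finset.sum_congr rfl fun γ _ ↦ ?_))
    rw [hF, norm_div, hnorm, Complex.norm_natCast]
  have b2 : ‖∑ γ ∈ T \ zetaNear t, F γ‖ ≤ 2 * M := by
    calc _ ≤ ∑ γ ∈ T \ zetaNear t, 2 * (zetaOrd γ : ℝ) := by
          refine (norm_sum_le _ _).trans (Finset.sum_le_sum fun γ hγ ↦ ?_)
          by_cases hz : γ ∈ zetaOrdinates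
          · have h1 : 5 / 8 < |γ - t| := by
              by_contra h
              exact (Finset.mem_sdiff.1 hγ).2 (mem_zetaNear.2 ⟨hz, not_lt.1 h⟩)
            have h2 : 1 / 2 ≤ ‖w - criticalPoint γ‖ := by
              rw [hnorm]
              refine Real.le_sqrt_of_sq_le ?_
              have : (5 / 8) ^ 2 ≤ |γ - t| ^ 2 := by gcongr
              rw [sq_abs] at this
              nlinarith
            rw [hF, norm_div, Complex.norm_natCast, div_le_iff₀ (by linarith)]
            have : (0 : ℝ) ≤ zetaOrd γ := Nat.cast_nonneg _
            nlinarith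
          · simp [hF, zetaOrd_eq_zero hz]
      _ ≤ ∑ γ ∈ T, 2 * (zetaOrd γ : ℝ) := Finset.sum_le_sum_of_subset_of_nonneg
          Finset.sdiff_subset fun _ _ _ ↦ by positivity
      _ = 2 * M := by rw [hM, Finset.mul_sum]
  have b3 : ‖∑ γ ∈ T, (zetaOrd γ : ℂ) / criticalPoint γ‖ ≤ 2 * M := by
    rw [hM, Finset.mul_sum]
    refine (norm_sum_le _ _).trans (Finset.sum_le_sum fun γ hγ ↦ ?_)
    have h2 := norm_criticalPoint_ge γ
    rw [norm_div, Complex.norm_natCast, div_le_iff₀ (by linarith)]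
    have : (0 : ℝ) ≤ zetaOrd γ := Nat.cast_nonneg _
    nlinarith
  have hl1 : 1 ≤ C * (1 + |t|) ^ (1 / 4 : ℝ) := by
    have := Real.one_le_rpow (x := 1 + |t|) (z := 1 / 4) (by linarith [abs_nonneg t]) (by norm_num)
    nlinarith
  rw [key, norm_mul, norm_neg, norm_div, norm_one]
  have hwi : 1 / ‖w‖ ≤ 3 / (1 + |t|) := by
    rw [div_le_div_iff₀ (norm_pos_iff.2 hw0) (by positivity)]
    linarith
  gcongr
  calc _ ≤ ‖E‖ + 1 + ‖∑ γ ∈ zetaNear t \ T, F γ‖ + ‖∑ γ ∈ T \ zetaNear t, F γ‖ +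
        ‖∑ γ ∈ T, (zetaOrd γ : ℂ) / criticalPoint γ‖ := by
        refine (norm_sub_le _ _).trans (add_le_add_left ((norm_sub_le _ _).trans
          (add_le_add_left ((norm_add_le _ _).trans (add_le_add_left ((norm_add_le _ _).trans
            ?_) _)) _)) _)
        simp
    _ ≤ _ := by nlinarith

theorem one_add_abs_rpow_le {t γ : ℝ} (h : |γ - t| ≤ 5 / 8) :
    (1 + |t|) ^ (-(7 / 4) : ℝ) ≤ 4 * (1 + |γ|) ^ (-(7 / 4) : ℝ) := by
  have h1 : 1 + |γ| ≤ 2 * (1 + |t|) := by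
    have : |γ| ≤ |γ - t| + |t| := by simpa using abs_add_le (γ - t) t
    linarith [abs_nonneg t]
  have h2 : (2 * (1 + |t|)) ^ (-(7 / 4) : ℝ) ≤ (1 + |γ|) ^ (-(7 / 4) : ℝ) :=
    Real.rpow_le_rpow_of_nonpos (by positivity) h1 (by norm_num)
  have h3 : (1 / 4 : ℝ) ≤ 2 ^ (-(7 / 4) : ℝ) := by
    calc (1 / 4 : ℝ) = 2 ^ (-2 : ℝ) := by
          rw [Real.rpow_neg (by norm_num)]; norm_num
      _ ≤ _ := Real.rpow_le_rpow_of_exponent_le (by norm_num) (by norm_num)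
  rw [Real.mul_rpow (by norm_num) (by positivity)] at h2
  have h4 : (0 : ℝ) ≤ (1 + |t|) ^ (-(7 / 4) : ℝ) := by positivity
  nlinarith

theorem lintegral_div_sq_add_sq_le {σ : ℝ} (hσ : 0 < σ) (γ : ℝ) {a : ℝ} (ha : 0 ≤ a) :
    ∫⁻ t : ℝ, ENNReal.ofReal (a / (σ ^ 2 + (t - γ) ^ 2)) = ENNReal.ofReal (a * (π / σ)) := by
  have e : ∀ t : ℝ, a / (σ ^ 2 + (t - γ) ^ 2) = a / σ ^ 2 * (1 + ((t - γ) / σ) ^ 2)⁻¹ := by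
    intro t
    have : σ ^ 2 + (t - γ) ^ 2 ≠ 0 := by positivity
    field_simp
  have i0 : Integrable fun t : ℝ ↦ (1 + ((t - γ) / σ) ^ 2)⁻¹ :=
    ((integrable_inv_one_add_sq.comp_div hσ.ne').comp_sub_right γ)
  simp only [e]
  rw [← ofReal_integral_eq_lintegral_ofReal (i0.const_mul _)
    (Eventually.of_forall fun t ↦ by positivity), integral_const_mul]
  have h1 := integral_sub_right_eq_self (μ := volume) (fun t : ℝ ↦ (1 + (t / σ) ^ 2)⁻¹) γ
  rw [h1, Measure.integral_comp_div (fun t : ℝ ↦ (1 + t ^ 2)⁻¹), integral_univ_inv_one_add_sq,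
    smul_eq_mul, abs_of_pos hσ]
  congr 1
  field_simp

/-- The tail of the weighted sum over zeros outside a finite set. -/
noncomputable def zetaTail (T : Finset ℝ) : ENNReal :=
  ∑' γ : zetaOrdinates, if (γ : ℝ) ∈ T then 0 else
    ENNReal.ofReal (zetaOrd γ * (1 + |(γ : ℝ)|) ^ (-(7 / 4) : ℝ))

theorem tsum_near (t : ℝ) (F : ℝ → ENNReal) :
    ∑' γ : zetaOrdinates, (if |(γ : ℝ) - t| ≤ 5 / 8 then F γ else 0) = ∑ γ ∈ zetaNear t, F γ := by
  rw [tsum_subtype zetaOrdinates (fun γ ↦ if |γ - t| ≤ 5 / 8 then F γ else 0),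
    tsum_eq_sum (s := zetaNear t)]
  · refine Finset.sum_congr rfl fun γ hγ ↦ ?_
    obtain ⟨h1, h2⟩ := mem_zetaNear.1 hγ
    rw [indicator_of_mem h1, if_pos h2]
  · intro γ hγ
    rw [mem_zetaNear] at hγ
    by_cases h1 : γ ∈ zetaOrdinates
    · rw [indicator_of_mem h1, if_neg fun h ↦ hγ ⟨h1, h⟩]
    · rw [indicator_of_notMem h1]

theorem lintegral_one_add_abs_rpow_lt_top {a r : ℝ} (hr : 1 < r) :
    ∫⁻ t : ℝ, ENNReal.ofReal (a * (1 + |t|) ^ (-r)) ≠ ⊤ := by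
  have h := integrable_one_add_norm (E := ℝ) (μ := volume) (r := r) (by simpa using hr)
  exact (h.const_mul a).lintegral_lt_top.ne

theorem zetaTail_empty_ne_top (hRH : RiemannHypothesis) : zetaTail ∅ ≠ ⊤ := by
  obtain ⟨C, hC1, hC⟩ := exists_zero_estimates hRH
  have : Countable zetaOrdinates := countable_zetaOrdinates.to_subtype
  refine ne_top_of_le_ne_top (lintegral_one_add_abs_rpow_lt_top (a := 4 * C) (r := 3 / 2)
    (by norm_num)) ?_
  set F : ℝ → ℝ → ENNReal := fun γ t ↦
    ENNReal.ofReal (4 * zetaOrd γ * (1 + |t|) ^ (-(7 / 4) : ℝ)) with hF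
  calc zetaTail ∅ ≤ ∑' γ : zetaOrdinates, ∫⁻ t : ℝ, (if |(γ : ℝ) - t| ≤ 5 / 8 then F γ t else 0) := by
        refine ENNReal.tsum_le_tsum fun γ ↦ ?_
        simp only [Finset.notMem_empty, if_false]
        calc ENNReal.ofReal (zetaOrd γ * (1 + |(γ : ℝ)|) ^ (-(7 / 4) : ℝ))
            ≤ ENNReal.ofReal (zetaOrd γ * (1 + |(γ : ℝ)|) ^ (-(7 / 4) : ℝ)) *
              volume (Icc ((γ : ℝ) - 5 / 8) (γ + 5 / 8)) := by
              rw [Real.volume_Icc]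
              refine le_mul_of_one_le_right' ?_
              rw [← ENNReal.ofReal_one]
              exact ENNReal.ofReal_le_ofReal (by linarith)
          _ = ∫⁻ t : ℝ, (Icc ((γ : ℝ) - 5 / 8) (γ + 5 / 8)).indicator (fun _ ↦
              ENNReal.ofReal (zetaOrd γ * (1 + |(γ : ℝ)|) ^ (-(7 / 4) : ℝ))) t :=
            (lintegral_indicator_const measurableSet_Icc _).symm
          _ ≤ _ := by
            refine lintegral_mono fun t ↦ ?_
            rw [indicator_apply]
            split_ifs with h1 h2 h2
            · rw [hF]
              refine ENNReal.ofReal_le_ofReal ?_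
              have := one_add_abs_rpow_le (t := (γ : ℝ)) (γ := t) (by rwa [abs_sub_comm])
              calc _ ≤ (zetaOrd γ : ℝ) * (4 * (1 + |t|) ^ (-(7 / 4) : ℝ)) := by gcongr
                _ = _ := by ring
            · refine absurd ?_ h2
              rw [abs_le]
              exact ⟨by linarith [h1.2], by linarith [h1.1]⟩
            · exact zero_le
            · exact le_rfl
    _ = ∫⁻ t : ℝ, ∑' γ : zetaOrdinates, (if |(γ : ℝ) - t| ≤ 5 / 8 then F γ t else 0) := by
        refine (lintegral_tsum fun γ ↦ Measurable.aemeasurable ?_).symm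
        refine Measurable.ite ?_ (by fun_prop) measurable_const
        exact measurableSet_le (by fun_prop) measurable_const
    _ ≤ _ := by
        refine lintegral_mono fun t ↦ ?_
        rw [tsum_near t (fun γ ↦ F γ t), hF, ← ENNReal.ofReal_sum_of_nonneg (fun _ _ ↦ by positivity)]
        refine ENNReal.ofReal_le_ofReal ?_
        rw [← Finset.sum_mul, ← Finset.mul_sum]
        calc _ ≤ 4 * (C * (1 + |t|) ^ (1 / 4 : ℝ)) * (1 + |t|) ^ (-(7 / 4) : ℝ) := by
              gcongr; exact (hC t).1
          _ = 4 * C * ((1 + |t|) ^ (1 / 4 : ℝ) * (1 + |t|) ^ (-(7 / 4) : ℝ)) := by ring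
          _ = _ := by rw [← Real.rpow_add (by positivity)]; norm_num

theorem exists_zetaTail_le (hRH : RiemannHypothesis) {ε : ENNReal} (hε : 0 < ε) :
    ∃ T₀ : Finset ℝ, ∀ T, T₀ ⊆ T → zetaTail T ≤ ε := by
  have h0 := zetaTail_empty_ne_top hRH
  simp only [zetaTail, Finset.notMem_empty, if_false] at h0
  have h1 := ENNReal.tendsto_tsum_compl_atTop_zero h0
  obtain ⟨S, hS⟩ := (h1.eventually_le_const hε).exists
  classical
  refine ⟨S.image (↑), fun T hT ↦ le_trans ?_ hS⟩
  rw [zetaTail]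
  set f : zetaOrdinates → ENNReal := fun γ ↦
    ENNReal.ofReal (zetaOrd γ * (1 + |(γ : ℝ)|) ^ (-(7 / 4) : ℝ))
  have h2 : ∑' b : {x // x ∉ S}, f b = ∑' γ, ({x | x ∉ S} : Set zetaOrdinates).indicator f γ :=
    tsum_subtype {x | x ∉ S} f
  rw [h2]
  refine ENNReal.tsum_le_tsum fun γ ↦ ?_
  split_ifs with h
  · exact zero_le
  · rw [indicator_of_mem]
    intro hγ
    exact h (hT (Finset.mem_image_of_mem _ hγ))

/-- The Abel mean square of the remainder in the explicit formula. -/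
theorem exists_lintegral_psiRem_le (hRH : RiemannHypothesis) : ∃ C : ℝ, 0 < C ∧
    ∀ T : Finset ℝ, ∃ K : ENNReal, K ≠ ⊤ ∧ ∀ σ : ℝ, 0 < σ → σ < 1 →
      ∫⁻ u, ENNReal.ofReal (‖psiRem T u‖ ^ 2 * rexp (-2 * σ * u)) ≤
        K + ENNReal.ofReal (C / σ) * zetaTail T := by
  obtain ⟨C, hC1, hC⟩ := exists_zero_estimates hRH
  have : Countable zetaOrdinates := countable_zetaOrdinates.to_subtype
  refine ⟨72 * C * π, by positivity, fun T ↦ ?_⟩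
  set A : ℝ := 2 + 4 * ∑ γ ∈ T, (zetaOrd γ : ℝ) with hA
  have hA0 : 0 ≤ A := by positivity
  refine ⟨∫⁻ t : ℝ, ENNReal.ofReal (18 * A ^ 2 * C ^ 2 * (1 + |t|) ^ (-(3 / 2) : ℝ)),
    lintegral_one_add_abs_rpow_lt_top (by norm_num), fun σ hσ hσ1 ↦ ?_⟩
  have hb := fun x hx hx1 t ↦
    norm_psiRemLaplace_le hC1 (fun t ↦ (hC t).2) T (x := x) hx hx1 t
  have hp : ∀ t : ℝ, (0 : ℝ) < 1 + |t| := fun t ↦ by positivity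
  refine (lintegral_sq_mul_exp_le (G := psiRem T) (D := psiRemLaplace T)
    (C := 9 + ∑ γ ∈ T, ‖zetaCoeff γ‖) hσ hσ1 (measurable_psiRem T).aestronglyMeasurable
    (fun u hu ↦ if_neg (not_le.2 hu)) (fun u hu ↦ norm_psiRem_le T hu)
    (differentiableOn_psiRemLaplace hRH T)
    (fun t ↦ psiRemLaplace_eq_integral T (by simp; norm_num)) ?_).trans ?_
  · intro ε hε
    have h1 : Tendsto (fun y : ℝ ↦ 3 * (A + 1 / σ) * C * (1 + y) ^ (-(3 / 4) : ℝ)) atTop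
        (nhds 0) := by
      have := (tendsto_rpow_neg_atTop (y := 3 / 4) (by norm_num)).comp
        (tendsto_atTop_add_const_left atTop (1 : ℝ) tendsto_id)
      simpa using this.const_mul (3 * (A + 1 / σ) * C)
    obtain ⟨Y, hY⟩ := eventually_atTop.1 (h1.eventually_le_const hε)
    refine ⟨Y, fun t ht x hx ↦ le_trans ?_ (hY _ ht)⟩
    have hx0 : 0 < x := hσ.trans_le hx.1
    refine (hb x hx0 hx.2 t).trans ?_
    have h2 : ∑ γ ∈ zetaNear t \ T, (zetaOrd γ : ℝ) / √(x ^ 2 + (t - γ) ^ 2) ≤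
        C * (1 + |t|) ^ (1 / 4 : ℝ) * (1 / σ) := by
      calc _ ≤ ∑ γ ∈ zetaNear t \ T, (zetaOrd γ : ℝ) * (1 / σ) := by
            refine Finset.sum_le_sum fun γ _ ↦ ?_
            rw [← div_eq_mul_one_div]
            gcongr
            refine Real.le_sqrt_of_sq_le ?_
            nlinarith [hx.1, sq_nonneg (t - γ)]
        _ ≤ ∑ γ ∈ zetaNear t, (zetaOrd γ : ℝ) * (1 / σ) :=
            Finset.sum_le_sum_of_subset_of_nonneg Finset.sdiff_subset fun _ _ _ ↦ by positivity
        _ ≤ _ := by rw [← Finset.sum_mul]; gcongr; exact (hC t).1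
    have h3 : (1 + |t|) ^ (1 / 4 : ℝ) / (1 + |t|) = (1 + |t|) ^ (-(3 / 4) : ℝ) := by
      rw [← Real.rpow_sub_one (hp t).ne']; norm_num
    calc _ ≤ 3 / (1 + |t|) * (A * (C * (1 + |t|) ^ (1 / 4 : ℝ)) +
          C * (1 + |t|) ^ (1 / 4 : ℝ) * (1 / σ)) := by gcongr
      _ = 3 * (A + 1 / σ) * C * ((1 + |t|) ^ (1 / 4 : ℝ) / (1 + |t|)) := by ring
      _ = _ := by rw [h3]
  · set F : ℝ → ℝ → ENNReal := fun γ t ↦ if γ ∈ T then 0 else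
      ENNReal.ofReal (18 * C * zetaOrd γ * (1 + |t|) ^ (-(7 / 4) : ℝ) / (σ ^ 2 + (t - γ) ^ 2)) with hF
    calc ∫⁻ t : ℝ, ENNReal.ofReal (‖psiRemLaplace T (σ + t * Complex.I)‖ ^ 2)
        ≤ ∫⁻ t : ℝ, (ENNReal.ofReal (18 * A ^ 2 * C ^ 2 * (1 + |t|) ^ (-(3 / 2) : ℝ)) +
          ∑' γ : zetaOrdinates, (if |(γ : ℝ) - t| ≤ 5 / 8 then F γ t else 0)) := by
          refine lintegral_mono fun t ↦ ?_
          rw [tsum_near t (fun γ ↦ F γ t)]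
          have e1 : ∑ γ ∈ zetaNear t, F γ t = ENNReal.ofReal (∑ γ ∈ zetaNear t \ T,
              18 * C * zetaOrd γ * (1 + |t|) ^ (-(7 / 4) : ℝ) / (σ ^ 2 + (t - γ) ^ 2)) := by
            rw [ENNReal.ofReal_sum_of_nonneg (fun _ _ ↦ by positivity), Finset.sdiff_eq_filter,
              Finset.sum_filter]
            refine Finset.sum_congr rfl fun γ _ ↦ ?_
            rw [hF]
            by_cases h : γ ∈ T <;> simp [h]
          rw [e1, ← ENNReal.ofReal_add (by positivity) (Finset.sum_nonneg fun _ _ ↦ by positivity)]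
          refine ENNReal.ofReal_le_ofReal ?_
          set l := C * (1 + |t|) ^ (1 / 4 : ℝ) with hl
          have hl0 : 0 ≤ l := by positivity
          set Q := ∑ γ ∈ zetaNear t \ T, (zetaOrd γ : ℝ) / (σ ^ 2 + (t - γ) ^ 2) with hQ
          have hQ0 : 0 ≤ Q := Finset.sum_nonneg fun _ _ ↦ by positivity
          have hcs : (∑ γ ∈ zetaNear t \ T, (zetaOrd γ : ℝ) / √(σ ^ 2 + (t - γ) ^ 2)) ^ 2 ≤
              l * Q := by
            refine (Finset.sum_sq_le_sum_mul_sum_of_sq_le_mul _ (f := fun γ ↦ (zetaOrd γ : ℝ))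
              (g := fun γ ↦ (zetaOrd γ : ℝ) / (σ ^ 2 + (t - γ) ^ 2)) (fun _ _ ↦ by positivity)
              (fun _ _ ↦ by positivity) fun γ _ ↦ ?_).trans ?_
            · rw [div_pow, Real.sq_sqrt (by positivity), sq, mul_div_assoc]
            · gcongr
              refine le_trans ?_ (hC t).1
              exact Finset.sum_le_sum_of_subset_of_nonneg Finset.sdiff_subset
                fun _ _ _ ↦ by positivity
          have h3 : (3 / (1 + |t|)) ^ 2 = 9 * (1 + |t|) ^ (-2 : ℝ) := by
            rw [Real.rpow_neg (hp t).le, Real.rpow_two, div_pow]; field_simp; norm_num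
          have h4 : (1 + |t|) ^ (-2 : ℝ) * l ^ 2 = C ^ 2 * (1 + |t|) ^ (-(3 / 2) : ℝ) := by
            rw [hl, mul_pow, ← Real.rpow_natCast ((1 + |t|) ^ (1 / 4 : ℝ)), ← Real.rpow_mul (hp t).le, mul_left_comm,
              ← Real.rpow_add (hp t)]
            norm_num
          have h5 : (1 + |t|) ^ (-2 : ℝ) * l = C * (1 + |t|) ^ (-(7 / 4) : ℝ) := by
            rw [hl, mul_left_comm, ← Real.rpow_add (hp t)]
            norm_num
          calc ‖psiRemLaplace T (σ + t * Complex.I)‖ ^ 2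
              ≤ (3 / (1 + |t|) * (A * l +
                ∑ γ ∈ zetaNear t \ T, (zetaOrd γ : ℝ) / √(σ ^ 2 + (t - γ) ^ 2))) ^ 2 := by
                gcongr
                exact hb σ hσ hσ1.le t
            _ ≤ (3 / (1 + |t|)) ^ 2 * (2 * ((A * l) ^ 2 + l * Q)) := by
                rw [mul_pow]
                gcongr
                refine (add_sq_le).trans ?_
                gcongr
            _ = 18 * A ^ 2 * ((1 + |t|) ^ (-2 : ℝ) * l ^ 2) +
                18 * ((1 + |t|) ^ (-2 : ℝ) * l) * Q := by rw [h3]; ring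
            _ = 18 * A ^ 2 * C ^ 2 * (1 + |t|) ^ (-(3 / 2) : ℝ) +
                18 * (C * (1 + |t|) ^ (-(7 / 4) : ℝ)) * Q := by rw [h4, h5]; ring
            _ = _ := by
                rw [hQ, Finset.mul_sum]
                congr 1
                exact Finset.sum_congr rfl fun γ _ ↦ by ring
      _ = (∫⁻ t : ℝ, ENNReal.ofReal (18 * A ^ 2 * C ^ 2 * (1 + |t|) ^ (-(3 / 2) : ℝ))) +
          ∑' γ : zetaOrdinates, ∫⁻ t : ℝ, (if |(γ : ℝ) - t| ≤ 5 / 8 then F γ t else 0) := by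
          rw [lintegral_add_left (by fun_prop)]
          congr 1
          refine lintegral_tsum fun γ ↦ Measurable.aemeasurable ?_
          refine Measurable.ite ?_ ?_ measurable_const
          · exact measurableSet_le (by fun_prop) measurable_const
          · rw [hF]
            by_cases h : (γ : ℝ) ∈ T
            · simp [h]
            · simp only [h, if_false]
              fun_prop
      _ ≤ _ := by
          refine add_le_add le_rfl ?_
          rw [zetaTail, ← ENNReal.tsum_mul_left]
          refine ENNReal.tsum_le_tsum fun γ ↦ ?_
          by_cases h : (γ : ℝ) ∈ T
          · simp [hF, h]
          · simp only [hF, h, if_false]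
            calc _ ≤ ∫⁻ t : ℝ, ENNReal.ofReal (72 * C * (zetaOrd γ *
                  (1 + |(γ : ℝ)|) ^ (-(7 / 4) : ℝ)) / (σ ^ 2 + (t - γ) ^ 2)) := by
                  refine lintegral_mono fun t ↦ ?_
                  split_ifs with h1
                  · refine ENNReal.ofReal_le_ofReal ?_
                    have h2 := one_add_abs_rpow_le h1
                    refine div_le_div_of_nonneg_right ?_ (by positivity)
                    calc 18 * C * zetaOrd γ * (1 + |t|) ^ (-(7 / 4) : ℝ)
                        ≤ 18 * C * zetaOrd γ * (4 * (1 + |(γ : ℝ)|) ^ (-(7 / 4) : ℝ)) :=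
                          mul_le_mul_of_nonneg_left h2 (by positivity)
                      _ = _ := by ring
                  · exact zero_le
              _ = _ := by
                  rw [lintegral_div_sq_add_sq_le hσ _ (by positivity),
                    ← ENNReal.ofReal_mul (by positivity)]
                  congr 1
                  ring

theorem fourier_one_injective : Function.Injective (fun x : UnitAddCircle ↦ fourier 1 x) := by
  intro x y h
  simp only [fourier_one] at h
  exact AddCircle.injective_toCircle one_ne_zero (Circle.coe_injective h)

instance nontrivial_unitAddCircle : Nontrivial UnitAddCircle := by
  refine ⟨0, ((1 / 2 : ℝ) : UnitAddCircle), fun h ↦ ?_⟩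
  have h1 : fourier 1 ((1 / 2 : ℝ) : UnitAddCircle) = -1 := by
    rw [fourier_coe_apply]
    rw [← Complex.exp_pi_mul_I]
    congr 1
    push_cast
    ring
  rw [← h, fourier_eval_zero] at h1
  norm_num at h1

instance nullSingletonClass_haarAddCircle :
    NullSingletonClass (AddCircle.haarAddCircle : Measure UnitAddCircle) :=
  inferInstance

theorem integral_fourier_eq_ite (n : ℤ) :
    ∫ x : UnitAddCircle, fourier n x ∂AddCircle.haarAddCircle = if n = 0 then 1 else 0 := by
  have := orthonormal_iff_ite.1 (orthonormal_fourier (T := 1)) 0 n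
  rw [ContinuousMap.inner_toLp] at this
  simpa [eq_comm] using this

/-- The law of `Re (a z)` for `z` uniformly distributed on the unit circle. -/
noncomputable def cosLaw (a : ℂ) : Measure ℝ :=
  Measure.map (fun x : UnitAddCircle ↦ (a * fourier 1 x).re) AddCircle.haarAddCircle

theorem continuous_re_mul_fourier (a : ℂ) :
    Continuous (fun x : UnitAddCircle ↦ (a * fourier 1 x).re) := by
  fun_prop

instance isProbabilityMeasure_cosLaw (a : ℂ) : IsProbabilityMeasure (cosLaw a) :=
  Measure.isProbabilityMeasure_map (continuous_re_mul_fourier a).aemeasurable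

theorem charFun_cosLaw (a : ℂ) (ξ : ℝ) : charFun (cosLaw a) ξ =
    ∫ x : UnitAddCircle, Complex.exp (ξ * (a * fourier 1 x).re * Complex.I)
      ∂AddCircle.haarAddCircle := by
  rw [charFun_apply_real, cosLaw, integral_map (continuous_re_mul_fourier a).aemeasurable
    (by fun_prop)]

theorem cosLaw_mul_of_norm_eq_one {K : ℂ} (hK : ‖K‖ = 1) (a : ℂ) : cosLaw (K * a) = cosLaw a := by
  obtain ⟨y, hy⟩ : ∃ y : UnitAddCircle, fourier 1 y = K := by
    refine ⟨((K.arg / (2 * π) : ℝ) : UnitAddCircle), ?_⟩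
    rw [fourier_coe_apply, ← Complex.norm_mul_exp_arg_mul_I K, hK]
    simp only [Complex.ofReal_one, one_mul]
    rw [Complex.arg_exp_mul_I, toIocMod_eq_self _ |>.2 (by
      have := Complex.arg_mem_Ioc K
      constructor <;> linarith [this.1, this.2])]
    congr 1
    have : (π : ℂ) ≠ 0 := by exact_mod_cast Real.pi_ne_zero
    push_cast
    field_simp
  have h1 : (fun x : UnitAddCircle ↦ (K * a * fourier 1 x).re) =
      (fun x : UnitAddCircle ↦ (a * fourier 1 x).re) ∘ fun x ↦ x + y := by
    funext x
    have : fourier 1 (x + y) = fourier 1 x * fourier 1 y := by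
      simp only [fourier_one, AddCircle.toCircle_add, Circle.coe_mul]
    simp only [Function.comp_apply, this, hy]
    ring_nf
  rw [cosLaw, h1, ← Measure.map_map (continuous_re_mul_fourier a).measurable (by fun_prop),
    map_add_right_eq_self]
  rfl

theorem charFun_cosLaw_neg (a : ℂ) (ξ : ℝ) :
    charFun (cosLaw a) (-ξ) = charFun (cosLaw a) ξ := by
  rw [← cosLaw_mul_of_norm_eq_one (K := -1) (by simp) a, charFun_cosLaw,
    cosLaw_mul_of_norm_eq_one (K := -1) (by simp) a, charFun_cosLaw]
  congr 1
  funext x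
  congr 1
  simp
  ring

theorem cosLaw_zero : cosLaw 0 = Measure.dirac 0 := by
  simp [cosLaw, Measure.map_const]

theorem cosLaw_singleton {a : ℂ} (ha : a ≠ 0) (c : ℝ) : cosLaw a {c} = 0 := by
  rw [cosLaw, Measure.map_apply (continuous_re_mul_fourier a).measurable (measurableSet_singleton c)]
  refine Set.Countable.measure_zero (Set.Finite.countable ?_) _
  have hfin : {w : ℝ | w ^ 2 = ‖a‖ ^ 2 - c ^ 2}.Finite := by
    refine Set.Finite.subset (Set.toFinite {√(‖a‖ ^ 2 - c ^ 2), -√(‖a‖ ^ 2 - c ^ 2)}) fun w hw ↦ ?_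
    have hw' : w ^ 2 = ‖a‖ ^ 2 - c ^ 2 := hw
    have h2 : √(‖a‖ ^ 2 - c ^ 2) ^ 2 = ‖a‖ ^ 2 - c ^ 2 := Real.sq_sqrt (by rw [← hw']; positivity)
    exact sq_eq_sq_iff_eq_or_eq_neg.1 (hw'.trans h2.symm)
  refine Set.Finite.of_finite_image (f := fun x ↦ (a * fourier 1 x).im) (hfin.subset ?_) ?_
  · rintro _ ⟨x, hx, rfl⟩
    have hx' : (a * fourier 1 x).re = c := hx
    have h1 : Complex.normSq (a * fourier 1 x) = ‖a‖ ^ 2 := by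
      rw [Complex.normSq_eq_norm_sq, norm_mul, fourier_one, Circle.norm_coe, mul_one]
    rw [Complex.normSq_apply, hx'] at h1
    change (a * fourier 1 x).im ^ 2 = _
    linarith
  · intro x hx y hy h
    have hx' : (a * fourier 1 x).re = c := hx
    have hy' : (a * fourier 1 y).re = c := hy
    exact fourier_one_injective (mul_left_cancel₀ ha (Complex.ext (hx'.trans hy'.symm) h))

theorem tendsto_mean_cexp {ω : ℝ} (hω : ω ≠ 0) :
    Tendsto (fun T : ℝ ↦ (T : ℂ)⁻¹ * ∫ u in (0 : ℝ)..T, Complex.exp (u * ω * Complex.I))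
      atTop (nhds 0) := by
  have hω' : (ω : ℂ) * Complex.I ≠ 0 := mul_ne_zero (by exact_mod_cast hω) Complex.I_ne_zero
  have h1 : ∀ T : ℝ, ∫ u in (0 : ℝ)..T, Complex.exp (u * ω * Complex.I) =
      (Complex.exp (T * ω * Complex.I) - 1) / (ω * Complex.I) := fun T ↦ by
    have := integral_exp_mul_complex (a := 0) (b := T) hω'
    simpa [mul_comm, mul_left_comm, mul_assoc] using this
  rw [tendsto_zero_iff_norm_tendsto_zero]
  refine squeeze_zero' (g := fun T : ℝ ↦ T⁻¹ * (2 / |ω|))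
    (Eventually.of_forall fun _ ↦ norm_nonneg _) ?_ ?_
  · filter_upwards [eventually_gt_atTop 0] with T hT
    rw [h1, norm_mul, norm_inv, norm_div, norm_mul, Complex.norm_I, mul_one, Complex.norm_real,
      Complex.norm_real, Real.norm_eq_abs, Real.norm_eq_abs, abs_of_pos hT]
    gcongr
    refine (norm_sub_le _ _).trans ?_
    rw [show (T : ℂ) * ω * Complex.I = ((T * ω : ℝ) : ℂ) * Complex.I by push_cast; ring,
      Complex.norm_exp_ofReal_mul_I]
    norm_num
  · simpa using tendsto_inv_atTop_zero.mul_const (2 / |ω|)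

theorem tendsto_mean_torus {ι : Type*} [Fintype ι] {l : ι → ℝ} (hl : LinearIndependent ℚ l)
    (F : C(UnitAddTorus ι, ℂ)) :
    Tendsto (fun T : ℝ ↦ (T : ℂ)⁻¹ * ∫ u in (0 : ℝ)..T,
      F (fun i ↦ ((l i * u / (2 * π) : ℝ) : UnitAddCircle))) atTop
      (nhds (∫ x, F x ∂(Measure.pi fun _ ↦ AddCircle.haarAddCircle))) := by
  set ν : Measure (UnitAddTorus ι) := Measure.pi fun _ ↦ AddCircle.haarAddCircle with hν
  set p : ℝ → UnitAddTorus ι := fun u i ↦ ((l i * u / (2 * π) : ℝ) : UnitAddCircle) with hp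
  have hpc : Continuous p := by
    refine continuous_pi fun i ↦ ?_
    exact (AddCircle.continuous_mk' (1 : ℝ)).comp (by fun_prop)
  have hInt : ∀ (G : C(UnitAddTorus ι, ℂ)) (a b : ℝ),
      IntervalIntegrable (fun u ↦ G (p u)) volume a b := fun G a b ↦
    (G.continuous.comp hpc).intervalIntegrable a b
  have hintν : ∀ G : C(UnitAddTorus ι, ℂ), Integrable (fun x ↦ G x) ν := fun G ↦
    G.continuous.integrable_of_hasCompactSupport (HasCompactSupport.of_compactSpace _)
  let M : Submodule ℂ C(UnitAddTorus ι, ℂ) :=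
    { carrier := {G | Tendsto (fun T : ℝ ↦ (T : ℂ)⁻¹ * ∫ u in (0 : ℝ)..T, G (p u)) atTop
        (nhds (∫ x, G x ∂ν))}
      add_mem' := by
        intro G H hG hH
        have := Tendsto.add (show Tendsto _ _ _ from hG) (show Tendsto _ _ _ from hH)
        change Tendsto _ _ _
        simp only [ContinuousMap.add_apply]
        rw [integral_add (hintν G) (hintν H)]
        refine this.congr fun T ↦ ?_
        rw [intervalIntegral.integral_add (hInt G _ _) (hInt H _ _), mul_add]
      zero_mem' := by
        change Tendsto _ _ _
        simp
      smul_mem' := by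
        intro c G hG
        have := Tendsto.const_mul c (show Tendsto _ _ _ from hG)
        change Tendsto _ _ _
        simp only [ContinuousMap.smul_apply, smul_eq_mul, integral_const_mul,
          intervalIntegral.integral_const_mul]
        refine this.congr fun T ↦ ?_
        ring }
  have hmono : range UnitAddTorus.mFourier ⊆ (M : Set C(UnitAddTorus ι, ℂ)) := by
    rintro _ ⟨n, rfl⟩
    change Tendsto _ _ _
    have h1 : ∫ x, UnitAddTorus.mFourier n x ∂ν = ∏ i, if n i = 0 then 1 else 0 := by
      have := integral_fintype_prod_eq_prod (𝕜 := ℂ) (fun i (x : UnitAddCircle) ↦ fourier (n i) x)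
        (μ := fun _ ↦ AddCircle.haarAddCircle)
      simp only [integral_fourier_eq_ite] at this
      exact this
    have h2 : ∀ u : ℝ, UnitAddTorus.mFourier n (p u) =
        Complex.exp (u * (∑ i, n i * l i : ℝ) * Complex.I) := fun u ↦ by
      have h3 : UnitAddTorus.mFourier n (p u) = ∏ i, fourier (n i) (p u i) := rfl
      rw [h3]
      simp only [hp, fourier_coe_apply]
      rw [← Complex.exp_sum]
      congr 1
      push_cast
      rw [Finset.mul_sum, Finset.sum_mul]
      refine Finset.sum_congr rfl fun i _ ↦ ?_
      have : (π : ℂ) ≠ 0 := by exact_mod_cast Real.pi_ne_zero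
      field_simp
    simp only [h1, h2]
    by_cases hn : n = 0
    · subst hn
      simp only [Pi.zero_apply, Int.cast_zero, zero_mul, Finset.sum_const_zero, Complex.ofReal_zero,
        mul_zero, Complex.exp_zero, if_true, Finset.prod_const_one]
      refine tendsto_const_nhds.congr' ?_
      filter_upwards [eventually_gt_atTop 0] with T hT
      have : (T : ℂ) ≠ 0 := by exact_mod_cast hT.ne'
      simp [this]
    · obtain ⟨i, hi⟩ := Function.ne_iff.1 hn
      rw [Finset.prod_eq_zero (Finset.mem_univ i) (if_neg hi)]
      refine tendsto_mean_cexp fun h0 ↦ hi ?_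
      have := Fintype.linearIndependent_iff.1 hl (fun i ↦ (n i : ℚ)) (by
        simpa [Rat.smul_def] using h0) i
      exact_mod_cast this
  have hclosed : IsClosed (M : Set C(UnitAddTorus ι, ℂ)) := by
    refine isClosed_of_closure_subset fun G hG ↦ ?_
    change Tendsto _ _ _
    rw [Metric.tendsto_nhds]
    intro ε hε
    obtain ⟨H, hH, hGH⟩ := Metric.mem_closure_iff.1 hG (ε / 3) (by positivity)
    have hH' := Metric.tendsto_nhds.1 (show Tendsto _ _ _ from hH) (ε / 3) (by positivity)
    have hd : ∀ x, ‖G x - H x‖ ≤ ε / 3 := fun x ↦ by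
      rw [← dist_eq_norm]
      exact (ContinuousMap.dist_apply_le_dist x).trans hGH.le
    filter_upwards [hH', eventually_gt_atTop 0] with T hT hT0
    have h1 : dist (∫ x, H x ∂ν) (∫ x, G x ∂ν) ≤ ε / 3 := by
      rw [dist_comm, dist_eq_norm, ← integral_sub (hintν G) (hintν H)]
      refine (norm_integral_le_of_norm_le_const (C := ε / 3) (Eventually.of_forall hd)).trans ?_
      simp
    have h2 : dist ((T : ℂ)⁻¹ * ∫ u in (0 : ℝ)..T, G (p u))
        ((T : ℂ)⁻¹ * ∫ u in (0 : ℝ)..T, H (p u)) ≤ ε / 3 := by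
      rw [dist_eq_norm, ← mul_sub, ← intervalIntegral.integral_sub (hInt G _ _) (hInt H _ _),
        norm_mul, norm_inv, Complex.norm_real, Real.norm_eq_abs, abs_of_pos hT0]
      have := intervalIntegral.norm_integral_le_of_norm_le_const (a := 0) (b := T) (C := ε / 3)
        (f := fun u ↦ G (p u) - H (p u)) (fun u _ ↦ hd _)
      rw [sub_zero, abs_of_pos hT0] at this
      rw [inv_mul_le_iff₀ hT0]
      linarith
    have := dist_triangle4 ((T : ℂ)⁻¹ * ∫ u in (0 : ℝ)..T, G (p u))
      ((T : ℂ)⁻¹ * ∫ u in (0 : ℝ)..T, H (p u)) (∫ x, H x ∂ν) (∫ x, G x ∂ν)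
    linarith
  have htop : (⊤ : Submodule ℂ C(UnitAddTorus ι, ℂ)) ≤ M := by
    rw [← UnitAddTorus.span_mFourier_closure_eq_top]
    exact Submodule.topologicalClosure_minimal _ (Submodule.span_le.2 hmono) hclosed
  exact htop (Submodule.mem_top (x := F))

/-- The trigonometric polynomial `∑ Re (a_i e^{i l_i u})`. -/
noncomputable def trigPoly {ι : Type*} (l : ι → ℝ) (a : ι → ℂ) (S : Finset ι) (u : ℝ) : ℝ :=
  ∑ i ∈ S, (a i * Complex.exp (l i * u * Complex.I)).re

theorem continuous_trigPoly {ι : Type*} (l : ι → ℝ) (a : ι → ℂ) (S : Finset ι) :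
    Continuous (trigPoly l a S) := by
  unfold trigPoly
  fun_prop

theorem tendsto_mean_cexp_trigPoly {ι : Type*} {l : ι → ℝ} (hl : LinearIndependent ℚ l)
    (a : ι → ℂ) (S : Finset ι) (ξ : ℝ) :
    Tendsto (fun T : ℝ ↦ (T : ℂ)⁻¹ * ∫ u in (0 : ℝ)..T,
      Complex.exp (ξ * trigPoly l a S u * Complex.I)) atTop
      (nhds (∏ i ∈ S, charFun (cosLaw (a i)) ξ)) := by
  let f : S → C(UnitAddCircle, ℂ) := fun i ↦
    ⟨fun x ↦ Complex.exp (ξ * (a i * fourier 1 x).re * Complex.I), by fun_prop⟩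
  let F : C(UnitAddTorus S, ℂ) := ⟨fun x ↦ ∏ i, f i (x i), by fun_prop⟩
  have h := tendsto_mean_torus (hl.comp (Subtype.val : S → ι) Subtype.val_injective) F
  have h1 : ∫ x, F x ∂(Measure.pi fun _ ↦ AddCircle.haarAddCircle) =
      ∏ i ∈ S, charFun (cosLaw (a i)) ξ := by
    have := integral_fintype_prod_eq_prod (𝕜 := ℂ) (fun i (x : UnitAddCircle) ↦ f i x)
        (μ := fun _ ↦ AddCircle.haarAddCircle)
    refine this.trans ?_
    rw [← Finset.prod_coe_sort S (fun i ↦ charFun (cosLaw (a i)) ξ)]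
    refine Finset.prod_congr rfl fun i _ ↦ ?_
    rw [charFun_cosLaw]
    rfl
  rw [h1] at h
  refine h.congr fun T ↦ ?_
  congr 1
  refine intervalIntegral.integral_congr fun u _ ↦ ?_
  change ∏ i, f i _ = _
  change ∏ i : S, Complex.exp (ξ * (a i * fourier 1 _).re * Complex.I) = _
  rw [← Complex.exp_sum, trigPoly,
    ← Finset.sum_coe_sort S (fun i ↦ (a i * Complex.exp (l i * u * Complex.I)).re)]
  push_cast
  rw [Finset.mul_sum, Finset.sum_mul]
  congr 1
  refine Finset.sum_congr rfl fun i _ ↦ ?_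
  rw [fourier_coe_apply]
  congr 6
  have : (π : ℂ) ≠ 0 := by exact_mod_cast Real.pi_ne_zero
  simp only [Function.comp_apply]
  push_cast
  field_simp

/-- The distribution of `E u` for `u` uniform in `(0, max T 1]`. -/
noncomputable def lawUpTo (E : ℝ → ℝ) (T : ℝ) : Measure ℝ :=
  Measure.map E ((ENNReal.ofReal (max T 1))⁻¹ • volume.restrict (Ioc 0 (max T 1)))

theorem isProbabilityMeasure_lawUpTo {E : ℝ → ℝ} (hE : Measurable E) (T : ℝ) :
    IsProbabilityMeasure (lawUpTo E T) := by
  constructor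
  have h0 : 0 < max T 1 := lt_max_of_lt_right one_pos
  rw [lawUpTo, Measure.map_apply hE MeasurableSet.univ]
  simp only [preimage_univ, Measure.smul_apply, Measure.restrict_apply_univ, Real.volume_Ioc,
    sub_zero, smul_eq_mul]
  exact ENNReal.inv_mul_cancel (by simp) ENNReal.ofReal_ne_top

theorem charFun_lawUpTo {E : ℝ → ℝ} (hE : Measurable E) {T : ℝ} (hT : 1 ≤ T) (ξ : ℝ) :
    charFun (lawUpTo E T) ξ =
      (T : ℂ)⁻¹ * ∫ u in (0 : ℝ)..T, Complex.exp (ξ * E u * Complex.I) := by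
  have h0 : 0 < T := by linarith
  rw [charFun_apply_real, lawUpTo, max_eq_left hT, integral_map hE.aemeasurable (by fun_prop),
    integral_smul_measure, intervalIntegral.integral_of_le h0.le, ENNReal.toReal_inv,
    ENNReal.toReal_ofReal h0.le, Complex.real_smul, Complex.ofReal_inv]

theorem lawUpTo_Ioi {E : ℝ → ℝ} (hE : Measurable E) {T : ℝ} (hT : 1 ≤ T) (c : ℝ) :
    lawUpTo E T (Ioi c) = (ENNReal.ofReal T)⁻¹ * volume ({u | c < E u} ∩ Ioc 0 T) := by
  rw [lawUpTo, max_eq_left hT, Measure.map_apply hE measurableSet_Ioi, Measure.smul_apply,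
    smul_eq_mul, Measure.restrict_apply (hE measurableSet_Ioi)]
  rfl

/-- Approximation in mean square of `E` by trigonometric polynomials. -/
def IsMeanSquareLimit {ι : Type*} (E : ℝ → ℝ) (l : ι → ℝ) (a : ι → ℂ) : Prop :=
  ∀ ε : ℝ, 0 < ε → ∃ S₀ : Finset ι, ∀ S, S₀ ⊆ S → ∀ᶠ T : ℝ in atTop,
    ∫⁻ u in Ioc 0 T, ENNReal.ofReal ((E u - trigPoly l a S u) ^ 2) ≤ ENNReal.ofReal (ε * T)

theorem norm_cexp_sub_cexp_le (x y : ℝ) :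
    ‖Complex.exp (x * Complex.I) - Complex.exp (y * Complex.I)‖ ≤ |x - y| := by
  have h : Complex.exp (x * Complex.I) - Complex.exp (y * Complex.I) =
      Complex.exp (y * Complex.I) * (Complex.exp (Complex.I * (x - y : ℝ)) - 1) := by
    rw [mul_sub, ← Complex.exp_add]
    push_cast
    ring_nf
  rw [h, norm_mul, Complex.norm_exp_ofReal_mul_I, one_mul]
  exact Real.norm_exp_I_mul_ofReal_sub_one_le

theorem norm_mean_cexp_sub_le {E P : ℝ → ℝ} (hE : Measurable E) (hP : Measurable P) (ξ : ℝ)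
    {T δ : ℝ} (hT : 0 < T) (hδ : 0 < δ)
    (h : ∫⁻ u in Ioc 0 T, ENNReal.ofReal ((E u - P u) ^ 2) ≤ ENNReal.ofReal (δ ^ 2 * T)) :
    ‖(T : ℂ)⁻¹ * (∫ u in (0 : ℝ)..T, Complex.exp (ξ * E u * Complex.I)) -
      (T : ℂ)⁻¹ * ∫ u in (0 : ℝ)..T, Complex.exp (ξ * P u * Complex.I)‖ ≤ |ξ| * δ := by
  have hi : ∀ Q : ℝ → ℝ, Measurable Q →
      IntervalIntegrable (fun u ↦ Complex.exp (ξ * Q u * Complex.I)) volume 0 T := fun Q hQ ↦ by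
    refine (intervalIntegrable_const (c := (1 : ℝ))).mono_fun (by fun_prop) ?_
    refine Eventually.of_forall fun u ↦ ?_
    simp only [← Complex.ofReal_mul, Complex.norm_exp_ofReal_mul_I, norm_one]
    exact le_rfl
  rw [← mul_sub, ← intervalIntegral.integral_sub (hi E hE) (hi P hP), norm_mul, norm_inv,
    Complex.norm_real, Real.norm_eq_abs, abs_of_pos hT, inv_mul_le_iff₀ hT]
  have hpt : ∀ u, ‖Complex.exp (ξ * E u * Complex.I) - Complex.exp (ξ * P u * Complex.I)‖ₑ ≤
      ENNReal.ofReal (|ξ| * δ / 2) + ENNReal.ofReal (|ξ| / (2 * δ)) *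
        ENNReal.ofReal ((E u - P u) ^ 2) := fun u ↦ by
    rw [← ofReal_norm, ← ENNReal.ofReal_mul (by positivity),
      ← ENNReal.ofReal_add (by positivity) (by positivity)]
    refine ENNReal.ofReal_le_ofReal ?_
    have h1 := norm_cexp_sub_cexp_le (ξ * E u) (ξ * P u)
    push_cast at h1
    refine h1.trans ?_
    rw [← mul_sub, abs_mul]
    have h2 : |E u - P u| ≤ δ / 2 + (E u - P u) ^ 2 / (2 * δ) := by
      rw [div_add_div _ _ two_ne_zero (by positivity), le_div_iff₀ (by positivity)]
      nlinarith [sq_nonneg (|E u - P u| - δ), sq_abs (E u - P u)]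
    calc |ξ| * |E u - P u| ≤ |ξ| * (δ / 2 + (E u - P u) ^ 2 / (2 * δ)) := by gcongr
      _ = _ := by ring
  rw [intervalIntegral.integral_of_le hT.le]
  have h3 : ‖∫ u in Ioc 0 T, (Complex.exp (ξ * E u * Complex.I) -
      Complex.exp (ξ * P u * Complex.I))‖ₑ ≤ ENNReal.ofReal (T * (|ξ| * δ)) := by
    refine (enorm_integral_le_lintegral_enorm _).trans ((lintegral_mono hpt).trans ?_)
    rw [lintegral_add_left (by fun_prop), lintegral_const_mul _ (by fun_prop), setLIntegral_const,
      Real.volume_Ioc, sub_zero]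
    calc _ ≤ ENNReal.ofReal (|ξ| * δ / 2) * ENNReal.ofReal T +
          ENNReal.ofReal (|ξ| / (2 * δ)) * ENNReal.ofReal (δ ^ 2 * T) := by gcongr
      _ = ENNReal.ofReal (T * (|ξ| * δ)) := by
        rw [← ENNReal.ofReal_mul (by positivity), ← ENNReal.ofReal_mul (by positivity),
          ← ENNReal.ofReal_add (by positivity) (by positivity)]
        congr 1
        field_simp
        ring
  rw [← ofReal_norm] at h3
  exact (ENNReal.ofReal_le_ofReal_iff (by positivity)).1 h3

theorem exists_tendsto_of_approx {ι X : Type*} [MetricSpace X] [CompleteSpace X]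
    {f : ℝ → X} {g : Finset ι → X}
    (h : ∀ ε : ℝ, 0 < ε → ∃ S₀ : Finset ι, ∀ S, S₀ ⊆ S → ∀ᶠ T : ℝ in atTop, dist (f T) (g S) ≤ ε) :
    ∃ z : X, Tendsto f atTop (nhds z) ∧ Tendsto g atTop (nhds z) := by
  have hc : CauchySeq f := by
    rw [Metric.cauchySeq_iff']
    intro ε hε
    obtain ⟨S, hS⟩ := h (ε / 3) (by positivity)
    obtain ⟨N, hN⟩ := eventually_atTop.1 (hS S (Finset.Subset.refl S))
    refine ⟨N, fun T hT ↦ ?_⟩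
    have h1 : dist (f T) (g S) ≤ ε / 3 := hN T hT
    have h2 : dist (f N) (g S) ≤ ε / 3 := hN N le_rfl
    have h3 : dist (f T) (f N) ≤ dist (f T) (g S) + dist (f N) (g S) := dist_triangle_right _ _ _
    linarith
  obtain ⟨z, hz⟩ := cauchySeq_tendsto_of_complete hc
  refine ⟨z, hz, Metric.tendsto_nhds.2 fun ε hε ↦ ?_⟩
  obtain ⟨S, hS⟩ := h (ε / 2) (by positivity)
  filter_upwards [eventually_ge_atTop S] with S' hS'
  have h1 : Tendsto (fun T ↦ dist (f T) (g S')) atTop (nhds (dist z (g S'))) :=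
    hz.dist tendsto_const_nhds
  have h2 : dist z (g S') ≤ ε / 2 := le_of_tendsto h1 (hS S' hS')
  rw [dist_comm]
  exact h2.trans_lt (half_lt_self hε)

theorem IsMeanSquareLimit.exists_charFun_tendsto {ι : Type*} {E : ℝ → ℝ} {l : ι → ℝ} {a : ι → ℂ}
    (h : IsMeanSquareLimit E l a) (hE : Measurable E) (hl : LinearIndependent ℚ l) :
    ∃ Φ : ℝ → ℂ, ContinuousAt Φ 0 ∧
      (∀ ξ, Tendsto (fun T ↦ charFun (lawUpTo E T) ξ) atTop (nhds (Φ ξ))) ∧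
      ∀ ξ, Tendsto (fun S : Finset ι ↦ ∏ i ∈ S, charFun (cosLaw (a i)) ξ) atTop (nhds (Φ ξ)) := by
  have key : ∀ δ : ℝ, 0 < δ → ∃ S₀ : Finset ι, ∀ S, S₀ ⊆ S → ∀ ξ, ∀ η : ℝ, 0 < η →
      ∀ᶠ T : ℝ in atTop,
      ‖charFun (lawUpTo E T) ξ - ∏ i ∈ S, charFun (cosLaw (a i)) ξ‖ ≤ |ξ| * δ + η := by
    intro δ hδ
    obtain ⟨S₀, hS₀⟩ := h (δ ^ 2) (by positivity)
    refine ⟨S₀, fun S hS ξ η hη ↦ ?_⟩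
    have h1 := Metric.tendsto_nhds.1 (tendsto_mean_cexp_trigPoly hl a S ξ) η hη
    filter_upwards [hS₀ S hS, h1, eventually_ge_atTop 1] with T hT hT1 hT2
    rw [charFun_lawUpTo hE hT2]
    have h2 := norm_mean_cexp_sub_le hE (continuous_trigPoly l a S).measurable ξ
      (by linarith) hδ hT
    rw [dist_eq_norm] at hT1
    exact (norm_sub_le_norm_sub_add_norm_sub _ _ _).trans (by linarith)
  have h1 : ∀ ξ, ∃ z : ℂ, Tendsto (fun T ↦ charFun (lawUpTo E T) ξ) atTop (nhds z) ∧
      Tendsto (fun S : Finset ι ↦ ∏ i ∈ S, charFun (cosLaw (a i)) ξ) atTop (nhds z) := by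
    intro ξ
    refine exists_tendsto_of_approx fun ε hε ↦ ?_
    obtain ⟨S₀, hS₀⟩ := key (ε / (2 * (|ξ| + 1))) (by positivity)
    refine ⟨S₀, fun S hS ↦ ?_⟩
    filter_upwards [hS₀ S hS ξ (ε / 2) (by positivity)] with T hT
    rw [dist_eq_norm]
    have : |ξ| * (ε / (2 * (|ξ| + 1))) ≤ ε / 2 := by
      rw [← mul_div_assoc, div_le_div_iff₀ (by positivity) two_pos]
      nlinarith [abs_nonneg ξ]
    linarith
  choose Φ hΦ1 hΦ2 using h1
  refine ⟨Φ, ?_, hΦ1, hΦ2⟩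
  obtain ⟨S, hS⟩ := key 1 one_pos
  set G : ℝ → ℂ := fun ξ ↦ ∏ i ∈ S, charFun (cosLaw (a i)) ξ with hG
  have hGc : Continuous G := by
    refine continuous_finsetProd _ fun i _ ↦ ?_
    exact continuous_charFun
  have hle : ∀ ξ, ‖Φ ξ - G ξ‖ ≤ |ξ| := fun ξ ↦ by
    refine le_of_forall_pos_le_add fun η hη ↦ ?_
    have := le_of_tendsto ((hΦ1 ξ).sub_const (G ξ)).norm (hS S subset_rfl ξ η hη)
    linarith
  have h0 : Tendsto (fun ξ ↦ Φ ξ - G ξ) (nhds 0) (nhds 0) := by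
    rw [tendsto_zero_iff_norm_tendsto_zero]
    refine squeeze_zero (fun _ ↦ norm_nonneg _) hle ?_
    simpa using (continuous_abs.tendsto (0 : ℝ))
  have h00 : Φ 0 = G 0 := by
    have := hle 0
    rw [abs_zero] at this
    exact sub_eq_zero.1 (norm_le_zero_iff.1 this)
  change Tendsto Φ (nhds 0) (nhds (Φ 0))
  rw [h00]
  simpa using h0.add (hGc.tendsto 0)

theorem IsMeanSquareLimit.exists_law {ι : Type*} {E : ℝ → ℝ} {l : ι → ℝ} {a : ι → ℂ}
    (h : IsMeanSquareLimit E l a) (hE : Measurable E) (hl : LinearIndependent ℚ l) :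
    ∃ μ : ProbabilityMeasure ℝ,
      (∀ c : ℝ, (μ : Measure ℝ) {c} = 0 → Tendsto (fun T : ℝ ↦
        (ENNReal.ofReal T)⁻¹ * volume ({u | c < E u} ∩ Ioc 0 T)) atTop
          (nhds ((μ : Measure ℝ) (Ioi c)))) ∧
      ∀ ξ, Tendsto (fun S : Finset ι ↦ ∏ i ∈ S, charFun (cosLaw (a i)) ξ) atTop
        (nhds (charFun (μ : Measure ℝ) ξ)) := by
  obtain ⟨Φ, hΦ0, hΦ1, hΦ2⟩ := h.exists_charFun_tendsto hE hl
  let m : ℝ → ProbabilityMeasure ℝ := fun T ↦ ⟨lawUpTo E T, isProbabilityMeasure_lawUpTo hE T⟩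
  have hseq : ∀ x : ℕ → ℝ, Tendsto x atTop atTop → ∀ ξ,
      Tendsto (fun n ↦ charFun (m (x n) : Measure ℝ) ξ) atTop (nhds (Φ ξ)) := fun x hx ξ ↦
    (hΦ1 ξ).comp hx
  have htight := isTightMeasureSet_of_tendsto_charFun
    (μ := fun n : ℕ ↦ (m n : Measure ℝ)) hΦ0 (hseq _ tendsto_natCast_atTop_atTop)
  have hcomp : IsCompact (closure (range fun n : ℕ ↦ m n)) := by
    refine isCompact_closure_of_isTightMeasureSet ?_
    convert htight using 1
    ext ν
    simp
  obtain ⟨μ, -, φ, hφ, hμ⟩ := hcomp.tendsto_subseq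
    (x := fun n : ℕ ↦ m n) fun n ↦ subset_closure (mem_range_self n)
  have hμΦ : ∀ ξ, charFun (μ : Measure ℝ) ξ = Φ ξ := fun ξ ↦
    tendsto_nhds_unique (ProbabilityMeasure.tendsto_iff_tendsto_charFun.1 hμ ξ)
      ((hseq _ tendsto_natCast_atTop_atTop ξ).comp hφ.tendsto_atTop)
  have hlim : Tendsto m atTop (nhds μ) := by
    refine tendsto_of_seq_tendsto fun x hx ↦ ?_
    refine ProbabilityMeasure.tendsto_of_tendsto_charFun fun ξ ↦ ?_
    rw [hμΦ]
    exact hseq x hx ξ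
  refine ⟨μ, fun c hc ↦ ?_, fun ξ ↦ ?_⟩
  · have := ProbabilityMeasure.tendsto_measure_of_null_frontier_of_tendsto' hlim (E := Ioi c)
      (by rwa [frontier_Ioi])
    refine this.congr' ?_
    filter_upwards [eventually_ge_atTop 1] with T hT
    exact lawUpTo_Ioi hE hT c
  · rw [hμΦ]
    exact hΦ2 ξ

theorem IsMeanSquareLimit.update {ι : Type*} [DecidableEq ι] {E : ℝ → ℝ} {l : ι → ℝ} {a : ι → ℂ}
    (h : IsMeanSquareLimit E l a) (i : ι) :
    IsMeanSquareLimit (fun u ↦ E u - (a i * Complex.exp (l i * u * Complex.I)).re) l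
      (Function.update a i 0) := by
  intro ε hε
  obtain ⟨S₀, hS₀⟩ := h ε hε
  refine ⟨insert i S₀, fun S hS ↦ ?_⟩
  filter_upwards [hS₀ S ((Finset.subset_insert _ _).trans hS)] with T hT
  convert hT using 5 with u
  have hi : i ∈ S := hS (Finset.mem_insert_self _ _)
  rw [trigPoly, trigPoly, ← Finset.add_sum_erase _ _ hi, ← Finset.add_sum_erase S _ hi]
  have : ∑ j ∈ S.erase i, (Function.update a i 0 j * Complex.exp (l j * u * Complex.I)).re =
      ∑ j ∈ S.erase i, (a j * Complex.exp (l j * u * Complex.I)).re :=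
    Finset.sum_congr rfl fun j hj ↦ by
      rw [Function.update_of_ne (Finset.ne_of_mem_erase hj)]
  rw [this]
  simp
  ring

theorem IsMeanSquareLimit.law_singleton {ι : Type*} {E : ℝ → ℝ} {l : ι → ℝ}
    {a : ι → ℂ} (h : IsMeanSquareLimit E l a) (hE : Measurable E) (hl : LinearIndependent ℚ l)
    {μ : ProbabilityMeasure ℝ} (hμ : ∀ ξ, Tendsto (fun S : Finset ι ↦
      ∏ i ∈ S, charFun (cosLaw (a i)) ξ) atTop (nhds (charFun (μ : Measure ℝ) ξ)))
    {c : ℝ} (hc : c ≠ 0) : (μ : Measure ℝ) {c} = 0 := by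
  classical
  by_cases ha : ∃ i, a i ≠ 0
  · obtain ⟨i, hi⟩ := ha
    obtain ⟨μ', -, hμ'⟩ := (h.update i).exists_law (hE.sub (by fun_prop)) hl
    have heq : (μ : Measure ℝ) = Measure.conv (cosLaw (a i)) (μ' : Measure ℝ) := by
      refine Measure.ext_of_charFun (funext fun ξ ↦ ?_)
      rw [charFun_conv]
      refine tendsto_nhds_unique (hμ ξ) (((hμ' ξ).const_mul _).congr' ?_)
      filter_upwards [eventually_ge_atTop {i}] with S hS
      have hi : i ∈ S := hS (Finset.mem_singleton_self _)
      rw [← Finset.mul_prod_erase _ _ hi, ← Finset.mul_prod_erase S _ hi, Function.update_self,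
        cosLaw_zero, charFun_dirac]
      simp only [inner_zero_left, Complex.ofReal_zero, zero_mul, Complex.exp_zero, one_mul]
      congr 1
      refine Finset.prod_congr rfl fun j hj ↦ ?_
      rw [Function.update_of_ne (Finset.ne_of_mem_erase hj)]
    rw [heq, ← lintegral_indicator_one (measurableSet_singleton c), Measure.conv_comm,
      Measure.lintegral_conv (by fun_prop (disch := measurability))]
    refine (lintegral_congr fun x ↦ ?_).trans lintegral_zero
    have : ∀ y, indicator {c} (1 : ℝ → ENNReal) (x + y) =
        indicator {c - x} (1 : ℝ → ENNReal) y := fun y ↦ by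
      simp only [indicator, mem_singleton_iff, eq_sub_iff_add_eq', Pi.one_apply]
    simp only [this]
    rw [lintegral_indicator_one (measurableSet_singleton _), cosLaw_singleton hi]
  · push Not at ha
    have heq : (μ : Measure ℝ) = Measure.dirac 0 := by
      refine Measure.ext_of_charFun (funext fun ξ ↦ ?_)
      refine tendsto_nhds_unique (hμ ξ) (tendsto_const_nhds.congr fun S ↦ ?_)
      simp [ha, cosLaw_zero, charFun_dirac]
    rw [heq, Measure.dirac_apply' _ (measurableSet_singleton c)]
    simp [hc.symm]

/-- If the coefficients of two almost periodic functions have equal moduli, the limiting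
distribution of both is the same symmetric law, without atoms away from `0`. -/
theorem IsMeanSquareLimit.exists_density {ι : Type*} {E F : ℝ → ℝ} {l : ι → ℝ}
    {a b : ι → ℂ} (hEa : IsMeanSquareLimit E l a) (hFb : IsMeanSquareLimit F l b)
    (hE : Measurable E) (hF : Measurable F) (hl : LinearIndependent ℚ l)
    (hab : ∀ i, ∃ K : ℂ, ‖K‖ = 1 ∧ b i = K * a i) {c : ℝ} (hc : c ≠ 0) :
    ∃ d : ℝ, Tendsto (fun T : ℝ ↦ volume.real ({u | c < E u} ∩ Ioc 0 T) / T) atTop (nhds d) ∧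
      Tendsto (fun T : ℝ ↦ volume.real ({u | -c < F u} ∩ Ioc 0 T) / T) atTop (nhds (1 - d)) := by
  obtain ⟨μ, hμ, hμa⟩ := hEa.exists_law hE hl
  obtain ⟨ν, hν, hνb⟩ := hFb.exists_law hF hl
  have hνμ : (ν : Measure ℝ) = μ := by
    refine Measure.ext_of_charFun (funext fun ξ ↦ tendsto_nhds_unique (hνb ξ) ?_)
    refine (hμa ξ).congr fun S ↦ Finset.prod_congr rfl fun i _ ↦ ?_
    obtain ⟨K, hK, hi⟩ := hab i
    rw [hi, cosLaw_mul_of_norm_eq_one hK]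
  have hsymm : Measure.map (fun x : ℝ ↦ -1 * x) (μ : Measure ℝ) = μ := by
    have : IsFiniteMeasure (Measure.map (fun x : ℝ ↦ -1 * x) (μ : Measure ℝ)) :=
      Measure.isFiniteMeasure_map _ _
    refine Measure.ext_of_charFun (funext fun ξ ↦ ?_)
    rw [charFun_map_mul]
    refine tendsto_nhds_unique (hμa _) ((hμa ξ).congr fun S ↦ ?_)
    refine Finset.prod_congr rfl fun i _ ↦ ?_
    rw [neg_one_mul, charFun_cosLaw_neg]
  have hμc : ∀ c : ℝ, c ≠ 0 → (μ : Measure ℝ) {c} = 0 := fun c hc ↦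
    hEa.law_singleton hE hl hμa hc
  have hreal : ∀ (G : ℝ → ℝ) (c : ℝ), Tendsto (fun T : ℝ ↦
        (ENNReal.ofReal T)⁻¹ * volume ({u | c < G u} ∩ Ioc 0 T)) atTop
          (nhds ((μ : Measure ℝ) (Ioi c))) →
      Tendsto (fun T : ℝ ↦ volume.real ({u | c < G u} ∩ Ioc 0 T) / T) atTop
        (nhds ((μ : Measure ℝ).real (Ioi c))) := fun G c h ↦ by
    refine ((ENNReal.tendsto_toReal (measure_ne_top _ _)).comp h).congr' ?_
    filter_upwards [eventually_gt_atTop 0] with T hT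
    simp only [Function.comp_apply, ENNReal.toReal_mul, ENNReal.toReal_inv,
      ENNReal.toReal_ofReal hT.le, Measure.real]
    rw [div_eq_inv_mul]
  refine ⟨(μ : Measure ℝ).real (Ioi c), hreal E c (hμ c (hμc c hc)), ?_⟩
  have h1 : (1 : ℝ) - (μ : Measure ℝ).real (Ioi c) = (μ : Measure ℝ).real (Ioi (-c)) := by
    rw [← probReal_compl_eq_one_sub measurableSet_Ioi, compl_Ioi]
    conv_rhs => rw [← hsymm]
    rw [map_measureReal_apply (by fun_prop) measurableSet_Ioi]
    have h2 : (fun x : ℝ ↦ -1 * x) ⁻¹' Ioi (-c) = Iio c := by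
      ext x
      simp
    rw [h2]
    refine measureReal_congr ?_
    exact (Iio_ae_eq_Iic' (hμc c hc)).symm
  rw [h1]
  refine hreal F (-c) ?_
  rw [← hνμ]
  exact hν _ (by rw [hνμ]; exact hμc _ (neg_ne_zero.2 hc))

theorem exists_lintegral_psiErr_le (hRH : RiemannHypothesis) : ∃ C : ℝ, 0 < C ∧
    ∀ σ : ℝ, 0 < σ → σ < 1 → ∫⁻ u in Ioi 0, ENNReal.ofReal (psiErr u ^ 2 * rexp (-2 * σ * u)) ≤
      ENNReal.ofReal (C / σ) := by
  obtain ⟨C, hC, h⟩ := exists_lintegral_psiRem_le hRH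
  obtain ⟨K, hK, hKb⟩ := h ∅
  have hz := zetaTail_empty_ne_top hRH
  refine ⟨K.toReal + C * (zetaTail ∅).toReal + 1, by positivity, fun σ hσ hσ1 ↦ ?_⟩
  have h1 : ∫⁻ u in Ioi 0, ENNReal.ofReal (psiErr u ^ 2 * rexp (-2 * σ * u)) ≤
      ∫⁻ u, ENNReal.ofReal (‖psiRem ∅ u‖ ^ 2 * rexp (-2 * σ * u)) := by
    refine le_trans (le_of_eq (setLIntegral_congr_fun measurableSet_Ioi fun u hu ↦ ?_))
      (setLIntegral_le_lintegral (Ioi 0) _)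
    have hu' : (0 : ℝ) ≤ u := le_of_lt hu
    simp [psiRem, hu', zetaPoly]
  refine h1.trans ((hKb σ hσ hσ1).trans ?_)
  rw [← ENNReal.ofReal_toReal hK, ← ENNReal.ofReal_toReal hz, ← ENNReal.ofReal_mul (by positivity),
    ← ENNReal.ofReal_add (by positivity) (by positivity)]
  simp only [ENNReal.toReal_ofReal ENNReal.toReal_nonneg]
  refine ENNReal.ofReal_le_ofReal ?_
  rw [le_div_iff₀ hσ, add_mul, div_mul_eq_mul_div, div_mul_cancel₀ _ hσ.ne']
  have : K.toReal * σ ≤ K.toReal * 1 := by gcongr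
  linarith

theorem psiErr_mul_exp (u : ℝ) :
    psiErr u * rexp (-(u / 2)) = Chebyshev.psi (rexp u) * rexp (-u) - 1 := by
  rw [psiErr, mul_assoc, ← Real.exp_add, sub_mul, ← Real.exp_add]
  ring_nf
  simp
  ring

/-- Under RH, `ψ(x) = x + o(x)`. -/
theorem tendsto_psiErr_mul_exp (hRH : RiemannHypothesis) :
    Tendsto (fun u ↦ psiErr u * rexp (-(u / 2))) atTop (nhds 0) := by
  obtain ⟨C, hC, hCb⟩ := exists_lintegral_psiErr_le hRH
  set φ : ℝ → ℝ := fun u ↦ psiErr u * rexp (-(u / 2)) with hφ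
  have key : ∀ w δ c : ℝ, 0 ≤ w → 0 < δ → 0 < c → (∀ v ∈ Ioc w (w + δ), c ≤ |φ v|) →
      δ * (c ^ 2 * rexp (w / 2)) ≤ C / (1 / 4) := by
    intro w δ c hw hδ hc h
    have h1 := hCb (1 / 4) (by norm_num) (by norm_num)
    refine (ENNReal.ofReal_le_ofReal_iff (by positivity)).1 (le_trans ?_ h1)
    calc ENNReal.ofReal (δ * (c ^ 2 * rexp (w / 2)))
        = ∫⁻ _ in Ioc w (w + δ), ENNReal.ofReal (c ^ 2 * rexp (w / 2)) := by
          rw [setLIntegral_const, Real.volume_Ioc, add_sub_cancel_left, mul_comm δ,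
            ENNReal.ofReal_mul (by positivity)]
      _ ≤ ∫⁻ u in Ioc w (w + δ), ENNReal.ofReal (psiErr u ^ 2 * rexp (-2 * (1 / 4) * u)) := by
          refine setLIntegral_mono' measurableSet_Ioc fun v hv ↦ ?_
          refine ENNReal.ofReal_le_ofReal ?_
          have h2 : psiErr v ^ 2 * rexp (-2 * (1 / 4) * v) = |φ v| ^ 2 * rexp (v / 2) := by
            rw [sq_abs, hφ]
            simp only []
            rw [mul_pow, ← Real.exp_nat_mul, mul_assoc (psiErr v ^ 2), ← Real.exp_add]
            congr 2
            push_cast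
            ring
          rw [h2]
          have := h v hv
          have := hv.1
          gcongr
      _ ≤ _ := lintegral_mono_set fun v hv ↦ lt_of_le_of_lt hw hv.1
  have hφ' : ∀ u, φ u = Chebyshev.psi (rexp u) * rexp (-u) - 1 := psiErr_mul_exp
  rw [Metric.tendsto_nhds]
  intro ε₀ hε₀
  set ε := min ε₀ 1 with hεdef
  have hε : 0 < ε := lt_min hε₀ one_pos
  have hε1 : ε ≤ 1 := min_le_right _ _
  have hbig : ∀ᶠ u : ℝ in atTop, C / (1 / 4) < ε / 4 * ((ε / 2) ^ 2 * rexp ((u - 1) / 2)) := by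
    have : Tendsto (fun u : ℝ ↦ ε / 4 * ((ε / 2) ^ 2 * rexp ((u - 1) / 2))) atTop atTop := by
      refine Tendsto.const_mul_atTop (by positivity) (Tendsto.const_mul_atTop (by positivity) ?_)
      refine Real.tendsto_exp_atTop.comp ?_
      exact Tendsto.atTop_div_const two_pos (tendsto_atTop_add_const_right _ _ tendsto_id)
    exact this.eventually_gt_atTop _
  filter_upwards [hbig, eventually_ge_atTop 1] with u hu hu1
  rw [dist_zero_right, Real.norm_eq_abs]
  refine lt_of_lt_of_le ?_ (min_le_left ε₀ 1)
  change |φ u| < ε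
  by_contra! hcon
  have hpsi : ∀ x, Chebyshev.psi (rexp x) = (1 + φ x) * rexp x := fun x ↦ by
    rw [hφ', add_sub_cancel, mul_assoc, ← Real.exp_add]
    simp
  rcases le_abs.1 hcon with h | h
  · have h3 := key u (ε / 4) (ε / 2) (by linarith) (by positivity) (by positivity) fun v hv ↦ by
      refine le_trans ?_ (le_abs_self _)
      have h4 : (1 + ε) * rexp u ≤ Chebyshev.psi (rexp v) :=
        le_trans (by rw [hpsi]; gcongr) (Chebyshev.psi_mono (Real.exp_le_exp.2 hv.1.le))
      rw [hφ']
      have h5 : (1 + ε) * (1 - ε / 4) ≤ Chebyshev.psi (rexp v) * rexp (-v) := by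
        calc (1 + ε) * (1 - ε / 4) ≤ (1 + ε) * rexp (u - v) := by
              have := Real.add_one_le_exp (u - v)
              have := hv.2
              gcongr
              linarith
          _ = (1 + ε) * rexp u * rexp (-v) := by rw [mul_assoc, ← Real.exp_add]; ring_nf
          _ ≤ _ := by gcongr
      nlinarith
    have : rexp ((u - 1) / 2) ≤ rexp (u / 2) := Real.exp_le_exp.2 (by linarith)
    have : ε / 4 * ((ε / 2) ^ 2 * rexp ((u - 1) / 2)) ≤ ε / 4 * ((ε / 2) ^ 2 * rexp (u / 2)) := by
      gcongr
    linarith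
  · have h3 := key (u - ε / 4) (ε / 4) (ε / 2) (by linarith) (by positivity) (by positivity)
        fun v hv ↦ by
      refine le_trans ?_ (neg_le_abs _)
      have hv2 : v ≤ u := by linarith [hv.2]
      have h4 : Chebyshev.psi (rexp v) ≤ (1 - ε) * rexp u :=
        le_trans (Chebyshev.psi_mono (Real.exp_le_exp.2 hv2)) (by rw [hpsi]; gcongr; linarith)
      rw [hφ']
      have h5 : Chebyshev.psi (rexp v) * rexp (-v) ≤ (1 - ε) * (1 + ε / 2) := by
        calc _ ≤ (1 - ε) * rexp u * rexp (-v) := by gcongr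
          _ = (1 - ε) * rexp (u - v) := by rw [mul_assoc, ← Real.exp_add]; ring_nf
          _ ≤ (1 - ε) * (1 + ε / 2) := by
              have h6 : u - v ≤ ε / 4 := by linarith [hv.1]
              have h7 := Real.abs_exp_sub_one_le (x := u - v) (by
                rw [abs_of_nonneg (by linarith)]; linarith)
              rw [abs_of_nonneg (by linarith : (0 : ℝ) ≤ u - v)] at h7
              have := le_abs_self (rexp (u - v) - 1)
              have : (0 : ℝ) ≤ 1 - ε := by linarith
              gcongr
              linarith
      nlinarith
    have : rexp ((u - 1) / 2) ≤ rexp ((u - ε / 4) / 2) := Real.exp_le_exp.2 (by linarith)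
    have : ε / 4 * ((ε / 2) ^ 2 * rexp ((u - 1) / 2)) ≤
        ε / 4 * ((ε / 2) ^ 2 * rexp ((u - ε / 4) / 2)) := by
      gcongr
    linarith

/-- The normalized error term of `θ`. -/
noncomputable def thetaErr (u : ℝ) : ℝ := (Chebyshev.theta (rexp u) - rexp u) * rexp (-(u / 2))

theorem measurable_thetaErr : Measurable thetaErr := by
  unfold thetaErr
  have := Chebyshev.theta_mono.measurable
  fun_prop

theorem theta_sub_eq (u : ℝ) :
    Chebyshev.theta (rexp u) - rexp u = thetaErr u * rexp (u / 2) := by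
  rw [thetaErr, mul_assoc, ← Real.exp_add]
  simp

theorem thetaErr_eq (u : ℝ) : thetaErr u = psiErr u -
    (Chebyshev.psi (rexp u) - Chebyshev.theta (rexp u)) * rexp (-(u / 2)) := by
  rw [thetaErr, psiErr]
  ring

theorem tendsto_thetaErr_sub (hRH : RiemannHypothesis) :
    Tendsto (fun u ↦ thetaErr u - (psiErr u - 1)) atTop (nhds 0) := by
  have hpow : ∀ u r : ℝ, rexp u ^ r = rexp (u * r) := fun u r ↦ (Real.exp_mul u r).symm
  have h1 : Tendsto (fun u ↦ Chebyshev.psi (rexp (u / 2)) * rexp (-(u / 2))) atTop (nhds 1) := by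
    have := (tendsto_psiErr_mul_exp hRH).add_const 1
    simp only [psiErr_mul_exp, sub_add_cancel, zero_add] at this
    exact this.comp (tendsto_id.atTop_div_const two_pos)
  have hdecay : ∀ r : ℝ, r < 1 / 2 → Tendsto (fun u ↦
      Chebyshev.psi (rexp (u * r)) * rexp (-(u / 2))) atTop (nhds 0) := fun r hr ↦ by
    refine squeeze_zero (g := fun u ↦ (log 4 + 4) * rexp ((r - 1 / 2) * u))
      (fun u ↦ mul_nonneg (Chebyshev.psi_nonneg _) (Real.exp_pos _).le) (fun u ↦ ?_) ?_
    · calc _ ≤ (log 4 + 4) * rexp (u * r) * rexp (-(u / 2)) := by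
            gcongr
            exact Chebyshev.psi_le_const_mul_self (Real.exp_pos _).le
        _ = _ := by rw [mul_assoc, ← Real.exp_add]; ring_nf
    · rw [← mul_zero (log 4 + 4)]
      refine Tendsto.const_mul _ (Real.tendsto_exp_atBot.comp ?_)
      exact tendsto_id.const_mul_atTop_of_neg (by linarith)
  have h2 : Tendsto (fun u ↦ (Chebyshev.psi (rexp u) - Chebyshev.theta (rexp u)) *
      rexp (-(u / 2))) atTop (nhds 1) := by
    refine tendsto_of_tendsto_of_tendsto_of_le_of_le h1
      (by simpa using (h1.add (hdecay 3⁻¹ (by norm_num))).add (hdecay 5⁻¹ (by norm_num))) ?_ ?_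
    · intro u
      dsimp only
      gcongr
      have := Chebyshev.psi_sub_theta_ge_psi_add_psi_add_psi (Real.exp_pos u).le
      simp only [hpow] at this
      have h3 := Chebyshev.psi_nonneg (rexp (u * 3⁻¹))
      have h4 := Chebyshev.psi_nonneg (rexp (u * 7⁻¹))
      rw [div_eq_mul_inv]
      linarith
    · intro u
      dsimp only
      rw [← add_mul, ← add_mul]
      gcongr
      have := Chebyshev.psi_sub_theta_le_psi_add_psi_add_psi (rexp u)
      simp only [hpow] at this
      rwa [div_eq_mul_inv]
  have h3 := h2.const_sub 1
  rw [sub_self] at h3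
  refine h3.congr fun u ↦ ?_
  rw [thetaErr_eq]
  ring

theorem exists_lintegral_thetaErr_le (hRH : RiemannHypothesis) : ∃ C : ℝ, 0 < C ∧
    ∀ σ : ℝ, 0 < σ → σ < 1 → ∫⁻ u in Ioi 0, ENNReal.ofReal (thetaErr u ^ 2 * rexp (-2 * σ * u)) ≤
      ENNReal.ofReal (C / σ) := by
  obtain ⟨C, hC, h⟩ := exists_lintegral_psiErr_le hRH
  obtain ⟨M, hM⟩ := Chebyshev.psi_sub_theta_le_mul_sqrt
  refine ⟨2 * C + M ^ 2, by positivity, fun σ hσ hσ1 ↦ ?_⟩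
  have hpt : ∀ u, thetaErr u ^ 2 ≤ 2 * psiErr u ^ 2 + 2 * M ^ 2 := fun u ↦ by
    rw [thetaErr_eq]
    set y := (Chebyshev.psi (rexp u) - Chebyshev.theta (rexp u)) * rexp (-(u / 2)) with hy
    have hy0 : 0 ≤ y :=
      mul_nonneg (sub_nonneg.2 (Chebyshev.theta_le_psi _)) (Real.exp_pos _).le
    have hyM : y ≤ M := by
      calc y ≤ M * √(rexp u) * rexp (-(u / 2)) := by
            rw [hy]; gcongr; exact hM _
        _ = M := by
            rw [Real.sqrt_eq_rpow, ← Real.exp_mul, mul_assoc, ← Real.exp_add]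
            ring_nf
            simp
    nlinarith [sq_nonneg (psiErr u + y)]
  have hexp : ∫⁻ u in Ioi (0 : ℝ), ENNReal.ofReal (rexp (-2 * σ * u)) =
      ENNReal.ofReal (1 / (2 * σ)) := by
    have hi : IntegrableOn (fun u ↦ rexp (-2 * σ * u)) (Ioi 0) :=
      integrableOn_exp_mul_Ioi (by linarith) 0
    rw [← ofReal_integral_eq_lintegral_ofReal hi (Eventually.of_forall fun _ ↦ (Real.exp_pos _).le),
      integral_exp_mul_Ioi (by linarith)]
    congr 1
    simp
  calc _ ≤ ∫⁻ u in Ioi 0, (ENNReal.ofReal 2 * ENNReal.ofReal (psiErr u ^ 2 * rexp (-2 * σ * u)) +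
        ENNReal.ofReal (2 * M ^ 2) * ENNReal.ofReal (rexp (-2 * σ * u))) := by
        refine lintegral_mono fun u ↦ ?_
        rw [← ENNReal.ofReal_mul (by positivity), ← ENNReal.ofReal_mul (by positivity),
          ← ENNReal.ofReal_add (by positivity) (by positivity)]
        refine ENNReal.ofReal_le_ofReal ?_
        calc _ ≤ (2 * psiErr u ^ 2 + 2 * M ^ 2) * rexp (-2 * σ * u) := by
              gcongr
              exact hpt u
          _ = _ := by ring
    _ ≤ ENNReal.ofReal 2 * ENNReal.ofReal (C / σ) +
          ENNReal.ofReal (2 * M ^ 2) * ENNReal.ofReal (1 / (2 * σ)) := by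
        have := measurable_psiErr
        rw [lintegral_add_left (by fun_prop), lintegral_const_mul _ (by fun_prop),
          lintegral_const_mul _ (by fun_prop), hexp]
        gcongr
        exact h σ hσ hσ1
    _ = _ := by
        rw [← ENNReal.ofReal_mul (by positivity), ← ENNReal.ofReal_mul (by positivity),
          ← ENNReal.ofReal_add (by positivity) (by positivity)]
        congr 1
        field_simp

theorem setIntegral_image_exp {s : Set ℝ} (hs : MeasurableSet s) (f : ℝ → ℝ) :
    ∫ t in rexp '' s, f t = ∫ v in s, rexp v * f (rexp v) := by
  rw [integral_image_eq_integral_abs_deriv_smul hs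
    (fun x _ ↦ (Real.hasDerivAt_exp x).hasDerivWithinAt) Real.exp_injective.injOn]
  simp [abs_of_pos (Real.exp_pos _)]

theorem integrableOn_image_exp_iff {s : Set ℝ} (hs : MeasurableSet s) (f : ℝ → ℝ) :
    IntegrableOn f (rexp '' s) ↔ IntegrableOn (fun v ↦ rexp v * f (rexp v)) s := by
  rw [integrableOn_image_iff_integrableOn_abs_deriv_smul hs
    (fun x _ ↦ (Real.hasDerivAt_exp x).hasDerivWithinAt) Real.exp_injective.injOn]
  simp [abs_of_pos (Real.exp_pos _)]

theorem exp_image_Ioc (a b : ℝ) : rexp '' Ioc a b = Ioc (rexp a) (rexp b) := by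
  ext x
  constructor
  · rintro ⟨y, hy, rfl⟩
    exact ⟨Real.exp_lt_exp.2 hy.1, Real.exp_le_exp.2 hy.2⟩
  · intro hx
    have h0 : 0 < x := (Real.exp_pos a).trans hx.1
    exact ⟨log x, ⟨(Real.lt_log_iff_exp_lt h0).2 hx.1, (Real.log_le_iff_le_exp h0).2 hx.2⟩,
      Real.exp_log h0⟩

theorem integrable_exp_neg_abs_div {c : ℝ} (hc : 0 < c) : Integrable fun w : ℝ ↦ rexp (-(|w| / c)) := by
  have h1 : IntegrableOn (fun w : ℝ ↦ rexp (-(|w| / c))) (Ioi 0) := by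
    refine (integrableOn_exp_mul_Ioi (a := -(1 / c)) (by simpa using hc) 0).congr_fun (fun w hw ↦ ?_)
      measurableSet_Ioi
    rw [abs_of_pos hw]
    ring_nf
  have h2 : IntegrableOn (fun w : ℝ ↦ rexp (-(|w| / c))) (Iic 0) := by
    refine (integrableOn_exp_mul_Iic (a := 1 / c) (by simpa using hc) 0).congr_fun (fun w hw ↦ ?_)
      measurableSet_Iic
    rw [abs_of_nonpos hw]
    ring_nf
  rw [← integrableOn_univ, ← Iic_union_Ioi (a := (0 : ℝ))]
  exact h2.union h1

/-- Under RH, the local averages of `|thetaErr|` near `u` are `O(√u)`. -/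
theorem exists_lintegral_thetaErr_kernel_le (hRH : RiemannHypothesis) : ∃ C : ℝ, 0 < C ∧
    ∀ u : ℝ, 8 ≤ u → ∫⁻ v in Ioi 0, ENNReal.ofReal (|thetaErr v| * rexp (-(|u - v| / 4))) ≤
      ENNReal.ofReal (C * √u) := by
  obtain ⟨C, hC, h⟩ := exists_lintegral_thetaErr_le hRH
  set J : ℝ := ∫ w : ℝ, rexp (-(|w| / 4)) with hJ
  have hJ0 : 0 ≤ J := integral_nonneg fun _ ↦ (Real.exp_pos _).le
  refine ⟨C + rexp 2 * J, by positivity, fun u hu ↦ ?_⟩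
  have hu0 : 0 < u := by linarith
  have hs : 0 < √u := Real.sqrt_pos.2 hu0
  have hpt : ∀ v ∈ Ioi (0 : ℝ), |thetaErr v| * rexp (-(|u - v| / 4)) ≤
      1 / √u * (thetaErr v ^ 2 * rexp (-2 * (1 / u) * v)) +
        √u * rexp 2 * rexp (-(|u - v| / 4)) := by
    intro v hv
    have hv' : (0 : ℝ) < v := hv
    set X := |thetaErr v| * rexp (-(v / u)) with hX
    set Y := rexp (v / u) * rexp (-(|u - v| / 4)) with hY
    have h1 : |thetaErr v| * rexp (-(|u - v| / 4)) = X * Y := by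
      rw [hX, hY, mul_assoc, ← mul_assoc (rexp (-(v / u))), ← Real.exp_add]
      simp
    have h2 : thetaErr v ^ 2 * rexp (-2 * (1 / u) * v) = X ^ 2 := by
      rw [hX, mul_pow, sq_abs, ← Real.exp_nat_mul]
      congr 2
      push_cast
      ring
    have h3 : Y ^ 2 ≤ rexp 2 * rexp (-(|u - v| / 4)) := by
      rw [hY, ← Real.exp_add, ← Real.exp_nat_mul, ← Real.exp_add, Real.exp_le_exp]
      push_cast
      have h4 : v / u ≤ 1 + |u - v| / 8 := by
        rw [div_le_iff₀ hu0]
        have := neg_le_abs (u - v)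
        nlinarith [abs_nonneg (u - v)]
      linarith
    rw [h1, h2]
    have h5 : X * Y ≤ 1 / √u * X ^ 2 + √u * Y ^ 2 := by
      have h6 : X * Y = (X / √u) * (√u * Y) := by field_simp
      have h7 : 1 / √u * X ^ 2 = √u * (X / √u) ^ 2 := by field_simp
      have : X * Y = √u * ((X / √u) * Y) := by rw [h6]; ring
      rw [this, h7, ← mul_add]
      gcongr
      nlinarith [sq_nonneg (X / √u - Y), sq_nonneg (X / √u + Y)]
    calc _ ≤ _ := h5
      _ ≤ _ := by rw [mul_assoc]; gcongr
  have hmeas := measurable_thetaErr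
  calc _ ≤ ∫⁻ v in Ioi 0, (ENNReal.ofReal (1 / √u) *
        ENNReal.ofReal (thetaErr v ^ 2 * rexp (-2 * (1 / u) * v)) +
        ENNReal.ofReal (√u * rexp 2) * ENNReal.ofReal (rexp (-(|u - v| / 4)))) := by
        refine setLIntegral_mono' measurableSet_Ioi fun v hv ↦ ?_
        rw [← ENNReal.ofReal_mul (by positivity), ← ENNReal.ofReal_mul (by positivity),
          ← ENNReal.ofReal_add (by positivity) (by positivity)]
        exact ENNReal.ofReal_le_ofReal (hpt v hv)
    _ ≤ ENNReal.ofReal (1 / √u) * ENNReal.ofReal (C / (1 / u)) +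
        ENNReal.ofReal (√u * rexp 2) * ENNReal.ofReal J := by
        rw [lintegral_add_left (by fun_prop), lintegral_const_mul _ (by fun_prop),
          lintegral_const_mul _ (by fun_prop)]
        gcongr
        · exact h (1 / u) (by positivity) (by rw [div_lt_one hu0]; linarith)
        · refine (setLIntegral_le_lintegral _ _).trans ?_
          rw [lintegral_sub_left_eq_self (fun w ↦ ENNReal.ofReal (rexp (-(|w| / 4)))) u, hJ,
            ofReal_integral_eq_lintegral_ofReal (integrable_exp_neg_abs_div (by norm_num))
              (Eventually.of_forall fun _ ↦ (Real.exp_pos _).le)]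
    _ = _ := by
        rw [← ENNReal.ofReal_mul (by positivity), ← ENNReal.ofReal_mul (by positivity),
          ← ENNReal.ofReal_add (by positivity) (by positivity)]
        congr 1
        have : u = √u * √u := (Real.mul_self_sqrt hu0.le).symm
        field_simp
        nlinarith

theorem exists_integral_thetaErr_kernel_le (hRH : RiemannHypothesis) : ∃ C : ℝ, 0 < C ∧
    ∀ u : ℝ, 8 ≤ u → IntegrableOn (fun v ↦ |thetaErr v| * rexp (-(|u - v| / 4))) (Ioi 0) ∧
      ∫ v in Ioi 0, |thetaErr v| * rexp (-(|u - v| / 4)) ≤ C * √u := by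
  obtain ⟨C, hC, h⟩ := exists_lintegral_thetaErr_kernel_le hRH
  have hm := measurable_thetaErr
  refine ⟨C, hC, fun u hu ↦ ⟨?_, ?_⟩⟩
  · refine ⟨by fun_prop, ?_⟩
    rw [hasFiniteIntegral_iff_ofReal (Eventually.of_forall fun _ ↦ by positivity)]
    exact (h u hu).trans_lt ENNReal.ofReal_lt_top
  · rw [integral_eq_lintegral_of_nonneg_ae (Eventually.of_forall fun _ ↦ by positivity)
      (by fun_prop)]
    exact ENNReal.toReal_le_of_le_ofReal (by positivity) (h u hu)

theorem tendsto_sqrt_div_self : Tendsto (fun u : ℝ ↦ √u / u) atTop (nhds 0) := by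
  have : Tendsto (fun u : ℝ ↦ (√u)⁻¹) atTop (nhds 0) := tendsto_inv_atTop_zero.comp tendsto_sqrt_atTop
  refine this.congr fun u ↦ ?_
  rw [Real.sqrt_div_self]

theorem tendsto_mul_exp_neg_div_two :
    Tendsto (fun u : ℝ ↦ u * rexp (-(u / 2))) atTop (nhds 0) := by
  have := (Real.tendsto_pow_mul_exp_neg_atTop_nhds_zero 1).comp
    (tendsto_id.atTop_div_const (two_pos (α := ℝ)))
  simpa using this.const_mul 2 |>.congr fun u ↦ by simp; ring

/-- The normalized error term of `π`. -/
noncomputable def piErr (u : ℝ) : ℝ :=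
  ((Nat.primeCounting ⌊rexp u⌋₊ : ℝ) - ∫ t in Icc 2 (rexp u), 1 / log t) * (u * rexp (-(u / 2)))

theorem integral_one_div_log_eq {x : ℝ} (hx : 2 ≤ x) : ∫ t in (2 : ℝ)..x, 1 / log t =
    x / log x - 2 / log 2 + ∫ t in (2 : ℝ)..x, 1 / log t ^ 2 := by
  have hi2 := Chebyshev.intervalIntegrable_one_div_log_sq (a := 2) (b := x) (by norm_num)
    (by linarith)
  have hpos : ∀ t ∈ uIcc 2 x, 0 < log t := fun t ht ↦ by
    rw [uIcc_of_le hx] at ht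
    exact Real.log_pos (by linarith [ht.1])
  have hi1 : IntervalIntegrable (fun t ↦ 1 / log t) volume 2 x := by
    refine ContinuousOn.intervalIntegrable (ContinuousOn.div continuousOn_const ?_ fun t ht ↦ (hpos t ht).ne')
    refine Real.continuousOn_log.mono fun t ht ↦ ?_
    rw [uIcc_of_le hx] at ht
    have := ht.1
    simp only [mem_compl_iff, mem_singleton_iff]
    linarith
  have h := intervalIntegral.integral_eq_sub_of_hasDerivAt (a := 2) (b := x)
    (f := fun t ↦ t / log t) (f' := fun t ↦ 1 / log t - 1 / log t ^ 2) (fun t ht ↦ by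
      have h1 := hpos t ht
      have h0 : t ≠ 0 := by
        rintro rfl
        simp at h1
      have := (hasDerivAt_id t).div (Real.hasDerivAt_log h0) h1.ne'
      have h2 : 1 / log t - 1 / log t ^ 2 = (1 * log t - id t * t⁻¹) / log t ^ 2 := by
        simp only [id]
        field_simp
      rw [h2]
      exact this) (hi1.sub hi2)
  rw [intervalIntegral.integral_sub hi1 hi2] at h
  linarith

theorem piErr_eq {u : ℝ} (hu : log 2 ≤ u) : piErr u = thetaErr u + u * rexp (-(u / 2)) *
    (2 / log 2 + ∫ v in Ioc (log 2) u, thetaErr v * rexp (v / 2) / v ^ 2) := by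
  have hx : 2 ≤ rexp u := (Real.log_le_iff_le_exp two_pos).1 hu
  have hu0 : 0 < u := (Real.log_pos one_lt_two).trans_le hu
  rw [piErr, integral_Icc_eq_integral_Ioc, ← intervalIntegral.integral_of_le hx,
    integral_one_div_log_eq hx, Chebyshev.primeCounting_eq_theta_div_log_add_integral hx,
    Real.log_exp]
  have h1 : ∫ v in Ioc (log 2) u, thetaErr v * rexp (v / 2) / v ^ 2 =
      (∫ t in (2 : ℝ)..rexp u, Chebyshev.theta t / (t * log t ^ 2)) -
        ∫ t in (2 : ℝ)..rexp u, 1 / log t ^ 2 := by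
    rw [← intervalIntegral.integral_sub, intervalIntegral.integral_of_le hx]
    · conv_rhs => rw [← Real.exp_log (two_pos (α := ℝ)), ← exp_image_Ioc]
      rw [setIntegral_image_exp measurableSet_Ioc]
      refine setIntegral_congr_fun measurableSet_Ioc fun v _ ↦ ?_
      simp only [Real.log_exp]
      rw [← theta_sub_eq]
      field_simp
    · rw [intervalIntegrable_iff_integrableOn_Ioc_of_le hx]
      exact (Chebyshev.integrableOn_theta_div_id_mul_log_sq _).mono_set Ioc_subset_Icc_self
    · exact Chebyshev.intervalIntegrable_one_div_log_sq (by norm_num) (by linarith)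
  rw [h1, thetaErr]
  field_simp
  ring

/-- Under RH, the normalized error terms of `π` and `θ` agree asymptotically. -/
theorem tendsto_piErr_sub (hRH : RiemannHypothesis) :
    Tendsto (fun u ↦ piErr u - thetaErr u) atTop (nhds 0) := by
  obtain ⟨C, hC, h⟩ := exists_integral_thetaErr_kernel_le hRH
  have hlim : Tendsto (fun u : ℝ ↦ 2 / log 2 * (u * rexp (-(u / 2))) + 256 * C * (√u / u))
      atTop (nhds 0) := by
    simpa using (tendsto_mul_exp_neg_div_two.const_mul (2 / log 2)).add (tendsto_sqrt_div_self.const_mul (256 * C))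
  refine squeeze_zero_norm' ?_ hlim
  filter_upwards [eventually_ge_atTop 8] with u hu
  have hu0 : 0 < u := by linarith
  have hl2 : 1 / 2 < log 2 := by linarith [Real.log_two_gt_d9]
  obtain ⟨hi, hb⟩ := h u hu
  rw [piErr_eq (by linarith [Real.log_two_lt_d9]), add_sub_cancel_left, mul_add, Real.norm_eq_abs]
  refine (abs_add_le _ _).trans (add_le_add ?_ ?_)
  · rw [abs_of_nonneg (by positivity)]
    linarith
  · rw [← integral_const_mul, ← Real.norm_eq_abs]
    have hsub : Ioc (log 2) u ⊆ Ioi 0 := fun v hv ↦ lt_trans (by linarith) hv.1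
    have hi' := (hi.mono_set hsub).const_mul (256 / u)
    refine (norm_integral_le_of_norm_le hi' ?_).trans ?_
    · refine (ae_restrict_iff' measurableSet_Ioc).2 (Eventually.of_forall fun v hv ↦ ?_)
      have hv0 : 0 < v := hsub hv
      have hv1 : 1 / 2 < v := hl2.trans hv.1
      have hw : 0 ≤ u - v := sub_nonneg.2 hv.2
      rw [Real.norm_eq_abs, abs_mul, abs_div, abs_mul, abs_of_pos (Real.exp_pos _),
        abs_of_pos hu0, abs_of_nonneg hw, abs_mul, abs_of_nonneg (sq_nonneg v),
        abs_of_pos (Real.exp_pos _)]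
      have h1 : u / v ≤ 16 * rexp ((u - v) / 8) := by
        have := Real.add_one_le_exp ((u - v) / 8)
        rw [div_le_iff₀ hv0]
        nlinarith
      have h2 : (u / v) ^ 2 ≤ 256 * rexp ((u - v) / 4) := by
        calc (u / v) ^ 2 ≤ (16 * rexp ((u - v) / 8)) ^ 2 := by gcongr
          _ = _ := by
            rw [mul_pow, ← Real.exp_nat_mul]
            push_cast
            ring_nf
      calc u * rexp (-(u / 2)) * (|thetaErr v| * rexp (v / 2) / v ^ 2)
          = (u / v) ^ 2 * (1 / u * |thetaErr v| * rexp (-((u - v) / 2))) := by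
            have : rexp (-((u - v) / 2)) = rexp (-(u / 2)) * rexp (v / 2) := by
              rw [← Real.exp_add]
              ring_nf
            rw [this]
            field_simp
        _ ≤ 256 * rexp ((u - v) / 4) * (1 / u * |thetaErr v| * rexp (-((u - v) / 2))) := by
            gcongr
        _ = 256 / u * (|thetaErr v| * rexp (-((u - v) / 4))) := by
            have : rexp (-((u - v) / 4)) = rexp ((u - v) / 4) * rexp (-((u - v) / 2)) := by
              rw [← Real.exp_add]
              ring_nf
            rw [this]
            ring
    · rw [integral_const_mul]
      have : ∫ v in Ioc (log 2) u, |thetaErr v| * rexp (-(|u - v| / 4)) ≤ C * √u :=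
        (setIntegral_mono_set hi (Eventually.of_forall fun _ ↦ by positivity)
          hsub.eventuallyLE).trans hb
      calc _ ≤ 256 / u * (C * √u) := by gcongr
        _ = _ := by ring

/-- `∑_{p ≤ x} 1/p`. -/
noncomputable def primeRecipSum (x : ℝ) : ℝ :=
  ∑ p ∈ Finset.filter Nat.Prime (Finset.Iic ⌊x⌋₊), (1 : ℝ) / p

/-- `-log (1 - 1/n) - 1/n`. -/
noncomputable def logRem (n : ℕ) : ℝ := -log (1 - 1 / n) - 1 / n

theorem hasDerivAt_inv_mul_log {t : ℝ} (ht : 1 < t) :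
    HasDerivAt (fun t ↦ (t * log t)⁻¹) (-((1 + log t) / (t * log t) ^ 2)) t := by
  have h0 : t ≠ 0 := by linarith
  have h1 : log t ≠ 0 := (Real.log_pos ht).ne'
  have h2 := ((hasDerivAt_id t).mul (Real.hasDerivAt_log h0)).inv
    (mul_ne_zero (by simpa using h0) h1)
  have h3 : -((1 + log t) / (t * log t) ^ 2) =
      -(1 * log t + id t * t⁻¹) / (t * log t) ^ 2 := by
    simp only [id]
    field_simp
    ring
  rw [h3]
  exact h2

theorem continuousOn_deriv_inv_mul_log {s : Set ℝ} (hs : ∀ t ∈ s, 1 < t) :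
    ContinuousOn (fun t ↦ (1 + log t) / (t * log t) ^ 2) s := by
  have hl : ContinuousOn log s := Real.continuousOn_log.mono fun t ht ↦ by
    have := hs t ht
    simp only [mem_compl_iff, mem_singleton_iff]
    linarith
  refine (continuousOn_const.add hl).div ((continuousOn_id.mul hl).pow 2) fun t ht ↦ ?_
  have h1 := hs t ht
  have h2 := Real.log_pos h1
  have : (0 : ℝ) < t := by linarith
  exact (pow_pos (mul_pos this h2) 2).ne'

theorem integrableOn_theta_mul_deriv (x : ℝ) :
    IntegrableOn (fun t ↦ (1 + log t) / (t * log t) ^ 2 * Chebyshev.theta t) (Icc 2 x) := by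
  conv => arg 1; ext; rw [Chebyshev.theta, Finset.sum_filter]
  exact integrableOn_mul_sum_Icc _ (by norm_num) (ContinuousOn.integrableOn_Icc
    (continuousOn_deriv_inv_mul_log fun t ht ↦ by linarith [ht.1]))

theorem primeRecipSum_eq (x : ℝ) : primeRecipSum x = Chebyshev.theta x / (x * log x) +
    ∫ t in Ioc 2 x, (1 + log t) / (t * log t) ^ 2 * Chebyshev.theta t := by
  let a : ℕ → ℝ := fun n ↦ if n.Prime then log n else 0
  have ha : ∀ t : ℝ, ∑ k ∈ Finset.Icc 0 ⌊t⌋₊, a k = Chebyshev.theta t := fun t ↦ by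
    rw [Chebyshev.theta_eq_sum_Icc, Finset.sum_filter]
  have hd : ∀ t ∈ Icc 2 x, deriv (fun t ↦ (t * log t)⁻¹) t = -((1 + log t) / (t * log t) ^ 2) :=
    fun t ht ↦ (hasDerivAt_inv_mul_log (by linarith [ht.1])).deriv
  have hcont : ContinuousOn (fun t ↦ -((1 + log t) / (t * log t) ^ 2)) (Icc 2 x) :=
    (continuousOn_deriv_inv_mul_log fun t ht ↦ by linarith [ht.1]).neg
  have h := sum_mul_eq_sub_integral_mul₁ a (f := fun t ↦ (t * log t)⁻¹) (by simp [a])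
    (by simp [a]) x (fun t ht ↦ (hasDerivAt_inv_mul_log (by linarith [ht.1])).differentiableAt)
    ((hcont.integrableOn_Icc).congr_fun (fun t ht ↦ (hd t ht).symm) measurableSet_Icc)
  simp only [ha] at h
  have h1 : primeRecipSum x = ∑ k ∈ Finset.Icc 0 ⌊x⌋₊, ((k : ℝ) * log k)⁻¹ * a k := by
    rw [primeRecipSum, Finset.sum_filter]
    refine Finset.sum_congr rfl fun n _ ↦ ?_
    simp only [a]
    split_ifs with hn
    · have h1 : (1 : ℝ) < n := by exact_mod_cast hn.one_lt
      have := Real.log_pos h1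
      field_simp
    · simp
  rw [h1, h, setIntegral_congr_fun measurableSet_Ioc
    (g := fun t ↦ -((1 + log t) / (t * log t) ^ 2 * Chebyshev.theta t)) fun t ht ↦ by
      simp only [hd t (Ioc_subset_Icc_self ht), neg_mul], integral_neg]
  ring

/-- The weight in the partial summation formula for `∑ 1/p`, in the variable `v = log t`. -/
noncomputable def recipKernel (v : ℝ) : ℝ := thetaErr v * rexp (-(v / 2)) * ((1 + v) / v ^ 2)

theorem integral_one_add_div_sq {a b : ℝ} (ha : 0 < a) (hab : a ≤ b) :
    IntegrableOn (fun v ↦ (1 + v) / v ^ 2) (Ioc a b) ∧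
    ∫ v in Ioc a b, (1 + v) / v ^ 2 = (log b - 1 / b) - (log a - 1 / a) := by
  have hc : ContinuousOn (fun v : ℝ ↦ (1 + v) / v ^ 2) (Icc a b) := by
    refine ContinuousOn.div (by fun_prop) (by fun_prop) fun v hv ↦ ?_
    have : 0 < v := ha.trans_le hv.1
    positivity
  refine ⟨hc.integrableOn_Icc.mono_set Ioc_subset_Icc_self, ?_⟩
  rw [← intervalIntegral.integral_of_le hab]
  refine intervalIntegral.integral_eq_sub_of_hasDerivAt (f := fun v ↦ log v - 1 / v)
    (fun v hv ↦ ?_) (ContinuousOn.intervalIntegrable (by rwa [uIcc_of_le hab]))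
  rw [uIcc_of_le hab] at hv
  have h0 : v ≠ 0 := (ha.trans_le hv.1).ne'
  have h1 := (Real.hasDerivAt_log h0).sub (hasDerivAt_inv h0)
  simp only [one_div]
  have h2 : (1 + v) / v ^ 2 = v⁻¹ - -(v ^ 2)⁻¹ := by field_simp; ring
  rw [h2]
  exact h1

theorem primeRecipSum_exp_eq {u : ℝ} (hu : log 2 ≤ u) : primeRecipSum (rexp u) =
    log u + (1 / log 2 - log (log 2)) + thetaErr u * rexp (-(u / 2)) / u +
      ∫ v in Ioc (log 2) u, recipKernel v := by
  have hl2 : 0 < log 2 := Real.log_pos one_lt_two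
  have hu0 : 0 < u := hl2.trans_le hu
  have key : ∀ v ∈ Ioc (log 2) u, rexp v * ((1 + log (rexp v)) / (rexp v * log (rexp v)) ^ 2 *
      Chebyshev.theta (rexp v)) = recipKernel v + (1 + v) / v ^ 2 := fun v hv ↦ by
    have hv0 : 0 < v := hl2.trans hv.1
    rw [Real.log_exp, recipKernel, thetaErr]
    have h1 : rexp (-(v / 2)) * rexp (-(v / 2)) * rexp v = 1 := by
      rw [← Real.exp_add, ← Real.exp_add]
      ring_nf
      simp
    have h2 : (Chebyshev.theta (rexp v) - rexp v) * rexp (-(v / 2)) * rexp (-(v / 2)) =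
        Chebyshev.theta (rexp v) / rexp v - 1 := by
      rw [eq_sub_iff_add_eq, eq_div_iff (Real.exp_pos v).ne']
      linear_combination (Chebyshev.theta (rexp v) - rexp v) * h1
    rw [h2]
    field_simp
    ring
  obtain ⟨hi, hv⟩ := integral_one_add_div_sq hl2 hu
  have hInt : IntegrableOn (fun v ↦ recipKernel v + (1 + v) / v ^ 2) (Ioc (log 2) u) := by
    refine IntegrableOn.congr_fun ?_ key measurableSet_Ioc
    refine (integrableOn_image_exp_iff measurableSet_Ioc
      (fun t ↦ (1 + log t) / (t * log t) ^ 2 * Chebyshev.theta t)).1 ?_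
    rw [exp_image_Ioc, Real.exp_log two_pos]
    exact (integrableOn_theta_mul_deriv _).mono_set Ioc_subset_Icc_self
  have hr : IntegrableOn recipKernel (Ioc (log 2) u) :=
    (hInt.sub hi).congr_fun (fun v _ ↦ by simp) measurableSet_Ioc
  rw [primeRecipSum_eq, Real.log_exp]
  have h3 : ∫ t in Ioc 2 (rexp u), (1 + log t) / (t * log t) ^ 2 * Chebyshev.theta t =
      (∫ v in Ioc (log 2) u, recipKernel v) + ((log u - 1 / u) - (log (log 2) - 1 / log 2)) := by
    conv_lhs => rw [← Real.exp_log (two_pos (α := ℝ)), ← exp_image_Ioc]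
    rw [setIntegral_image_exp measurableSet_Ioc, setIntegral_congr_fun measurableSet_Ioc key,
      integral_add hr hi, hv]
  rw [h3]
  have h4 : Chebyshev.theta (rexp u) / (rexp u * u) = thetaErr u * rexp (-(u / 2)) / u + 1 / u := by
    have h1 : rexp (-(u / 2)) * rexp (-(u / 2)) * rexp u = 1 := by
      rw [← Real.exp_add, ← Real.exp_add]
      ring_nf
      simp
    rw [thetaErr]
    field_simp
    linear_combination -(Chebyshev.theta (rexp u) - rexp u) * h1
  rw [h4]
  ring

theorem logRem_nonneg_and_le {n : ℕ} (hn : 2 ≤ n) :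
    0 ≤ logRem n ∧ logRem n ≤ 2 * ((n : ℝ) ^ 2)⁻¹ := by
  have h2 : (2 : ℝ) ≤ n := by exact_mod_cast hn
  have h0 : (0 : ℝ) < n := by linarith
  have hy : (1 : ℝ) / n ≤ 1 / 2 := by gcongr
  have hy0 : (0 : ℝ) < 1 / n := by positivity
  have h3 : ((n : ℝ) ^ 2)⁻¹ = (1 / n) ^ 2 := by simp
  rw [logRem, h3]
  set y : ℝ := 1 / n
  constructor
  · have := Real.log_le_sub_one_of_pos (x := 1 - y) (by linarith)
    linarith
  · have h4 := Real.abs_log_sub_add_sum_range_le (x := y) (by rw [abs_of_pos hy0]; linarith) 1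
    simp only [Finset.sum_range_one] at h4
    have h5 := (abs_le.1 h4).1
    rw [abs_of_pos hy0] at h5
    norm_num at h5
    have h6 : y ^ 2 / (1 - y) ≤ 2 * y ^ 2 := by
      rw [div_le_iff₀ (by linarith)]
      nlinarith [sq_nonneg y]
    linarith

theorem log_mertensProd (x : ℝ) : log (mertensProd x) = primeRecipSum x +
    ∑ p ∈ Finset.filter Nat.Prime (Finset.Iic ⌊x⌋₊), logRem p := by
  rw [mertensProd, Real.log_prod, primeRecipSum, ← Finset.sum_add_distrib]
  · refine Finset.sum_congr rfl fun p _ ↦ ?_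
    rw [Real.log_inv, logRem]
    ring
  · intro p hp
    have h1 : (1 : ℝ) < p := by exact_mod_cast (Finset.mem_filter.1 hp).2.one_lt
    have : (1 : ℝ) / p < 1 := by rw [div_lt_one (by linarith)]; exact h1
    refine inv_ne_zero (by linarith)

theorem mertensProd_pos (x : ℝ) : 0 < mertensProd x := by
  refine Finset.prod_pos fun p hp ↦ ?_
  have h1 : (1 : ℝ) < p := by exact_mod_cast (Finset.mem_filter.1 hp).2.one_lt
  have : (1 : ℝ) / p < 1 := by rw [div_lt_one (by linarith)]; exact h1
  exact inv_pos.2 (by linarith)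

theorem exists_sum_logRem_sub_le : ∃ c : ℝ, ∀ x : ℝ, 2 ≤ x →
    |(∑ p ∈ Finset.filter Nat.Prime (Finset.Iic ⌊x⌋₊), logRem p) - c| ≤ 4 / x := by
  let r : ℕ → ℝ := fun n ↦ if n.Prime then logRem n else 0
  have hr0 : ∀ n, 0 ≤ r n := fun n ↦ by
    simp only [r]
    split_ifs with h
    · exact (logRem_nonneg_and_le h.two_le).1
    · exact le_rfl
  have hr1 : ∀ n, r n ≤ 2 * ((n : ℝ) ^ 2)⁻¹ := fun n ↦ by
    simp only [r]
    split_ifs with h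
    · exact (logRem_nonneg_and_le h.two_le).2
    · positivity
  have hs : Summable r := Summable.of_nonneg_of_le hr0 hr1
    ((Real.summable_nat_pow_inv.2 one_lt_two).mul_left 2)
  refine ⟨∑' n, r n, fun x hx ↦ ?_⟩
  set N := ⌊x⌋₊ with hN
  have hN1 : 1 ≤ N := Nat.le_floor (by norm_num; linarith)
  have h1 : ∑ p ∈ Finset.filter Nat.Prime (Finset.Iic N), logRem p =
      ∑ n ∈ Finset.range (N + 1), r n := by
    rw [Finset.sum_filter]
    refine Finset.sum_congr ?_ fun _ _ ↦ rfl
    ext n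
    simp
  rw [h1]
  have hlow : ∑ n ∈ Finset.range (N + 1), r n ≤ ∑' n, r n := hs.sum_le_tsum _ fun n _ ↦ hr0 n
  have hup : ∑' n, r n ≤ ∑ n ∈ Finset.range (N + 1), r n + 2 * (N : ℝ)⁻¹ := by
    refine le_of_tendsto hs.hasSum.tendsto_sum_nat ?_
    filter_upwards [eventually_ge_atTop (N + 1)] with M hM
    rw [← Finset.sum_range_add_sum_Ico _ hM]
    gcongr
    calc ∑ n ∈ Finset.Ico (N + 1) M, r n ≤ ∑ n ∈ Finset.Ioc N M, 2 * ((n : ℝ) ^ 2)⁻¹ := by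
          refine (Finset.sum_le_sum fun n _ ↦ hr1 n).trans
            (Finset.sum_le_sum_of_subset_of_nonneg ?_ fun _ _ _ ↦ by positivity)
          intro n hn
          simp only [Finset.mem_Ico, Finset.mem_Ioc] at hn ⊢
          omega
      _ ≤ 2 * ((N : ℝ)⁻¹ - (M : ℝ)⁻¹) := by
          rw [← Finset.mul_sum]
          gcongr
          exact sum_Ioc_inv_sq_le_sub (by omega) (by omega)
      _ ≤ 2 * (N : ℝ)⁻¹ := by
          gcongr
          have : (0 : ℝ) ≤ (M : ℝ)⁻¹ := by positivity
          linarith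
  have hNx : 2 * (N : ℝ)⁻¹ ≤ 4 / x := by
    have h2 := Nat.lt_floor_add_one x
    rw [← hN] at h2
    have h3 : (1 : ℝ) ≤ N := by exact_mod_cast hN1
    rw [← div_eq_mul_inv, div_le_div_iff₀ (by linarith) (by linarith)]
    linarith
  rw [abs_le]
  constructor <;> linarith

/-- The normalized error term in Mertens' product theorem with constant `L`. -/
noncomputable def mertensErr (L u : ℝ) : ℝ :=
  (log (mertensProd (rexp u)) - log u - L) * (u * rexp (u / 2))

theorem integrableOn_thetaErr_mul_exp (hRH : RiemannHypothesis) :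
    IntegrableOn (fun v ↦ |thetaErr v| * rexp (-(v / 2))) (Ioi 0) := by
  obtain ⟨C, -, h⟩ := exists_integral_thetaErr_kernel_le hRH
  have hm := measurable_thetaErr
  refine ((h 8 le_rfl).1.const_mul (rexp 2)).mono' (by fun_prop) ?_
  refine (ae_restrict_iff' measurableSet_Ioi).2 (Eventually.of_forall fun v hv ↦ ?_)
  have hv0 : (0 : ℝ) < v := hv
  rw [Real.norm_eq_abs, abs_mul, abs_abs, abs_of_pos (Real.exp_pos _), mul_left_comm,
    ← Real.exp_add]
  gcongr
  have : |8 - v| ≤ 8 + v := abs_le.2 ⟨by linarith, by linarith⟩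
  linarith

theorem integrableOn_recipKernel (hRH : RiemannHypothesis) :
    IntegrableOn recipKernel (Ioi (log 2)) := by
  have hl2 : 1 / 2 < log 2 := by linarith [Real.log_two_gt_d9]
  have hm := measurable_thetaErr
  have hsub : Ioi (log 2) ⊆ Ioi 0 := Ioi_subset_Ioi (by linarith)
  refine (((integrableOn_thetaErr_mul_exp hRH).mono_set hsub).const_mul 6).mono'
    (by unfold recipKernel; fun_prop) ?_
  refine (ae_restrict_iff' measurableSet_Ioi).2 (Eventually.of_forall fun v hv ↦ ?_)
  have hv0 : 1 / 2 < v := hl2.trans hv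
  have h6 : (1 + v) / v ^ 2 ≤ 6 := by
    rw [div_le_iff₀ (by positivity)]
    nlinarith
  rw [Real.norm_eq_abs, recipKernel, abs_mul, abs_mul, abs_of_pos (Real.exp_pos _),
    abs_of_nonneg (by positivity : 0 ≤ (1 + v) / v ^ 2), mul_comm 6]
  gcongr

theorem tendsto_thetaErr_mul_exp (hRH : RiemannHypothesis) :
    Tendsto (fun u ↦ thetaErr u * rexp (-(u / 2))) atTop (nhds 0) := by
  have he : Tendsto (fun u : ℝ ↦ rexp (-(u / 2))) atTop (nhds 0) :=
    Real.tendsto_exp_neg_atTop_nhds_zero.comp (tendsto_id.atTop_div_const two_pos)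
  have h := (((tendsto_thetaErr_sub hRH).mul he).add (tendsto_psiErr_mul_exp hRH)).sub he
  simp only [mul_zero, add_zero, sub_zero] at h
  exact h.congr fun u ↦ by ring

/-- The difference between the kernel in the partial summation formula and its main term. -/
theorem tendsto_integral_recipKernel_sub (hRH : RiemannHypothesis) :
    Tendsto (fun u ↦ u * rexp (u / 2) * (∫ v in Ioi u, recipKernel v) -
      rexp (u / 2) * ∫ v in Ioi u, thetaErr v * rexp (-(v / 2))) atTop (nhds 0) := by
  obtain ⟨C, hC, h⟩ := exists_integral_thetaErr_kernel_le hRH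
  have hlim : Tendsto (fun u : ℝ ↦ 4 * C * (√u / u)) atTop (nhds 0) := by
    simpa using tendsto_sqrt_div_self.const_mul (4 * C)
  refine squeeze_zero_norm' ?_ hlim
  filter_upwards [eventually_ge_atTop 8] with u hu
  have hu0 : 0 < u := by linarith
  obtain ⟨hi, hb⟩ := h u hu
  have hsub : Ioi u ⊆ Ioi 0 := Ioi_subset_Ioi hu0.le
  have hi1 : IntegrableOn recipKernel (Ioi u) := (integrableOn_recipKernel hRH).mono_set
    (Ioi_subset_Ioi (by linarith [Real.log_two_lt_d9]))
  have hm := measurable_thetaErr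
  have hi2 : IntegrableOn (fun v ↦ thetaErr v * rexp (-(v / 2))) (Ioi u) :=
    ((integrableOn_thetaErr_mul_exp hRH).mono_set hsub).mono' (by fun_prop)
      (Eventually.of_forall fun v ↦ by rw [norm_mul, Real.norm_eq_abs, Real.norm_eq_abs,
        abs_of_pos (Real.exp_pos _)])
  rw [← integral_const_mul, ← integral_const_mul, ← integral_sub (hi1.const_mul _) (hi2.const_mul _)]
  have hi' := (hi.mono_set hsub).const_mul (4 / u)
  refine (norm_integral_le_of_norm_le hi' ?_).trans ?_
  · refine (ae_restrict_iff' measurableSet_Ioi).2 (Eventually.of_forall fun v hv ↦ ?_)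
    have huv : u < v := hv
    have hv0 : 0 < v := hu0.trans huv
    have h1 : u * rexp (u / 2) * recipKernel v - rexp (u / 2) * (thetaErr v * rexp (-(v / 2))) =
        thetaErr v * (rexp ((u - v) / 2) * ((u - v * (v - u)) / v ^ 2)) := by
      have : rexp ((u - v) / 2) = rexp (u / 2) * rexp (-(v / 2)) := by
        rw [← Real.exp_add]
        ring_nf
      rw [this, recipKernel]
      field_simp
      ring
    have h2 : |(u - v * (v - u)) / v ^ 2| ≤ 4 / u * rexp ((v - u) / 4) := by
      have h3 : 1 + (v - u) ≤ 4 * rexp ((v - u) / 4) := by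
        have := Real.add_one_le_exp ((v - u) / 4)
        linarith
      have h4 : |u - v * (v - u)| ≤ u + v * (v - u) := by
        have : 0 ≤ v * (v - u) := mul_nonneg hv0.le (by linarith)
        exact abs_le.2 ⟨by linarith, by linarith⟩
      rw [abs_div, abs_of_pos (by positivity : 0 < v ^ 2), div_le_iff₀ (by positivity)]
      calc _ ≤ u + v * (v - u) := h4
        _ ≤ 1 / u * (1 + (v - u)) * v ^ 2 := by
          rw [mul_assoc, div_mul_eq_mul_div, le_div_iff₀ hu0]
          have h5 : u * u ≤ v * v := by nlinarith
          have h6 : v * (v - u) * u ≤ (v - u) * (v * v) := by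
            have : 0 ≤ (v - u) * (v * (v - u)) := by
              have : 0 ≤ v - u := by linarith
              positivity
            nlinarith
          nlinarith
        _ ≤ 1 / u * (4 * rexp ((v - u) / 4)) * v ^ 2 := by gcongr
        _ = _ := by ring
    have h5 : rexp ((u - v) / 2) * rexp ((v - u) / 4) = rexp (-(|u - v| / 4)) := by
      rw [abs_of_nonpos (by linarith), ← Real.exp_add]
      ring_nf
    rw [h1, Real.norm_eq_abs, abs_mul, abs_mul, abs_of_pos (Real.exp_pos _), ← h5]
    calc _ ≤ |thetaErr v| * (rexp ((u - v) / 2) * (4 / u * rexp ((v - u) / 4))) := by gcongr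
      _ = _ := by ring
  · rw [integral_const_mul]
    have : ∫ v in Ioi u, |thetaErr v| * rexp (-(|u - v| / 4)) ≤ C * √u :=
      (setIntegral_mono_set hi (Eventually.of_forall fun _ ↦ by positivity)
        hsub.eventuallyLE).trans hb
    calc _ ≤ 4 / u * (C * √u) := by gcongr
      _ = _ := by ring

theorem exists_tendsto_mertensErr (hRH : RiemannHypothesis) : ∃ L : ℝ,
    Tendsto (fun u ↦ log (mertensProd (rexp u)) - log u) atTop (nhds L) ∧
    Tendsto (fun u ↦ mertensErr L u - (thetaErr u -
      rexp (u / 2) * ∫ v in Ioi u, thetaErr v * rexp (-(v / 2)))) atTop (nhds 0) := by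
  obtain ⟨c, hc⟩ := exists_sum_logRem_sub_le
  set I := ∫ v in Ioi (log 2), recipKernel v with hI
  have hl2 : log 2 < 1 := by linarith [Real.log_two_lt_d9]
  set R : ℝ → ℝ := fun u ↦
    (∑ p ∈ Finset.filter Nat.Prime (Finset.Iic ⌊rexp u⌋₊), logRem p) - c with hR
  have hRle : ∀ u, 1 ≤ u → |R u| ≤ 4 * rexp (-u) := fun u hu ↦ by
    have h2 := Real.add_one_le_exp u
    have := hc (rexp u) (by linarith)
    rwa [div_eq_mul_inv, ← Real.exp_neg] at this
  have hmain : ∀ u, 1 ≤ u → log (mertensProd (rexp u)) - log u =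
      (1 / log 2 - log (log 2) + I + c) + thetaErr u * rexp (-(u / 2)) / u -
        (∫ v in Ioi u, recipKernel v) + R u := fun u hu ↦ by
    have h1 : I = (∫ v in Ioc (log 2) u, recipKernel v) + ∫ v in Ioi u, recipKernel v := by
      have hInt := integrableOn_recipKernel hRH
      have hlu : log 2 ≤ u := by linarith
      rw [hI, ← Ioc_union_Ioi_eq_Ioi hlu, setIntegral_union (Ioc_disjoint_Ioi le_rfl)
        measurableSet_Ioi (hInt.mono_set Ioc_subset_Ioi_self) (hInt.mono_set (Ioi_subset_Ioi hlu))]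
    rw [log_mertensProd, primeRecipSum_exp_eq (by linarith), h1, hR]
    ring
  refine ⟨1 / log 2 - log (log 2) + I + c, ?_, ?_⟩
  · have h1 : Tendsto (fun u ↦ thetaErr u * rexp (-(u / 2)) / u) atTop (nhds 0) :=
      (tendsto_thetaErr_mul_exp hRH).div_atTop tendsto_id
    have h2 : Tendsto (fun u ↦ ∫ v in Ioi u, recipKernel v) atTop (nhds 0) := by
      have := (intervalIntegral_tendsto_integral_Ioi _ (integrableOn_recipKernel hRH) tendsto_id).const_sub I
      rw [← hI, sub_self] at this
      refine this.congr' ?_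
      filter_upwards [eventually_ge_atTop 1] with u hu
      have hInt := integrableOn_recipKernel hRH
      have hlu : log 2 ≤ u := by linarith
      rw [id, intervalIntegral.integral_of_le hlu, hI, ← Ioc_union_Ioi_eq_Ioi hlu,
        setIntegral_union (Ioc_disjoint_Ioi le_rfl)
        measurableSet_Ioi (hInt.mono_set Ioc_subset_Ioi_self) (hInt.mono_set (Ioi_subset_Ioi hlu))]
      ring
    have h3 : Tendsto R atTop (nhds 0) := by
      refine squeeze_zero_norm' (a := fun u ↦ 4 * rexp (-u)) ?_ ?_
      · filter_upwards [eventually_ge_atTop 1] with u hu using hRle u hu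
      · simpa using Real.tendsto_exp_neg_atTop_nhds_zero.const_mul 4
    have h4 := ((h1.const_add (1 / log 2 - log (log 2) + I + c)).sub h2).add h3
    simp only [add_zero, sub_zero] at h4
    refine h4.congr' ?_
    filter_upwards [eventually_ge_atTop 1] with u hu using (hmain u hu).symm
  · have h1 := (tendsto_integral_recipKernel_sub hRH).neg
    have h2 : Tendsto (fun u ↦ R u * (u * rexp (u / 2))) atTop (nhds 0) := by
      refine squeeze_zero_norm' (a := fun u ↦ 4 * (u * rexp (-(u / 2)))) ?_ ?_
      · filter_upwards [eventually_ge_atTop 1] with u hu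
        rw [norm_mul, Real.norm_eq_abs, Real.norm_eq_abs, abs_of_nonneg (by positivity : 0 ≤ u * rexp (u / 2))]
        calc _ ≤ 4 * rexp (-u) * (u * rexp (u / 2)) := by
              gcongr
              exact hRle u hu
          _ = 4 * (u * (rexp (-u) * rexp (u / 2))) := by ring
          _ = _ := by rw [← Real.exp_add]; ring_nf
      · simpa using tendsto_mul_exp_neg_div_two.const_mul 4
    have h3 := h1.add h2
    simp only [neg_zero, add_zero] at h3
    refine h3.congr' ?_
    filter_upwards [eventually_ge_atTop 1] with u hu
    have h4 : rexp (-(u / 2)) * rexp (u / 2) = 1 := by rw [← Real.exp_add]; simp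
    rw [mertensErr, hmain u hu]
    have h5 : thetaErr u = thetaErr u * rexp (-(u / 2)) / u * (u * rexp (u / 2)) := by
      field_simp
      rw [mul_assoc, h4, mul_one]
    linear_combination h5

theorem integrableOn_mul_exp_neg {s : ℝ} (hs : 0 < s) (c : ℝ) :
    IntegrableOn (fun u ↦ s * rexp (-(s * u))) (Ioi c) := by
  have := (integrableOn_exp_mul_Ioi (a := -s) (by linarith) c).const_mul s
  simp only [neg_mul] at this
  exact this

theorem integral_mul_exp_neg {s : ℝ} (hs : 0 < s) (c : ℝ) :
    ∫ u in Ioi c, s * rexp (-(s * u)) = rexp (-(s * c)) := by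
  have := integral_exp_mul_Ioi (a := -s) (by linarith) c
  simp only [neg_mul] at this
  rw [integral_const_mul, this]
  field_simp

/-- Tonelli: the Laplace transform of the summatory function of a general Dirichlet series. -/
theorem integral_summatory_mul_exp_neg {ι : Type*} [Countable ι] {b l : ι → ℝ} {B : ℝ → ℝ}
    (hb : ∀ i, 0 ≤ b i) (hl : ∀ i, 0 < l i) (hBm : Measurable B)
    (hB : ∀ u, HasSum (fun i ↦ if l i ≤ u then b i else 0) (B u)) {s : ℝ} (hs : 0 < s)
    (hsum : Summable fun i ↦ b i * rexp (-(s * l i))) :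
    IntegrableOn (fun u ↦ B u * (s * rexp (-(s * u)))) (Ioi 0) ∧
      ∫ u in Ioi 0, B u * (s * rexp (-(s * u))) = ∑' i, b i * rexp (-(s * l i)) := by
  have hB0 : ∀ u, 0 ≤ B u := fun u ↦ (hB u).nonneg fun i ↦ by split_ifs <;> simp [hb i]
  have key : ∫⁻ u in Ioi 0, ENNReal.ofReal (B u * (s * rexp (-(s * u)))) =
      ENNReal.ofReal (∑' i, b i * rexp (-(s * l i))) := by
    have h1 : ∀ u, ENNReal.ofReal (B u * (s * rexp (-(s * u)))) =
        ∑' i, (Ici (l i)).indicator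
          (fun u ↦ ENNReal.ofReal (b i) * ENNReal.ofReal (s * rexp (-(s * u)))) u := fun u ↦ by
      rw [ENNReal.ofReal_mul (hB0 u), ← (hB u).tsum_eq, ENNReal.ofReal_tsum_of_nonneg
        (fun i ↦ by split_ifs <;> simp [hb i]) (hB u).summable, ← ENNReal.tsum_mul_right]
      refine tsum_congr fun i ↦ ?_
      by_cases h : l i ≤ u <;> simp [h]
    simp only [h1]
    rw [lintegral_tsum fun i ↦ (Measurable.indicator (by fun_prop) measurableSet_Ici).aemeasurable,
      ENNReal.ofReal_tsum_of_nonneg (fun i ↦ mul_nonneg (hb i) (Real.exp_pos _).le) hsum]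
    refine tsum_congr fun i ↦ ?_
    have hsub : Ici (l i) ⊆ Ioi 0 := fun v hv ↦ (hl i).trans_le hv
    rw [lintegral_indicator measurableSet_Ici, Measure.restrict_restrict measurableSet_Ici,
      inter_eq_left.2 hsub, lintegral_const_mul _ (by fun_prop), setLIntegral_congr Ioi_ae_eq_Ici.symm,
      ← ofReal_integral_eq_lintegral_ofReal (integrableOn_mul_exp_neg hs _)
        (Eventually.of_forall fun u ↦ by positivity), integral_mul_exp_neg hs,
      ENNReal.ofReal_mul (hb i)]
  have h0 : ∀ u, 0 ≤ B u * (s * rexp (-(s * u))) := fun u ↦ mul_nonneg (hB0 u) (by positivity)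
  refine ⟨⟨by fun_prop, ?_⟩, ?_⟩
  · rw [hasFiniteIntegral_iff_ofReal (Eventually.of_forall h0), key]
    exact ENNReal.ofReal_lt_top
  · rw [integral_eq_lintegral_of_nonneg_ae (Eventually.of_forall h0) (by fun_prop), key,
      ENNReal.toReal_ofReal (tsum_nonneg fun i ↦ mul_nonneg (hb i) (Real.exp_pos _).le)]

/-- An Abelian theorem for the Laplace transform. -/
theorem tendsto_integral_mul_exp_neg {g : ℝ → ℝ} {c : ℝ}
    (hi : ∀ s, 0 < s → IntegrableOn (fun u ↦ g u * (s * rexp (-(s * u)))) (Ioi 0))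
    (hg : Tendsto g atTop (nhds c)) :
    Tendsto (fun s ↦ ∫ u in Ioi 0, g u * (s * rexp (-(s * u)))) (nhdsWithin 0 (Ioi 0)) (nhds c) := by
  have hi' : ∀ s, 0 < s → IntegrableOn (fun u ↦ (g u - c) * (s * rexp (-(s * u)))) (Ioi 0) :=
    fun s hs ↦ ((hi s hs).sub ((integrableOn_mul_exp_neg hs 0).const_mul c)).congr_fun
      (fun u _ ↦ by simp only [Pi.sub_apply]; ring) measurableSet_Ioi
  have hK := (hi' 1 one_pos).norm
  set K := ∫ u in Ioi 0, ‖(g u - c) * (1 * rexp (-(1 * u)))‖ with hKdef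
  have hK0 : 0 ≤ K := integral_nonneg fun _ ↦ norm_nonneg _
  rw [Metric.tendsto_nhds]
  intro ε hε
  obtain ⟨U, hU⟩ := eventually_atTop.1 (Metric.tendsto_nhds.1 hg (ε / 2) (by positivity))
  have hsmall : ∀ᶠ s in nhdsWithin (0 : ℝ) (Ioi 0), s * (rexp U * K) < ε / 2 := by
    have : Tendsto (fun s : ℝ ↦ s * (rexp U * K)) (nhdsWithin 0 (Ioi 0)) (nhds (0 * (rexp U * K))) :=
      (tendsto_id.mono_left nhdsWithin_le_nhds).mul_const _
    rw [zero_mul] at this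
    exact this.eventually_lt_const (by positivity)
  filter_upwards [hsmall, self_mem_nhdsWithin] with s hs hs0
  have hs0 : 0 < s := hs0
  have h1 : (∫ u in Ioi 0, g u * (s * rexp (-(s * u)))) - c =
      ∫ u in Ioi 0, (g u - c) * (s * rexp (-(s * u))) := by
    have h2 := integral_mul_exp_neg hs0 0
    rw [mul_zero, neg_zero, Real.exp_zero] at h2
    simp only [sub_mul]
    rw [integral_sub (hi s hs0) ((integrableOn_mul_exp_neg hs0 0).const_mul c), integral_const_mul,
      h2, mul_one]
  rw [dist_eq_norm, h1]
  have hb := ((integrableOn_mul_exp_neg hs0 0).const_mul (ε / 2)).add (hK.const_mul (s * rexp U))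
  refine (norm_integral_le_of_norm_le hb ?_).trans_lt ?_
  · refine (ae_restrict_iff' measurableSet_Ioi).2 (Eventually.of_forall fun u hu ↦ ?_)
    have hu0 : (0 : ℝ) < u := hu
    simp only [Pi.add_apply, norm_mul, Real.norm_eq_abs, one_mul, abs_of_pos hs0,
      abs_of_pos (Real.exp_pos _)]
    rcases le_total U u with h | h
    · have h3 := hU u h
      rw [Real.dist_eq] at h3
      calc _ ≤ ε / 2 * (s * rexp (-(s * u))) := by gcongr
        _ ≤ _ := le_add_of_nonneg_right (by positivity)
    · calc |g u - c| * (s * rexp (-(s * u))) ≤ |g u - c| * (s * (rexp U * rexp (-u))) := by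
            gcongr
            rw [← Real.exp_add, Real.exp_le_exp]
            have : 0 ≤ s * u := by positivity
            linarith
        _ = s * rexp U * (|g u - c| * rexp (-u)) := by ring
        _ ≤ _ := le_add_of_nonneg_left (by positivity)
  · have h2 := integral_mul_exp_neg hs0 0
    rw [mul_zero, neg_zero, Real.exp_zero] at h2
    simp only [Pi.add_apply]
    rw [integral_add ((integrableOn_mul_exp_neg hs0 0).const_mul (ε / 2)) (hK.const_mul _),
      integral_const_mul (ε / 2), h2, integral_const_mul (s * rexp U), ← hKdef]
    linarith

theorem harmonic_floor_hasSum (u : ℝ) : HasSum (fun n : ℕ ↦ if (n : ℝ) + 1 ≤ u then 1 / ((n : ℝ) + 1) else 0)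
    (harmonic ⌊u⌋₊ : ℝ) := by
  have h : (harmonic ⌊u⌋₊ : ℝ) = ∑ n ∈ Finset.range ⌊u⌋₊,
      if (n : ℝ) + 1 ≤ u then 1 / ((n : ℝ) + 1) else 0 := by
    rw [harmonic]
    push_cast
    refine Finset.sum_congr rfl fun n hn ↦ ?_
    have h1 : n + 1 ≤ ⌊u⌋₊ := Finset.mem_range.1 hn
    have h2 : (n : ℝ) + 1 ≤ u := by exact_mod_cast (Nat.le_floor_iff' (Nat.succ_ne_zero n)).1 h1
    simp [h2]
  rw [h]
  refine hasSum_sum_of_ne_finset_zero fun n hn ↦ if_neg fun h2 ↦ hn ?_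
  refine Finset.mem_range.2 (Nat.le_floor (n := n + 1) ?_)
  exact_mod_cast h2

theorem log_mertensProd_hasSum (u : ℝ) :
    HasSum (fun p : Nat.Primes ↦ if log (p : ℕ) ≤ u then -log (1 - 1 / (p : ℕ)) else 0)
      (log (mertensProd (rexp u))) := by
  have hiff : ∀ n : ℕ, n.Prime → (log n ≤ u ↔ n ≤ ⌊rexp u⌋₊) := fun n hn ↦ by
    rw [Nat.le_floor_iff (Real.exp_pos u).le,
      Real.log_le_iff_le_exp (by exact_mod_cast hn.pos)]
  have h : log (mertensProd (rexp u)) = ∑ n ∈ Finset.Iic ⌊rexp u⌋₊,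
      ({n : ℕ | n.Prime}.indicator fun n ↦ if log n ≤ u then -log (1 - 1 / n) else 0) n := by
    rw [log_mertensProd, primeRecipSum, ← Finset.sum_add_distrib, Finset.sum_filter]
    refine Finset.sum_congr rfl fun n hn ↦ ?_
    by_cases hp : n.Prime
    · simp only [hp, indicator, mem_ofPred_eq, if_true, (hiff n hp).2 (Finset.mem_Iic.1 hn), logRem]
      ring
    · simp [hp, indicator]
  have := (hasSum_subtype_iff_indicator (s := {n : ℕ | n.Prime})
    (f := fun n : ℕ ↦ if log n ≤ u then -log (1 - 1 / n) else 0)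
    (a := log (mertensProd (rexp u)))).2 ?_
  · exact this
  · rw [h]
    refine hasSum_sum_of_ne_finset_zero fun n hn ↦ ?_
    by_cases hp : n.Prime
    · simp only [hp, indicator, mem_ofPred_eq, if_true]
      exact if_neg fun h ↦ hn (Finset.mem_Iic.2 ((hiff n hp).1 h))
    · simp [hp, indicator]

theorem tendsto_harmonic_floor_sub_log :
    Tendsto (fun u : ℝ ↦ (harmonic ⌊u⌋₊ : ℝ) - log u) atTop (nhds eulerMascheroniConstant) := by
  have h1 := tendsto_harmonic_sub_log.comp (tendsto_nat_floor_atTop (α := ℝ))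
  have h2 := (tendsto_nat_floor_div_atTop (R := ℝ)).log one_ne_zero
  rw [Real.log_one] at h2
  have h3 := h1.add h2
  rw [add_zero] at h3
  refine h3.congr' ?_
  filter_upwards [eventually_ge_atTop 1] with u hu
  have : (1 : ℝ) ≤ ⌊u⌋₊ := by exact_mod_cast Nat.le_floor (by simpa using hu)
  rw [Real.log_div (by linarith) (by linarith)]
  simp

/-- `log ζ(1 + s)` as a sum over primes. -/
theorem log_riemannZeta_one_add {s : ℝ} (hs : 0 < s) : log (riemannZeta ((1 + s : ℝ) : ℂ)).re =
    ∑' p : Nat.Primes, -log (1 - 1 / (p : ℕ) * rexp (-(s * log (p : ℕ)))) := by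
  have h := riemannZeta_eulerProduct_exp_log (s := ((1 + s : ℝ) : ℂ)) (by simpa using hs)
  have h1 : (∑' p : Nat.Primes, -Complex.log (1 - (p : ℂ) ^ (-((1 + s : ℝ) : ℂ)))) =
      ((∑' p : Nat.Primes, -log (1 - 1 / (p : ℕ) * rexp (-(s * log (p : ℕ)))) : ℝ) : ℂ) := by
    rw [Complex.ofReal_tsum]
    refine tsum_congr fun p ↦ ?_
    have hp : (1 : ℝ) < (p : ℕ) := by exact_mod_cast p.2.one_lt
    have h2 : (1 : ℝ) / (p : ℕ) * rexp (-(s * log (p : ℕ))) = ((p : ℕ) : ℝ) ^ (-(1 + s)) := by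
      rw [Real.rpow_def_of_pos (by linarith), neg_add, mul_add, Real.exp_add, mul_neg_one,
        Real.exp_neg (log _), Real.exp_log (by linarith), one_div, mul_neg, mul_comm s]
    have h3 : ((p : ℕ) : ℝ) ^ (-(1 + s)) < 1 := Real.rpow_lt_one_of_one_lt_of_neg hp (by linarith)
    rw [h2, Complex.ofReal_neg, Complex.ofReal_log (by linarith), Complex.ofReal_sub,
      Complex.ofReal_cpow (by linarith)]
    push_cast
    rfl
  rw [← h, h1, ← Complex.ofReal_exp, Complex.ofReal_re, Real.log_exp]

theorem tendsto_neg_log_one_sub_exp_add_log :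
    Tendsto (fun s : ℝ ↦ -log (1 - rexp (-s)) + log s) (nhdsWithin 0 (Ioi 0)) (nhds 0) := by
  have h1 : HasDerivAt (fun s : ℝ ↦ 1 - rexp (-s)) 1 0 := by
    have := ((hasDerivAt_neg (0 : ℝ)).exp).const_sub 1
    simpa using this
  have h2 := (hasDerivAt_iff_tendsto_slope.1 h1).mono_left
    (nhdsWithin_mono 0 fun (x : ℝ) (hx : 0 < x) ↦ hx.ne')
  have h3 := (h2.log one_ne_zero).neg
  rw [Real.log_one, neg_zero] at h3
  refine h3.congr' ?_
  filter_upwards [self_mem_nhdsWithin] with s hs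
  have hs0 : 0 < s := hs
  have h4 : rexp (-s) < 1 := Real.exp_lt_one_iff.2 (by linarith)
  simp only [slope_def_field, neg_zero, Real.exp_zero, sub_self, sub_zero]
  rw [Real.log_div (by linarith) hs0.ne']
  ring

theorem tendsto_log_riemannZeta_add_log :
    Tendsto (fun s : ℝ ↦ log (riemannZeta ((1 + s : ℝ) : ℂ)).re + log s)
      (nhdsWithin 0 (Ioi 0)) (nhds 0) := by
  have h1 := (Asymptotics.isLittleO_one_iff ℝ).1 log_riemannZeta_add_log_sub_isLittleO_ofReal
  have h2 : Tendsto (fun s : ℝ ↦ 1 + s) (nhdsWithin 0 (Ioi 0)) (nhdsWithin 1 (Ioi 1)) := by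
    refine tendsto_nhdsWithin_iff.2 ⟨?_, ?_⟩
    · have : Tendsto (fun s : ℝ ↦ 1 + s) (nhds 0) (nhds (1 + 0)) := tendsto_id.const_add 1
      rw [add_zero] at this
      exact this.mono_left nhdsWithin_le_nhds
    · filter_upwards [self_mem_nhdsWithin] with s hs
      have hs0 : 0 < s := hs
      simpa using hs0
  refine (h1.comp h2).congr fun s ↦ ?_
  simp

theorem neg_log_one_sub_bounds {y : ℝ} (hy0 : 0 ≤ y) (hy : y ≤ 1 / 2) :
    y ≤ -log (1 - y) ∧ -log (1 - y) ≤ y + 2 * y ^ 2 := by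
  constructor
  · have := Real.log_le_sub_one_of_pos (x := 1 - y) (by linarith)
    linarith
  · have h4 := Real.abs_log_sub_add_sum_range_le (x := y) (by rw [abs_of_nonneg hy0]; linarith) 1
    simp only [Finset.sum_range_one] at h4
    have h5 := (abs_le.1 h4).1
    rw [abs_of_nonneg hy0] at h5
    norm_num at h5
    have h6 : y ^ 2 / (1 - y) ≤ 2 * y ^ 2 := by
      rw [div_le_iff₀ (by linarith)]
      nlinarith [sq_nonneg y]
    linarith

theorem summable_primes_sq : Summable fun p : Nat.Primes ↦ 2 * (1 / ((p : ℕ) : ℝ)) ^ 2 := by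
  have := (Nat.Primes.summable_rpow (r := -2)).2 (by norm_num)
  refine (this.mul_left 2).congr fun p ↦ ?_
  rw [Real.rpow_neg (by positivity)]
  simp

theorem abs_neg_log_mul_sub_le {y e : ℝ} (hy0 : 0 ≤ y) (hy : y ≤ 1 / 2) (he0 : 0 ≤ e) (he : e ≤ 1) :
    |-log (1 - y) * e - -log (1 - y * e)| ≤ 2 * y ^ 2 := by
  have hz : y * e ≤ y := mul_le_of_le_one_right hy0 he
  have hz0 : 0 ≤ y * e := mul_nonneg hy0 he0
  obtain ⟨h1, h2⟩ := neg_log_one_sub_bounds hy0 hy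
  obtain ⟨h3, h4⟩ := neg_log_one_sub_bounds hz0 (hz.trans hy)
  have h5 : y * e ≤ -log (1 - y) * e := by gcongr
  have h6 : -log (1 - y) * e ≤ (y + 2 * y ^ 2) * e := by gcongr
  have h7 : 2 * y ^ 2 * e ≤ 2 * y ^ 2 := mul_le_of_le_one_right (by positivity) he
  have h8 : 2 * (y * e) ^ 2 ≤ 2 * y ^ 2 := by gcongr
  rw [abs_le]
  constructor <;> nlinarith

theorem one_div_prime_le (p : Nat.Primes) : (1 : ℝ) / (p : ℕ) ≤ 1 / 2 := by
  have : (2 : ℝ) ≤ (p : ℕ) := by exact_mod_cast p.2.two_le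
  gcongr

theorem exp_neg_mul_log_prime_le {s : ℝ} (hs : 0 < s) (p : Nat.Primes) :
    rexp (-(s * log (p : ℕ))) ≤ 1 := by
  have : 0 < log (p : ℕ) := Real.log_pos (by exact_mod_cast p.2.one_lt)
  refine Real.exp_le_one_iff.2 ?_
  have := mul_pos hs this
  linarith

theorem tendsto_tsum_primes_sub :
    Tendsto (fun s : ℝ ↦ ∑' p : Nat.Primes, (-log (1 - 1 / (p : ℕ)) * rexp (-(s * log (p : ℕ))) -
      -log (1 - 1 / (p : ℕ) * rexp (-(s * log (p : ℕ)))))) (nhdsWithin 0 (Ioi 0)) (nhds 0) := by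
  have h := tendsto_tsum_of_dominated_convergence (𝓕 := nhdsWithin (0 : ℝ) (Ioi 0))
    (f := fun (s : ℝ) (p : Nat.Primes) ↦ (-log (1 - 1 / (p : ℕ)) * rexp (-(s * log (p : ℕ))) -
      -log (1 - 1 / (p : ℕ) * rexp (-(s * log (p : ℕ)))))) (g := fun _ ↦ 0) summable_primes_sq
    (fun p ↦ ?_) ?_
  · simpa using h
  · have h1 : Tendsto (fun s : ℝ ↦ rexp (-(s * log (p : ℕ)))) (nhdsWithin 0 (Ioi 0)) (nhds 1) := by
      have : Continuous fun s : ℝ ↦ rexp (-(s * log (p : ℕ))) := by fun_prop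
      have := this.tendsto 0
      simp only [zero_mul, neg_zero, Real.exp_zero] at this
      exact this.mono_left nhdsWithin_le_nhds
    have h2 := one_div_prime_le p
    have h3 := ((h1.const_mul (1 / ((p : ℕ) : ℝ))).const_sub 1).log (by linarith)
    have h4 := (h1.const_mul (-log (1 - 1 / ((p : ℕ) : ℝ)))).sub h3.neg
    simpa using h4
  · filter_upwards [self_mem_nhdsWithin] with s hs p
    exact abs_neg_log_mul_sub_le (by positivity) (one_div_prime_le p) (Real.exp_pos _).le
      (exp_neg_mul_log_prime_le hs p)

theorem measurable_log_mertensProd_exp : Measurable fun u ↦ log (mertensProd (rexp u)) := by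
  refine Monotone.measurable fun u v huv ↦ ?_
  refine hasSum_le (fun p ↦ ?_) (log_mertensProd_hasSum u) (log_mertensProd_hasSum v)
  by_cases h : log (p : ℕ) ≤ u
  · rw [if_pos h, if_pos (h.trans huv)]
  · rw [if_neg h]
    split_ifs
    · exact le_trans (by positivity)
        (neg_log_one_sub_bounds (by positivity) (one_div_prime_le p)).1
    · exact le_rfl

/-- The constant in Mertens' product theorem is `e^γ`. -/
theorem eq_eulerMascheroniConstant_of_tendsto {L : ℝ}
    (hL : Tendsto (fun u ↦ log (mertensProd (rexp u)) - log u) atTop (nhds L)) :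
    L = eulerMascheroniConstant := by
  have hs1 : ∀ s : ℝ, 0 < s → Summable fun p : Nat.Primes ↦
      1 / ((p : ℕ) : ℝ) * rexp (-(s * log (p : ℕ))) := fun s hs ↦ by
    refine ((Nat.Primes.summable_rpow (r := -(1 + s))).2 (by linarith)).congr fun p ↦ ?_
    have hp : (1 : ℝ) < (p : ℕ) := by exact_mod_cast p.2.one_lt
    rw [Real.rpow_def_of_pos (by linarith), neg_add, mul_add, Real.exp_add, mul_neg_one,
        Real.exp_neg (log _), Real.exp_log (by linarith), one_div, mul_neg, mul_comm s]
  have hb0 : ∀ p : Nat.Primes, 0 ≤ -log (1 - 1 / ((p : ℕ) : ℝ)) := fun p ↦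
    le_trans (by positivity) (neg_log_one_sub_bounds (by positivity) (one_div_prime_le p)).1
  have hs2 : ∀ s : ℝ, 0 < s → Summable fun p : Nat.Primes ↦
      -log (1 - 1 / ((p : ℕ) : ℝ)) * rexp (-(s * log (p : ℕ))) := fun s hs ↦ by
    refine Summable.of_nonneg_of_le (fun p ↦ mul_nonneg (hb0 p) (Real.exp_pos _).le) (fun p ↦ ?_)
      ((hs1 s hs).mul_left 2)
    have h1 := (neg_log_one_sub_bounds (by positivity) (one_div_prime_le p)).2
    have h2 : 2 * (1 / ((p : ℕ) : ℝ)) ^ 2 ≤ 1 / ((p : ℕ) : ℝ) := by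
      have := one_div_prime_le p
      have h0 : (0 : ℝ) ≤ 1 / (p : ℕ) := by positivity
      nlinarith
    rw [← mul_assoc]
    gcongr
    linarith
  have hs3 : ∀ s : ℝ, 0 < s → Summable fun p : Nat.Primes ↦
      -log (1 - 1 / ((p : ℕ) : ℝ) * rexp (-(s * log (p : ℕ)))) := fun s hs ↦ by
    refine ((hs2 s hs).sub (Summable.of_norm_bounded (g := fun p : Nat.Primes ↦
      2 * (1 / ((p : ℕ) : ℝ)) ^ 2) summable_primes_sq
      fun p ↦ abs_neg_log_mul_sub_le (by positivity) (one_div_prime_le p)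
        (Real.exp_pos (-(s * log (p : ℕ)))).le (exp_neg_mul_log_prime_le hs p))).congr fun p ↦ ?_
    simp
  have hl : ∀ p : Nat.Primes, 0 < log (p : ℕ) := fun p ↦
    Real.log_pos (by exact_mod_cast p.2.one_lt)
  have hmA := measurable_log_mertensProd_exp
  have hmH : Measurable fun u : ℝ ↦ (harmonic ⌊u⌋₊ : ℝ) := by
    refine (measurable_from_top (f := fun n : ℕ ↦ (harmonic n : ℝ))).comp Nat.measurable_floor
  have hA := fun s (hs : (0 : ℝ) < s) ↦ integral_summatory_mul_exp_neg hb0 hl hmA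
    log_mertensProd_hasSum hs (hs2 s hs)
  have hpow : ∀ s : ℝ, 0 < s → HasSum (fun n : ℕ ↦ 1 / ((n : ℝ) + 1) * rexp (-(s * (n + 1))))
      (-log (1 - rexp (-s))) := fun s hs ↦ by
    have := Real.hasSum_pow_div_log_of_abs_lt_one (x := rexp (-s)) (by
      rw [abs_of_pos (Real.exp_pos _)]
      exact Real.exp_lt_one_iff.2 (by linarith))
    convert this using 2 with n
    rw [← Real.exp_nat_mul]
    push_cast
    ring_nf
  have hH := fun s (hs : (0 : ℝ) < s) ↦ integral_summatory_mul_exp_neg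
    (b := fun n : ℕ ↦ 1 / ((n : ℝ) + 1)) (l := fun n : ℕ ↦ (n : ℝ) + 1) (fun n ↦ by positivity)
    (fun n ↦ by positivity) hmH harmonic_floor_hasSum hs (hpow s hs).summable
  have hlim := tendsto_integral_mul_exp_neg
    (g := fun u ↦ log (mertensProd (rexp u)) - harmonic ⌊u⌋₊) (c := L - eulerMascheroniConstant)
    (fun s hs ↦ ((hA s hs).1.sub (hH s hs).1).congr_fun
      (fun u _ ↦ by simp only [Pi.sub_apply]; ring) measurableSet_Ioi)
    ((hL.sub tendsto_harmonic_floor_sub_log).congr fun u ↦ by ring)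
  have hzero := (tendsto_tsum_primes_sub.add tendsto_log_riemannZeta_add_log).sub
    tendsto_neg_log_one_sub_exp_add_log
  simp only [add_zero, sub_zero] at hzero
  have heq := tendsto_nhds_unique hlim (hzero.congr' ?_)
  · linarith
  · filter_upwards [self_mem_nhdsWithin] with s hs
    have hs0 : (0 : ℝ) < s := hs
    simp only [sub_mul]
    rw [integral_sub (hA s hs0).1 (hH s hs0).1, (hA s hs0).2, (hH s hs0).2, (hpow s hs0).tsum_eq,
      log_riemannZeta_one_add hs0, (hs2 s hs0).tsum_sub (hs3 s hs0)]
    ring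

/-- The amplitude of the pair of ordinates `γ`, `-γ` in the explicit formula. -/
noncomputable def zetaAmp (γ : ℝ) : ℂ := zetaCoeff γ + starRingEnd ℂ (zetaCoeff (-γ))

theorem sum_zetaCoeff_re (hRH : RiemannHypothesis) {k : ℝ → ℂ}
    (hk : ∀ γ, k (-γ) = starRingEnd ℂ (k γ)) (T₀ : Finset ℝ)
    (S : Finset {s : ℂ // IsNontrivialZetaZero s ∧ 0 < s.im})
    (hS : ∀ i : {s : ℂ // IsNontrivialZetaZero s ∧ 0 < s.im},
      (i : ℂ).im ∈ T₀ ∨ -(i : ℂ).im ∈ T₀ → i ∈ S) :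
    ∃ T, T₀ ⊆ T ∧ ∀ u : ℝ,
      (∑ γ ∈ T, k γ * zetaCoeff γ * Complex.exp (γ * Complex.I * u)).re =
      trigPoly (fun i : {s : ℂ // IsNontrivialZetaZero s ∧ 0 < s.im} ↦ (i : ℂ).im)
        (fun i ↦ k (i : ℂ).im * zetaAmp (i : ℂ).im) S u := by
  classical
  set l := fun i : {s : ℂ // IsNontrivialZetaZero s ∧ 0 < s.im} ↦ (i : ℂ).im with hl
  have hinj : Function.Injective l := fun i j hij ↦ by
    have h : ∀ i : {s : ℂ // IsNontrivialZetaZero s ∧ 0 < s.im}, (i : ℂ) = criticalPoint (l i) := by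
      intro i
      obtain ⟨⟨h0, h1, h2⟩, h3⟩ := i.2
      have hne : (i : ℂ) ≠ 1 := fun h ↦ by rw [h] at h3; simp at h3
      have := re_eq_half_of_riemannZeta₁_eq_zero hRH h1
        (by rw [riemannZeta₁_eq_mul hne, h0, mul_zero])
      apply Complex.ext <;> simp [this, hl]
    exact Subtype.ext (by rw [h i, h j, hij])
  refine ⟨T₀ ∪ (S.image l ∪ S.image fun i ↦ -l i), Finset.subset_union_left, fun u ↦ ?_⟩
  have hsub : ∑ γ ∈ S.image l ∪ S.image (fun i ↦ -l i),
      k γ * zetaCoeff γ * Complex.exp (γ * Complex.I * u) =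
      ∑ γ ∈ T₀ ∪ (S.image l ∪ S.image fun i ↦ -l i),
      k γ * zetaCoeff γ * Complex.exp (γ * Complex.I * u) := by
    refine Finset.sum_subset Finset.subset_union_right fun γ hγ hγ' ↦ ?_
    have hγ0 : γ ∈ T₀ := by
      rcases Finset.mem_union.1 hγ with h | h
      · exact h
      · exact absurd h hγ'
    have hno : γ ∉ zetaOrdinates := fun hz ↦ by
      have key : ∀ δ : ℝ, δ ∈ zetaOrdinates → 0 < δ → (δ ∈ T₀ ∨ -δ ∈ T₀) → ∃ i ∈ S, l i = δ := by
        intro δ hδ hδ0 hT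
        refine ⟨⟨criticalPoint δ, ⟨mem_zetaOrdinates_iff.1 hδ, by simp, by simp; norm_num⟩,
          by simpa using hδ0⟩, hS _ (by simpa using hT), by simp [hl]⟩
      rcases lt_trichotomy γ 0 with h | h | h
      · obtain ⟨i, hi, hi'⟩ := key (-γ) (neg_mem_zetaOrdinates hz) (by linarith)
          (Or.inr (by simpa using hγ0))
        exact hγ' (Finset.mem_union_right _ (Finset.mem_image.2 ⟨i, hi, by rw [hi', neg_neg]⟩))
      · exact zero_notMem_zetaOrdinates (h ▸ hz)
      · obtain ⟨i, hi, hi'⟩ := key γ hz h (Or.inl hγ0)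
        exact hγ' (Finset.mem_union_left _ (Finset.mem_image.2 ⟨i, hi, hi'⟩))
    simp [zetaCoeff, zetaOrd_eq_zero hno]
  rw [← hsub, Finset.sum_union, Finset.sum_image fun i _ j _ h ↦ hinj h,
    Finset.sum_image fun i _ j _ h ↦ hinj (neg_injective h), ← Finset.sum_add_distrib,
    Complex.re_sum, trigPoly]
  · refine Finset.sum_congr rfl fun i _ ↦ ?_
    have h1 : k (-l i) * zetaCoeff (-l i) * Complex.exp (((-l i : ℝ) : ℂ) * Complex.I * u) =
        starRingEnd ℂ (k (l i) * starRingEnd ℂ (zetaCoeff (-l i)) *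
          Complex.exp (l i * Complex.I * u)) := by
      rw [hk]
      simp [← Complex.exp_conj]
    rw [h1, Complex.add_re, Complex.conj_re, ← Complex.add_re, zetaAmp]
    congr 1
    rw [show (l i : ℂ) * u * Complex.I = l i * Complex.I * u by ring]
    ring
  · rw [Finset.disjoint_left]
    intro x hx hx'
    obtain ⟨i, _, rfl⟩ := Finset.mem_image.1 hx
    obtain ⟨j, _, hj⟩ := Finset.mem_image.1 hx'
    have hi := i.2.2
    have hj' := j.2.2
    simp only [hl] at hj
    linarith

/-- A uniform Laplace transform estimate for the tails gives a mean square expansion. -/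
theorem isMeanSquareLimit_of_lintegral_le (hRH : RiemannHypothesis) {k : ℝ → ℂ}
    (hk : ∀ γ, k (-γ) = starRingEnd ℂ (k γ)) {E : ℝ → ℝ} {C : ℝ} (hC : 0 < C)
    (hE : ∀ T : Finset ℝ, ∃ K : ENNReal, K ≠ ⊤ ∧ ∀ σ : ℝ, 0 < σ → σ < 1 / 8 →
      ∫⁻ u in Ioi (0 : ℝ), ENNReal.ofReal (‖(E u : ℂ) -
        ∑ γ ∈ T, k γ * zetaCoeff γ * Complex.exp (γ * Complex.I * u)‖ ^ 2 * rexp (-2 * σ * u)) ≤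
        K + ENNReal.ofReal (C / σ) * zetaTail T) :
    IsMeanSquareLimit E (fun i : {s : ℂ // IsNontrivialZetaZero s ∧ 0 < s.im} ↦ (i : ℂ).im)
      (fun i ↦ k (i : ℂ).im * zetaAmp (i : ℂ).im) := by
  classical
  intro ε hε
  have hη : 0 < ε / (2 * C * rexp 2) := by positivity
  obtain ⟨T₀, hT₀⟩ := exists_zetaTail_le hRH (ENNReal.ofReal_pos.2 hη)
  have hfin : {i : {s : ℂ // IsNontrivialZetaZero s ∧ 0 < s.im} |
      (i : ℂ).im ∈ T₀ ∨ -(i : ℂ).im ∈ T₀}.Finite := by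
    refine Set.Finite.subset (Set.Finite.preimage (f := Subtype.val) Subtype.val_injective.injOn
      ((T₀ ∪ T₀.image Neg.neg).image criticalPoint).finite_toSet) fun i hi ↦ ?_
    obtain ⟨⟨h0, h1, h2⟩, h3⟩ := i.2
    have hne : (i : ℂ) ≠ 1 := fun h ↦ by rw [h] at h3; simp at h3
    have := re_eq_half_of_riemannZeta₁_eq_zero hRH h1
      (by rw [riemannZeta₁_eq_mul hne, h0, mul_zero])
    rw [mem_preimage, Finset.mem_coe, Finset.mem_image]
    refine ⟨(i : ℂ).im, ?_, by apply Complex.ext <;> simp [this]⟩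
    rw [Finset.mem_union, Finset.mem_image]
    rcases hi with hi | hi
    · exact Or.inl hi
    · exact Or.inr ⟨_, hi, neg_neg _⟩
  refine ⟨hfin.toFinset, fun S hS ↦ ?_⟩
  obtain ⟨T, hT, hTe⟩ := sum_zetaCoeff_re hRH hk T₀ S fun i hi ↦ hS (by simpa using hi)
  obtain ⟨K, hK, hKE⟩ := hE T
  filter_upwards [eventually_gt_atTop 8, eventually_ge_atTop (2 * rexp 2 * K.toReal / ε)] with X hX hX2
  have hX0 : 0 < X := by linarith
  have hσ := hKE (1 / X) (by positivity) (by gcongr)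
  have hpt : ∀ u ∈ Ioc 0 X, ENNReal.ofReal ((E u - trigPoly
      (fun i : {s : ℂ // IsNontrivialZetaZero s ∧ 0 < s.im} ↦ (i : ℂ).im)
      (fun i ↦ k (i : ℂ).im * zetaAmp (i : ℂ).im) S u) ^ 2) ≤ ENNReal.ofReal (rexp 2) *
      ENNReal.ofReal (‖(E u : ℂ) -
        ∑ γ ∈ T, k γ * zetaCoeff γ * Complex.exp (γ * Complex.I * u)‖ ^ 2 *
          rexp (-2 * (1 / X) * u)) := by
    intro u hu
    rw [← ENNReal.ofReal_mul (Real.exp_pos _).le]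
    apply ENNReal.ofReal_le_ofReal
    rw [← hTe u]
    set z := (E u : ℂ) - ∑ γ ∈ T, k γ * zetaCoeff γ * Complex.exp (γ * Complex.I * u) with hz
    have h1 : E u - (∑ γ ∈ T, k γ * zetaCoeff γ * Complex.exp (γ * Complex.I * u)).re = z.re := by
      rw [hz, Complex.sub_re, Complex.ofReal_re]
    have h2 : z.re ^ 2 ≤ ‖z‖ ^ 2 := by
      rw [← sq_abs]; gcongr; exact Complex.abs_re_le_norm z
    have h3 : 1 ≤ rexp 2 * rexp (-2 * (1 / X) * u) := by
      rw [← Real.exp_add]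
      apply Real.one_le_exp
      have : u / X ≤ 1 := (div_le_one hX0).2 hu.2
      calc (0 : ℝ) ≤ 2 * (1 - u / X) := by linarith
        _ = _ := by ring
    rw [h1]
    calc z.re ^ 2 ≤ ‖z‖ ^ 2 * 1 := by rw [mul_one]; exact h2
      _ ≤ ‖z‖ ^ 2 * (rexp 2 * rexp (-2 * (1 / X) * u)) := by gcongr
      _ = _ := by ring
  calc _ ≤ ∫⁻ u in Ioc 0 X, ENNReal.ofReal (rexp 2) *
      ENNReal.ofReal (‖(E u : ℂ) -
        ∑ γ ∈ T, k γ * zetaCoeff γ * Complex.exp (γ * Complex.I * u)‖ ^ 2 *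
          rexp (-2 * (1 / X) * u)) := setLIntegral_mono' measurableSet_Ioc hpt
    _ ≤ ∫⁻ u in Ioi 0, ENNReal.ofReal (rexp 2) *
      ENNReal.ofReal (‖(E u : ℂ) -
        ∑ γ ∈ T, k γ * zetaCoeff γ * Complex.exp (γ * Complex.I * u)‖ ^ 2 *
          rexp (-2 * (1 / X) * u)) := lintegral_mono_set Ioc_subset_Ioi_self
    _ = ENNReal.ofReal (rexp 2) * ∫⁻ u in Ioi 0,
      ENNReal.ofReal (‖(E u : ℂ) -
        ∑ γ ∈ T, k γ * zetaCoeff γ * Complex.exp (γ * Complex.I * u)‖ ^ 2 *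
          rexp (-2 * (1 / X) * u)) := lintegral_const_mul' _ _ ENNReal.ofReal_ne_top
    _ ≤ ENNReal.ofReal (rexp 2) * (ENNReal.ofReal K.toReal + ENNReal.ofReal (C / (1 / X)) *
        ENNReal.ofReal (ε / (2 * C * rexp 2))) := by
      gcongr
      rw [ENNReal.ofReal_toReal hK]
      refine hσ.trans ?_
      gcongr
      exact hT₀ T hT
    _ = ENNReal.ofReal (rexp 2 * (K.toReal + C / (1 / X) * (ε / (2 * C * rexp 2)))) := by
      rw [ENNReal.ofReal_mul (Real.exp_pos _).le, ENNReal.ofReal_add (by positivity) (by positivity),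
        ENNReal.ofReal_mul (p := C / (1 / X)) (by positivity)]
    _ ≤ _ := by
      apply ENNReal.ofReal_le_ofReal
      rw [div_le_iff₀ hε] at hX2
      have : rexp 2 * (K.toReal + C / (1 / X) * (ε / (2 * C * rexp 2))) =
        rexp 2 * K.toReal + ε * X / 2 := by field_simp
      rw [this]
      linarith

theorem isMeanSquareLimit_psiErr (hRH : RiemannHypothesis) :
    IsMeanSquareLimit psiErr (fun i : {s : ℂ // IsNontrivialZetaZero s ∧ 0 < s.im} ↦ (i : ℂ).im)
      (fun i ↦ zetaAmp (i : ℂ).im) := by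
  obtain ⟨C, hC, h⟩ := exists_lintegral_psiRem_le hRH
  have := isMeanSquareLimit_of_lintegral_le hRH (k := fun _ ↦ 1) (by simp) (E := psiErr) hC fun T ↦ by
    obtain ⟨K, hK, hKσ⟩ := h T
    refine ⟨K, hK, fun σ h0 h1 ↦ (le_trans ?_ (hKσ σ h0 (by linarith)))⟩
    refine le_trans (le_of_eq ?_) (setLIntegral_le_lintegral (Ioi 0) _)
    refine setLIntegral_congr_fun measurableSet_Ioi fun u hu ↦ ?_
    have hu0 : (0 : ℝ) ≤ u := le_of_lt hu
    simp only [psiRem, if_pos hu0, zetaPoly, one_mul]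
  simpa only [one_mul] using this

theorem enorm_integral_mul_exp_sq_le {f : ℝ → ℂ} (hf : Measurable f) (u : ℝ) :
    ENNReal.ofReal (‖(rexp (u / 2) : ℂ) * ∫ v in Ioi u, f v * rexp (-(v / 2))‖ ^ 2) ≤
      2 * ∫⁻ v in Ioi u, ENNReal.ofReal (‖f v‖ ^ 2 * rexp ((u - v) / 2)) := by
  have h1 : (rexp (u / 2) : ℂ) * ∫ v in Ioi u, f v * rexp (-(v / 2)) =
      ∫ v in Ioi u, f v * rexp ((u - v) / 2) := by
    rw [← integral_const_mul]
    congr 1 with v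
    rw [mul_left_comm, ← Complex.ofReal_mul, ← Real.exp_add]
    ring_nf
  have h2 : ∫⁻ v in Ioi u, ENNReal.ofReal (rexp ((u - v) / 4)) ^ (2 : ℝ) = 2 := by
    have e1 : ∀ v, ENNReal.ofReal (rexp ((u - v) / 4)) ^ (2 : ℝ) =
        ENNReal.ofReal (rexp (u / 2) * rexp (-(1 / 2) * v)) := fun v ↦ by
      rw [ENNReal.rpow_two, ← ENNReal.ofReal_pow (Real.exp_pos _).le, ← Real.exp_nat_mul,
        ← Real.exp_add]
      congr 2
      push_cast
      ring
    simp only [e1]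
    rw [← ofReal_integral_eq_lintegral_ofReal
      ((integrableOn_exp_mul_Ioi (by norm_num) u).const_mul _)
      (Eventually.of_forall fun _ ↦ by positivity), integral_const_mul,
      integral_exp_mul_Ioi (by norm_num)]
    have : rexp (u / 2) * (-rexp (-(1 / 2) * u) / -(1 / 2)) = 2 * (rexp (u / 2) * rexp (-(1 / 2) * u)) := by
      ring
    rw [this, ← Real.exp_add, show u / 2 + -(1 / 2) * u = 0 by ring]
    simp
  have h3 : ∀ v, ENNReal.ofReal (‖f v‖ * rexp ((u - v) / 4)) ^ (2 : ℝ) =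
      ENNReal.ofReal (‖f v‖ ^ 2 * rexp ((u - v) / 2)) := fun v ↦ by
    rw [ENNReal.rpow_two, ← ENNReal.ofReal_pow (by positivity), mul_pow, ← Real.exp_nat_mul]
    congr 3
    push_cast
    ring
  have h4 : ENNReal.ofReal ‖∫ v in Ioi u, f v * rexp ((u - v) / 2)‖ ≤
      (∫⁻ v in Ioi u, ENNReal.ofReal (‖f v‖ ^ 2 * rexp ((u - v) / 2))) ^ (1 / 2 : ℝ) *
        2 ^ (1 / 2 : ℝ) := by
    rw [ofReal_norm]
    refine (enorm_integral_le_lintegral_enorm _).trans ?_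
    have := ENNReal.lintegral_mul_le_Lp_mul_Lq (volume.restrict (Ioi u)) Real.HolderConjugate.two_two
      (f := fun v ↦ ENNReal.ofReal (‖f v‖ * rexp ((u - v) / 4)))
      (g := fun v ↦ ENNReal.ofReal (rexp ((u - v) / 4))) (by fun_prop) (by fun_prop)
    rw [h2] at this
    simp only [h3, Pi.mul_apply] at this
    refine le_trans (le_of_eq (lintegral_congr fun v ↦ ?_)) this
    rw [← ENNReal.ofReal_mul (by positivity), ← ofReal_norm, norm_mul, Complex.norm_real,
      Real.norm_of_nonneg (Real.exp_pos _).le, mul_assoc, ← Real.exp_add]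
    ring_nf
  rw [h1, ENNReal.ofReal_pow (norm_nonneg _)]
  refine (pow_le_pow_left' h4 2).trans (le_of_eq ?_)
  rw [mul_pow, ← ENNReal.rpow_two, ← ENNReal.rpow_two, ← ENNReal.rpow_mul, ← ENNReal.rpow_mul]
  norm_num
  rw [mul_comm]

theorem lintegral_lintegral_Ioi_le {g : ℝ → ENNReal} (hg : Measurable g) {σ : ℝ} (hσ : σ < 1 / 8) :
    ∫⁻ u in Ioi (0 : ℝ), ENNReal.ofReal (rexp (-2 * σ * u)) *
      ∫⁻ v in Ioi u, g v * ENNReal.ofReal (rexp ((u - v) / 2)) ≤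
      4 * ∫⁻ v in Ioi (0 : ℝ), g v * ENNReal.ofReal (rexp (-2 * σ * v)) := by
  set k : ℝ × ℝ → ENNReal := {p : ℝ × ℝ | p.1 < p.2}.indicator fun p ↦
    ENNReal.ofReal (rexp (-2 * σ * p.1)) * (g p.2 * ENNReal.ofReal (rexp ((p.1 - p.2) / 2))) with hk
  have hkm : Measurable k := by
    refine Measurable.indicator (by fun_prop) (measurableSet_lt measurable_fst measurable_snd)
  have h1 : ∀ u ∈ Ioi (0 : ℝ), ENNReal.ofReal (rexp (-2 * σ * u)) *
      ∫⁻ v in Ioi u, g v * ENNReal.ofReal (rexp ((u - v) / 2)) = ∫⁻ v in Ioi 0, k (u, v) := by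
    intro u hu
    have hu0 : (0 : ℝ) < u := hu
    rw [← lintegral_const_mul _ (by fun_prop)]
    have : ∀ v, k (u, v) = (Ioi u).indicator (fun v ↦ ENNReal.ofReal (rexp (-2 * σ * u)) *
        (g v * ENNReal.ofReal (rexp ((u - v) / 2)))) v := fun v ↦ by
      simp only [hk, indicator, mem_ofPred_eq, mem_Ioi]
    simp only [this]
    rw [setLIntegral_indicator measurableSet_Ioi, inter_eq_left.2 (Ioi_subset_Ioi hu0.le)]
  rw [setLIntegral_congr_fun measurableSet_Ioi h1, lintegral_lintegral_swap
    (f := fun u v ↦ k (u, v)) hkm.aemeasurable,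
    ← lintegral_const_mul' _ _ (by norm_num)]
  refine setLIntegral_mono' measurableSet_Ioi fun v hv ↦ ?_
  have h2 : ∀ u, k (u, v) ≤ g v * (ENNReal.ofReal (rexp (-(v / 2))) *
      (Iic v).indicator (fun u ↦ ENNReal.ofReal (rexp ((1 / 2 - 2 * σ) * u))) u) := fun u ↦ by
    simp only [hk, indicator, mem_ofPred_eq, mem_Iic]
    split_ifs with h3 h4
    · rw [mul_left_comm, ← ENNReal.ofReal_mul (Real.exp_pos _).le,
        ← ENNReal.ofReal_mul (Real.exp_pos _).le, ← Real.exp_add, ← Real.exp_add]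
      apply le_of_eq
      congr 3
      ring
    · exact absurd h3.le h4
    · simp
    · simp
  have h0 : 0 < 1 / 2 - 2 * σ := by linarith
  calc _ ≤ ∫⁻ u, g v * (ENNReal.ofReal (rexp (-(v / 2))) *
      (Iic v).indicator (fun u ↦ ENNReal.ofReal (rexp ((1 / 2 - 2 * σ) * u))) u) :=
        (setLIntegral_le_lintegral _ _).trans (lintegral_mono h2)
    _ = g v * (ENNReal.ofReal (rexp (-(v / 2))) *
        ENNReal.ofReal (rexp ((1 / 2 - 2 * σ) * v) / (1 / 2 - 2 * σ))) := by
      rw [lintegral_const_mul _ ((Measurable.indicator (by fun_prop) measurableSet_Iic).const_mul _),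
        lintegral_const_mul _ (Measurable.indicator (by fun_prop) measurableSet_Iic),
        lintegral_indicator measurableSet_Iic, ← ofReal_integral_eq_lintegral_ofReal
        (integrableOn_exp_mul_Iic h0 v) (Eventually.of_forall fun _ ↦ (Real.exp_pos _).le),
        integral_exp_mul_Iic h0]
    _ ≤ g v * (ENNReal.ofReal (4 * rexp (-2 * σ * v))) := by
      gcongr
      rw [← ENNReal.ofReal_mul (Real.exp_pos _).le]
      apply ENNReal.ofReal_le_ofReal
      rw [mul_div_assoc', ← Real.exp_add, div_le_iff₀ h0,
        show -(v / 2) + (1 / 2 - 2 * σ) * v = -2 * σ * v by ring]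
      nlinarith [Real.exp_pos (-2 * σ * v)]
    _ = _ := by
      rw [ENNReal.ofReal_mul (by norm_num)]
      simp
      ring

/-- A weighted `L²` bound for the operator `f ↦ f - e^{u/2} ∫_u^∞ f(v) e^{-v/2} dv`. -/
theorem lintegral_sub_tail_sq_le {f : ℝ → ℂ} (hf : Measurable f) {σ : ℝ} (hσ : σ < 1 / 8) :
    ∫⁻ u in Ioi (0 : ℝ), ENNReal.ofReal (‖f u - (rexp (u / 2) : ℂ) *
      ∫ v in Ioi u, f v * rexp (-(v / 2))‖ ^ 2 * rexp (-2 * σ * u)) ≤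
      18 * ∫⁻ u in Ioi (0 : ℝ), ENNReal.ofReal (‖f u‖ ^ 2 * rexp (-2 * σ * u)) := by
  set J : ℝ → ℂ := fun u ↦ (rexp (u / 2) : ℂ) * ∫ v in Ioi u, f v * rexp (-(v / 2)) with hJ
  have hpt : ∀ u, ENNReal.ofReal (‖f u - J u‖ ^ 2 * rexp (-2 * σ * u)) ≤
      2 * ENNReal.ofReal (‖f u‖ ^ 2 * rexp (-2 * σ * u)) +
      4 * (ENNReal.ofReal (rexp (-2 * σ * u)) *
        ∫⁻ v in Ioi u, ENNReal.ofReal (‖f v‖ ^ 2) * ENNReal.ofReal (rexp ((u - v) / 2))) := by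
    intro u
    have h1 : ‖f u - J u‖ ^ 2 ≤ 2 * ‖f u‖ ^ 2 + 2 * ‖J u‖ ^ 2 := by
      have := norm_sub_le (f u) (J u)
      nlinarith [sq_nonneg (‖f u‖ - ‖J u‖), norm_nonneg (f u - J u)]
    have h2 := enorm_integral_mul_exp_sq_le hf u
    calc _ ≤ ENNReal.ofReal (2 * (‖f u‖ ^ 2 * rexp (-2 * σ * u)) +
          rexp (-2 * σ * u) * (2 * ‖J u‖ ^ 2)) := by
          apply ENNReal.ofReal_le_ofReal
          nlinarith [Real.exp_pos (-2 * σ * u)]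
      _ = 2 * ENNReal.ofReal (‖f u‖ ^ 2 * rexp (-2 * σ * u)) +
          ENNReal.ofReal (rexp (-2 * σ * u)) * (2 * ENNReal.ofReal (‖J u‖ ^ 2)) := by
          rw [ENNReal.ofReal_add (by positivity) (by positivity), ENNReal.ofReal_mul (by norm_num),
            ENNReal.ofReal_mul (Real.exp_pos _).le, ENNReal.ofReal_mul (p := 2) (by norm_num)]
          simp
      _ ≤ 2 * ENNReal.ofReal (‖f u‖ ^ 2 * rexp (-2 * σ * u)) +
          ENNReal.ofReal (rexp (-2 * σ * u)) * (2 * (2 *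
            ∫⁻ v in Ioi u, ENNReal.ofReal (‖f v‖ ^ 2 * rexp ((u - v) / 2)))) := by
          gcongr
      _ = _ := by
          simp only [ENNReal.ofReal_mul (sq_nonneg ‖f _‖)]
          ring
  calc _ ≤ ∫⁻ u in Ioi (0 : ℝ), (2 * ENNReal.ofReal (‖f u‖ ^ 2 * rexp (-2 * σ * u)) +
      4 * (ENNReal.ofReal (rexp (-2 * σ * u)) *
        ∫⁻ v in Ioi u, ENNReal.ofReal (‖f v‖ ^ 2) * ENNReal.ofReal (rexp ((u - v) / 2)))) :=
        lintegral_mono hpt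
    _ ≤ 2 * (∫⁻ u in Ioi (0 : ℝ), ENNReal.ofReal (‖f u‖ ^ 2 * rexp (-2 * σ * u))) + 4 * (4 *
        ∫⁻ v in Ioi (0 : ℝ), ENNReal.ofReal (‖f v‖ ^ 2) * ENNReal.ofReal (rexp (-2 * σ * v))) := by
      rw [lintegral_add_left (by fun_prop), lintegral_const_mul' _ _ (by norm_num),
        lintegral_const_mul' _ _ (by norm_num)]
      gcongr
      exact lintegral_lintegral_Ioi_le (by fun_prop) hσ
    _ = _ := by
      simp only [← ENNReal.ofReal_mul (sq_nonneg ‖f _‖)]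
      ring

/-- The error term `psiErr` corrected by its exponentially weighted tail. -/
noncomputable def psiTailErr (u : ℝ) : ℝ :=
  psiErr u - rexp (u / 2) * ∫ v in Ioi u, psiErr v * rexp (-(v / 2))

/-- The multiplier by which `psiTailErr` acts on frequencies. -/
noncomputable def tailMul (γ : ℝ) : ℂ := 1 - 1 / (1 / 2 - γ * Complex.I)

theorem half_sub_mul_I_ne_zero (γ : ℝ) : (1 / 2 - γ * Complex.I : ℂ) ≠ 0 := fun h ↦ by
  have := congrArg Complex.re h
  norm_num at this

theorem tailMul_neg (γ : ℝ) : tailMul (-γ) = starRingEnd ℂ (tailMul γ) := by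
  have h2 : starRingEnd ℂ 2 = 2 := map_ofNat (starRingEnd ℂ) 2
  simp [tailMul, h2]

theorem norm_tailMul (γ : ℝ) : ‖tailMul γ‖ = 1 := by
  have h0 := half_sub_mul_I_ne_zero γ
  have h1 : tailMul γ = -starRingEnd ℂ (1 / 2 - γ * Complex.I) / (1 / 2 - γ * Complex.I) := by
    rw [tailMul]
    have h2 : starRingEnd ℂ 2 = 2 := map_ofNat (starRingEnd ℂ) 2
    have h3 : starRingEnd ℂ (1 / 2 - γ * Complex.I) = 1 / 2 + γ * Complex.I := by simp [h2]
    rw [h3, eq_div_iff h0, sub_mul, one_div_mul_cancel h0]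
    ring
  rw [h1, norm_div, norm_neg, RCLike.norm_conj, div_self (norm_ne_zero_iff.2 h0)]

theorem integrableOn_psiErr_mul_exp (hRH : RiemannHypothesis) :
    IntegrableOn (fun v ↦ psiErr v * rexp (-(v / 2))) (Ioi 0) := by
  obtain ⟨C, -, h⟩ := exists_lintegral_psiErr_le hRH
  have hm := measurable_psiErr
  have h1 : IntegrableOn (fun v ↦ psiErr v ^ 2 * rexp (-2 * (1 / 4) * v)) (Ioi 0) := by
    refine ⟨by fun_prop, ?_⟩
    rw [hasFiniteIntegral_iff_ofReal (Eventually.of_forall fun _ ↦ by positivity)]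
    exact (h (1 / 4) (by norm_num) (by norm_num)).trans_lt ENNReal.ofReal_lt_top
  refine (h1.add (integrableOn_exp_mul_Ioi (a := -2 * (1 / 4)) (by norm_num) 0)).mono'
    (by fun_prop) (Eventually.of_forall fun v ↦ ?_)
  rw [Real.norm_eq_abs, abs_mul, abs_of_pos (Real.exp_pos _), Pi.add_apply,
    show -(v / 2) = -2 * (1 / 4) * v by ring, ← add_one_mul]
  gcongr
  nlinarith [sq_abs (psiErr v), sq_nonneg (|psiErr v| - 1 / 2)]

theorem integrableOn_cexp_mul_exp (γ u : ℝ) :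
    IntegrableOn (fun v : ℝ ↦ Complex.exp (γ * Complex.I * v) * (rexp (-(v / 2)) : ℂ)) (Ioi u) ∧
    (rexp (u / 2) : ℂ) * ∫ v in Ioi u, Complex.exp (γ * Complex.I * v) * (rexp (-(v / 2)) : ℂ) =
      1 / (1 / 2 - γ * Complex.I) * Complex.exp (γ * Complex.I * u) := by
  have h0 := half_sub_mul_I_ne_zero γ
  have he : ∀ v : ℝ, Complex.exp (γ * Complex.I * v) * (rexp (-(v / 2)) : ℂ) =
      Complex.exp (-(1 / 2 - γ * Complex.I) * v) := fun v ↦ by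
    push_cast
    rw [← Complex.exp_add]
    ring_nf
  have hre : (-(1 / 2 - γ * Complex.I)).re < 0 := by norm_num
  simp only [he]
  refine ⟨integrableOn_exp_mul_complex_Ioi hre u, ?_⟩
  rw [integral_exp_mul_complex_Ioi hre, neg_div_neg_eq, mul_div_assoc', Complex.ofReal_exp,
    ← Complex.exp_add]
  push_cast
  rw [show (u : ℂ) / 2 + -(1 / 2 - γ * Complex.I) * u = γ * Complex.I * u by ring]
  ring

theorem psiRem_sub_tail (hRH : RiemannHypothesis) (T : Finset ℝ) {u : ℝ} (hu : 0 < u) :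
    psiRem T u - (rexp (u / 2) : ℂ) * ∫ v in Ioi u, psiRem T v * rexp (-(v / 2)) =
      psiTailErr u - ∑ γ ∈ T, tailMul γ * zetaCoeff γ * Complex.exp (γ * Complex.I * u) := by
  have h1 : ∫ v in Ioi u, psiRem T v * (rexp (-(v / 2)) : ℂ) =
      ∫ v in Ioi u, (((psiErr v * rexp (-(v / 2)) : ℝ) : ℂ) -
        ∑ γ ∈ T, zetaCoeff γ * (Complex.exp (γ * Complex.I * v) * (rexp (-(v / 2)) : ℂ))) := by
    refine setIntegral_congr_fun measurableSet_Ioi fun v hv ↦ ?_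
    have hv0 : 0 ≤ v := hu.le.trans (le_of_lt hv)
    simp only [psiRem, if_pos hv0, zetaPoly, sub_mul, Finset.sum_mul, mul_assoc]
    push_cast
    rfl
  have hi : Integrable (fun v ↦ ((psiErr v * rexp (-(v / 2)) : ℝ) : ℂ)) (volume.restrict (Ioi u)) :=
    ((integrableOn_psiErr_mul_exp hRH).mono_set (Ioi_subset_Ioi hu.le)).ofReal
  have hi2 : ∀ γ ∈ T, Integrable (fun v : ℝ ↦ zetaCoeff γ *
      (Complex.exp (γ * Complex.I * v) * (rexp (-(v / 2)) : ℂ))) (volume.restrict (Ioi u)) :=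
    fun γ _ ↦ (integrableOn_cexp_mul_exp γ u).1.const_mul _
  rw [h1, integral_sub hi (integrable_finsetSum _ hi2), integral_finsetSum _ hi2,
    mul_sub, Finset.mul_sum]
  have h2 : ∀ γ ∈ T, (rexp (u / 2) : ℂ) * ∫ v in Ioi u, zetaCoeff γ *
      (Complex.exp (γ * Complex.I * v) * (rexp (-(v / 2)) : ℂ)) =
      zetaCoeff γ * (1 / (1 / 2 - γ * Complex.I) * Complex.exp (γ * Complex.I * u)) := fun γ _ ↦ by
    rw [integral_const_mul, mul_left_comm, (integrableOn_cexp_mul_exp γ u).2]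
  have h3 : ∫ v in Ioi u, ((psiErr v * rexp (-(v / 2)) : ℝ) : ℂ) =
      ((∫ v in Ioi u, psiErr v * rexp (-(v / 2)) : ℝ) : ℂ) := integral_ofReal
  rw [Finset.sum_congr rfl h2]
  have h4 : ∑ γ ∈ T, tailMul γ * zetaCoeff γ * Complex.exp (γ * Complex.I * u) = zetaPoly T u -
      ∑ γ ∈ T, zetaCoeff γ * (1 / (1 / 2 - γ * Complex.I) * Complex.exp (γ * Complex.I * u)) := by
    rw [zetaPoly, ← Finset.sum_sub_distrib]
    refine Finset.sum_congr rfl fun γ _ ↦ ?_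
    rw [tailMul]
    ring
  rw [h3, h4, psiRem, if_pos hu.le, psiTailErr]
  push_cast
  ring

theorem isMeanSquareLimit_psiTailErr (hRH : RiemannHypothesis) :
    IsMeanSquareLimit psiTailErr
      (fun i : {s : ℂ // IsNontrivialZetaZero s ∧ 0 < s.im} ↦ (i : ℂ).im)
      (fun i ↦ tailMul (i : ℂ).im * zetaAmp (i : ℂ).im) := by
  obtain ⟨C, hC, h⟩ := exists_lintegral_psiRem_le hRH
  refine isMeanSquareLimit_of_lintegral_le hRH tailMul_neg (C := 18 * C) (by positivity) fun T ↦ ?_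
  obtain ⟨K, hK, hKσ⟩ := h T
  refine ⟨18 * K, ENNReal.mul_ne_top (by norm_num) hK, fun σ h0 h1 ↦ ?_⟩
  calc _ = ∫⁻ u in Ioi (0 : ℝ), ENNReal.ofReal (‖psiRem T u - (rexp (u / 2) : ℂ) *
        ∫ v in Ioi u, psiRem T v * rexp (-(v / 2))‖ ^ 2 * rexp (-2 * σ * u)) := by
        refine setLIntegral_congr_fun measurableSet_Ioi fun u hu ↦ ?_
        simp only [psiRem_sub_tail hRH T hu]
    _ ≤ _ := lintegral_sub_tail_sq_le (measurable_psiRem T) h1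
    _ ≤ 18 * (K + ENNReal.ofReal (C / σ) * zetaTail T) := by
      gcongr
      exact (setLIntegral_le_lintegral _ _).trans (hKσ σ h0 (by linarith))
    _ = _ := by
      rw [mul_add, ← mul_assoc, mul_div_assoc, ENNReal.ofReal_mul (p := 18) (by norm_num)]
      simp

theorem tendsto_mul_integral_Ioi {r : ℝ → ℝ} (hr : Tendsto r atTop (nhds 0)) :
    Tendsto (fun u ↦ rexp (u / 2) * ∫ v in Ioi u, r v * rexp (-(v / 2))) atTop (nhds 0) := by
  have hInt : ∀ u : ℝ, IntegrableOn (fun v ↦ rexp (-(1 / 2) * v)) (Ioi u) := fun u ↦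
    integrableOn_exp_mul_Ioi (by norm_num) u
  rw [Metric.tendsto_nhds]
  intro ε hε
  obtain ⟨U, hU⟩ := eventually_atTop.1 ((Metric.tendsto_nhds.1 hr) (ε / 4) (by positivity))
  filter_upwards [eventually_ge_atTop U] with u hu
  rw [dist_zero_right, norm_mul, Real.norm_of_nonneg (Real.exp_pos _).le]
  have h1 : ‖∫ v in Ioi u, r v * rexp (-(v / 2))‖ ≤ ∫ v in Ioi u, ε / 4 * rexp (-(1 / 2) * v) := by
    refine norm_integral_le_of_norm_le ((hInt u).const_mul _)
      ((ae_restrict_iff' measurableSet_Ioi).2 (Eventually.of_forall fun v hv ↦ ?_))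
    have := hU v (hu.trans (le_of_lt hv))
    rw [dist_zero_right] at this
    rw [norm_mul, Real.norm_of_nonneg (Real.exp_pos _).le, show -(v / 2) = -(1 / 2) * v by ring]
    gcongr
  rw [integral_const_mul, integral_exp_mul_Ioi (by norm_num)] at h1
  calc _ ≤ rexp (u / 2) * (ε / 4 * (-rexp (-(1 / 2) * u) / -(1 / 2))) := by gcongr
    _ = ε / 2 * (rexp (u / 2) * rexp (-(1 / 2) * u)) := by ring
    _ = ε / 2 := by
      rw [← Real.exp_add, show u / 2 + -(1 / 2) * u = 0 by ring, Real.exp_zero, mul_one]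
    _ < ε := by linarith

theorem tendsto_mertensErr_sub (hRH : RiemannHypothesis) :
    Tendsto (fun u ↦ mertensErr eulerMascheroniConstant u - 1 - psiTailErr u) atTop (nhds 0) := by
  obtain ⟨L, hL, h⟩ := exists_tendsto_mertensErr hRH
  rw [eq_eulerMascheroniConstant_of_tendsto hL] at h
  have hr := tendsto_thetaErr_sub hRH
  have h2 := (h.add hr).sub (tendsto_mul_integral_Ioi hr)
  simp only [add_zero, sub_zero] at h2
  refine h2.congr' ?_
  filter_upwards [eventually_gt_atTop 0] with u hu
  have hi := (integrableOn_psiErr_mul_exp hRH).mono_set (Ioi_subset_Ioi hu.le)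
  have hm := measurable_thetaErr
  have hi2 : IntegrableOn (fun v ↦ thetaErr v * rexp (-(v / 2))) (Ioi u) :=
    ((integrableOn_thetaErr_mul_exp hRH).mono_set (Ioi_subset_Ioi hu.le)).mono' (by fun_prop)
      (Eventually.of_forall fun v ↦ by
        rw [norm_mul, Real.norm_of_nonneg (Real.exp_pos _).le, Real.norm_eq_abs])
  have hi3 : IntegrableOn (fun v ↦ rexp (-(1 / 2) * v)) (Ioi u) :=
    integrableOn_exp_mul_Ioi (by norm_num) u
  have h3 : ∫ v in Ioi u, (thetaErr v - (psiErr v - 1)) * rexp (-(v / 2)) =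
      (∫ v in Ioi u, thetaErr v * rexp (-(v / 2))) - (∫ v in Ioi u, psiErr v * rexp (-(v / 2))) +
        ∫ v in Ioi u, rexp (-(1 / 2) * v) := by
    have hd : IntegrableOn (fun v ↦ thetaErr v * rexp (-(v / 2)) - psiErr v * rexp (-(v / 2)))
      (Ioi u) := hi2.sub hi
    rw [← integral_sub hi2 hi, ← integral_add hd hi3]
    congr 1 with v
    rw [show -(1 / 2) * v = -(v / 2) by ring]
    ring
  rw [h3, integral_exp_mul_Ioi (by norm_num), psiTailErr]
  have h4 : rexp (u / 2) * rexp (-(1 / 2) * u) = 1 := by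
    rw [← Real.exp_add, show u / 2 + -(1 / 2) * u = 0 by ring, Real.exp_zero]
  linear_combination (-2) * h4

theorem IsMeanSquareLimit.add_of_tendsto_zero {ι : Type*} {E r : ℝ → ℝ} {l : ι → ℝ} {a : ι → ℂ}
    (hE : IsMeanSquareLimit E l a) (hr : Tendsto r atTop (nhds 0)) (hr1 : ∀ u, |r u| ≤ 1) :
    IsMeanSquareLimit (fun u ↦ E u + r u) l a := by
  intro ε hε
  obtain ⟨S₀, hS₀⟩ := hE (ε / 8) (by positivity)
  have hrε : ∀ᶠ u in atTop, r u ^ 2 < ε / 8 := by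
    have := hr.pow 2
    rw [zero_pow two_ne_zero] at this
    exact this.eventually_lt_const (by positivity)
  obtain ⟨U, hU⟩ := eventually_atTop.1 hrε
  refine ⟨S₀, fun S hS ↦ ?_⟩
  filter_upwards [hS₀ S hS, eventually_gt_atTop 0, eventually_ge_atTop (4 * |U| / ε)] with T hT hT0 hTU
  have hpt : ∀ u ∈ Ioc 0 T, ENNReal.ofReal ((E u + r u - trigPoly l a S u) ^ 2) ≤
      2 * ENNReal.ofReal ((E u - trigPoly l a S u) ^ 2) +
        2 * ((Icc 0 U).indicator (fun _ ↦ 1) u + ENNReal.ofReal (ε / 8)) := by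
    intro u hu
    have h1 : ENNReal.ofReal (r u ^ 2) ≤ (Icc 0 U).indicator (fun _ ↦ 1) u + ENNReal.ofReal (ε / 8) := by
      by_cases h : u ≤ U
      · rw [indicator_of_mem (show u ∈ Icc 0 U from ⟨hu.1.le, h⟩)]
        refine le_add_right ?_
        rw [ENNReal.ofReal_le_one, ← sq_abs]
        exact pow_le_one₀ (abs_nonneg _) (hr1 u)
      · exact le_add_left (ENNReal.ofReal_le_ofReal (hU u (le_of_not_ge h)).le)
    calc _ ≤ ENNReal.ofReal (2 * (E u - trigPoly l a S u) ^ 2 + 2 * r u ^ 2) := by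
          apply ENNReal.ofReal_le_ofReal
          nlinarith [sq_nonneg (E u - trigPoly l a S u - r u)]
      _ = 2 * ENNReal.ofReal ((E u - trigPoly l a S u) ^ 2) + 2 * ENNReal.ofReal (r u ^ 2) := by
          rw [ENNReal.ofReal_add (by positivity) (by positivity), ENNReal.ofReal_mul (by norm_num),
            ENNReal.ofReal_mul (by norm_num)]
          simp
      _ ≤ _ := by gcongr
  calc _ ≤ ∫⁻ u in Ioc 0 T, (2 * ENNReal.ofReal ((E u - trigPoly l a S u) ^ 2) +
        2 * ((Icc 0 U).indicator (fun _ ↦ 1) u + ENNReal.ofReal (ε / 8))) :=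
        setLIntegral_mono' measurableSet_Ioc hpt
    _ ≤ 2 * ENNReal.ofReal (ε / 8 * T) +
        2 * (ENNReal.ofReal |U| + ENNReal.ofReal (ε / 8) * ENNReal.ofReal T) := by
      have hm : Measurable ((Icc 0 U).indicator fun _ ↦ (1 : ENNReal)) :=
        measurable_const.indicator measurableSet_Icc
      rw [lintegral_add_right _ (by fun_prop), lintegral_const_mul' _ _ (by norm_num),
        lintegral_const_mul' _ _ (by norm_num), lintegral_add_right _ (by fun_prop)]
      gcongr
      · refine (setLIntegral_le_lintegral _ _).trans ?_
        rw [lintegral_indicator measurableSet_Icc, setLIntegral_one, Real.volume_Icc, sub_zero]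
        exact ENNReal.ofReal_le_ofReal (le_abs_self U)
      · simp
    _ = ENNReal.ofReal (2 * (ε / 8 * T) + 2 * (|U| + ε / 8 * T)) := by
      rw [ENNReal.ofReal_add (by positivity) (by positivity),
        ENNReal.ofReal_mul (p := 2) (q := ε / 8 * T) (by norm_num),
        ENNReal.ofReal_mul (p := 2) (by norm_num), ENNReal.ofReal_add (by positivity) (by positivity),
        ENNReal.ofReal_mul (p := ε / 8) (q := T) (by positivity)]
      simp
    _ ≤ _ := by
      apply ENNReal.ofReal_le_ofReal
      rw [div_le_iff₀ hε] at hTU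
      linarith

/-- A mean square expansion is inherited by an asymptotically equal function, after a modification
on a bounded set. -/
theorem IsMeanSquareLimit.exists_eventuallyEq {ι : Type*} {E F : ℝ → ℝ} {l : ι → ℝ} {a : ι → ℂ}
    (hE : IsMeanSquareLimit E l a) (hEm : Measurable E) (hFm : Measurable F)
    (h : Tendsto (fun u ↦ F u - E u) atTop (nhds 0)) :
    ∃ G, Measurable G ∧ IsMeanSquareLimit G l a ∧ G =ᶠ[atTop] F := by
  obtain ⟨U, hU⟩ := eventually_atTop.1 ((Metric.tendsto_nhds.1 h) 1 one_pos)
  refine ⟨fun u ↦ E u + (Ici U).indicator (fun u ↦ F u - E u) u,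
    hEm.add ((hFm.sub hEm).indicator measurableSet_Ici), hE.add_of_tendsto_zero ?_ fun u ↦ ?_, ?_⟩
  · refine h.congr' ?_
    filter_upwards [eventually_ge_atTop U] with u hu
    rw [indicator_of_mem (mem_Ici.2 hu)]
  · by_cases hu : u ∈ Ici U
    · have := hU u hu
      rw [Real.dist_0_eq_abs] at this
      rw [indicator_of_mem hu]
      exact this.le
    · rw [indicator_of_notMem hu, abs_zero]
      exact zero_le_one
  · filter_upwards [eventually_ge_atTop U] with u hu
    rw [indicator_of_mem (mem_Ici.2 hu)]
    ring

/-- Logarithmic densities are natural densities in the logarithmic scale. -/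
theorem hasLogDensity_of_tendsto {S : Set ℝ} {G : ℝ → ℝ} (hG : Measurable G)
    (hS : ∀ v, log 2 ≤ v → (rexp v ∈ S ↔ 0 < G v)) {B : Set ℝ}
    (hB : ∀ᶠ u in atTop, (u ∈ B ↔ 0 < G u)) {d : ℝ}
    (hd : Tendsto (fun T ↦ volume.real (B ∩ Ioc 0 T) / T) atTop (nhds d)) :
    HasLogDensity S d := by
  have hl2 : 0 < log 2 := Real.log_pos one_lt_two
  set A : Set ℝ := {v | log 2 ≤ v ∧ 0 < G v} with hA
  have hAm : MeasurableSet A := (measurableSet_le measurable_const measurable_id).inter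
    (measurableSet_lt measurable_const hG)
  obtain ⟨U, hU⟩ := eventually_atTop.1 (hB.and (eventually_ge_atTop (log 2)))
  have hInt : ∀ x : ℝ, 2 ≤ x → ∫ t in S ∩ Icc 2 x, 1 / t = volume.real (A ∩ Iic (log x)) := by
    intro x hx
    have him : S ∩ Icc 2 x = rexp '' (A ∩ Iic (log x)) := by
      ext t
      constructor
      · rintro ⟨ht, ht2, htx⟩
        have ht0 : 0 < t := by linarith
        have hlt : log 2 ≤ log t := Real.log_le_log two_pos ht2
        refine ⟨log t, ⟨⟨hlt, (hS _ hlt).1 ?_⟩, Real.log_le_log ht0 htx⟩, Real.exp_log ht0⟩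
        rwa [Real.exp_log ht0]
      · rintro ⟨v, ⟨⟨hv, hGv⟩, hvx⟩, rfl⟩
        exact ⟨(hS v hv).2 hGv, (Real.log_le_iff_le_exp two_pos).1 hv,
          (Real.le_log_iff_exp_le (by linarith)).1 hvx⟩
    rw [him, setIntegral_image_exp (hAm.inter measurableSet_Iic)]
    simp
  have hfin : ∀ X, volume (A ∩ Iic X) ≠ ⊤ := fun X ↦ measure_ne_top_of_subset
    (fun v hv ↦ (⟨hl2.le.trans hv.1.1, hv.2⟩ : v ∈ Icc 0 X)) measure_Icc_lt_top.ne
  have hfin2 : ∀ X, volume (B ∩ Ioc 0 X) ≠ ⊤ := fun X ↦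
    measure_ne_top_of_subset inter_subset_right (by simp)
  have hU0 : 0 ≤ U := hl2.le.trans (hU U le_rfl).2
  have hUr : volume.real (Icc 0 U) = U := by simp [hU0]
  have hle1 : ∀ X, volume.real (A ∩ Iic X) ≤ volume.real (B ∩ Ioc 0 X) + U := fun X ↦ by
    refine (measureReal_mono (s₂ := B ∩ Ioc 0 X ∪ Icc 0 U) (fun v hv ↦ ?_)
      (measure_union_ne_top (hfin2 X) (by simp))).trans ((measureReal_union_le _ _).trans_eq (by rw [hUr]))
    have hv0 : 0 < v := hl2.trans_le hv.1.1
    by_cases h : U ≤ v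
    · exact Or.inl ⟨(hU v h).1.2 hv.1.2, hv0, hv.2⟩
    · exact Or.inr ⟨hv0.le, le_of_not_ge h⟩
  have hle2 : ∀ X, volume.real (B ∩ Ioc 0 X) ≤ volume.real (A ∩ Iic X) + U := fun X ↦ by
    refine (measureReal_mono (s₂ := A ∩ Iic X ∪ Icc 0 U) (fun v hv ↦ ?_)
      (measure_union_ne_top (hfin X) (by simp))).trans ((measureReal_union_le _ _).trans_eq (by rw [hUr]))
    by_cases h : U ≤ v
    · exact Or.inl ⟨⟨(hU v h).2, (hU v h).1.1 hv.1⟩, hv.2.2⟩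
    · exact Or.inr ⟨hv.2.1.le, le_of_not_ge h⟩
  have hlim : Tendsto (fun X ↦ volume.real (A ∩ Iic X) / X) atTop (nhds d) := by
    have h0 : Tendsto (fun X ↦ (volume.real (A ∩ Iic X) - volume.real (B ∩ Ioc 0 X)) / X) atTop
        (nhds 0) := by
      refine squeeze_zero_norm' (a := fun X ↦ U / X) ?_ (tendsto_const_nhds.div_atTop tendsto_id)
      filter_upwards [eventually_gt_atTop 0] with X hX
      rw [norm_div, Real.norm_eq_abs, Real.norm_of_nonneg hX.le]
      gcongr
      exact abs_le.2 ⟨by linarith [hle2 X], by linarith [hle1 X]⟩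
    have := hd.add h0
    rw [add_zero] at this
    refine this.congr fun X ↦ ?_
    ring
  refine (hlim.comp Real.tendsto_log_atTop).congr' ?_
  filter_upwards [eventually_ge_atTop 2] with x hx
  rw [Function.comp_apply, hInt x hx]

theorem measurable_mertensErr (L : ℝ) : Measurable (mertensErr L) := by
  have := measurable_log_mertensProd_exp
  unfold mertensErr
  fun_prop

theorem measurable_piErr : Measurable piErr := by
  have h1 : Monotone fun x : ℝ ↦ ∫ t in Icc 2 x, 1 / log t := fun x y hxy ↦ by
    have hc : IntegrableOn (fun t ↦ 1 / log t) (Icc 2 y) := by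
      refine ContinuousOn.integrableOn_Icc fun t ht ↦ ContinuousAt.continuousWithinAt ?_
      have ht2 : (2 : ℝ) ≤ t := ht.1
      exact continuousAt_const.div (Real.continuousAt_log (by linarith))
        (Real.log_pos (by linarith)).ne'
    refine setIntegral_mono_set hc ((ae_restrict_iff' measurableSet_Icc).2
      (Eventually.of_forall fun t ht ↦ ?_)) (Icc_subset_Icc_right hxy).eventuallyLE
    have ht2 : (2 : ℝ) ≤ t := ht.1
    exact one_div_nonneg.2 (Real.log_nonneg (by linarith))
  have h2 : Measurable fun u : ℝ ↦ ∫ t in Icc 2 (rexp u), 1 / log t :=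
    h1.measurable.comp Real.measurable_exp
  have h3 : Measurable fun u : ℝ ↦ (Nat.primeCounting ⌊rexp u⌋₊ : ℝ) :=
    (measurable_from_top (f := fun n : ℕ ↦ (Nat.primeCounting n : ℝ))).comp
      (Nat.measurable_floor.comp Real.measurable_exp)
  unfold piErr
  fun_prop

theorem measurable_psiTailErr : Measurable psiTailErr := by
  have hm := measurable_psiErr
  have h1 : Measurable fun p : ℝ × ℝ ↦
      {p : ℝ × ℝ | p.1 < p.2}.indicator (fun p ↦ psiErr p.2 * rexp (-(p.2 / 2))) p :=
    Measurable.indicator (by fun_prop) (measurableSet_lt measurable_fst measurable_snd)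
  have h2 : Measurable fun u ↦ ∫ v in Ioi u, psiErr v * rexp (-(v / 2)) := by
    have h3 := (h1.stronglyMeasurable.integral_prod_right' (ν := volume)).measurable
    refine (congrArg Measurable (funext fun u ↦ ?_)).mp h3
    rw [← integral_indicator measurableSet_Ioi]
    rfl
  unfold psiTailErr
  fun_prop

theorem exp_mem_piLiSet_iff {v : ℝ} (hv : log 2 ≤ v) : rexp v ∈ PiLiSet ↔ 0 < piErr v := by
  have hv0 : 0 < v := (Real.log_pos one_lt_two).trans_le hv
  have h2 : 2 ≤ rexp v := (Real.log_le_iff_le_exp two_pos).1 hv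
  rw [PiLiSet, mem_ofPred_eq, piErr, mul_pos_iff_of_pos_right (by positivity), sub_pos]
  exact and_iff_right h2

theorem exp_mem_mertensSet_iff {v : ℝ} (hv : log 2 ≤ v) :
    rexp v ∈ MertensSet ↔ 0 < mertensErr eulerMascheroniConstant v := by
  have hv0 : 0 < v := (Real.log_pos one_lt_two).trans_le hv
  have h2 : 2 ≤ rexp v := (Real.log_le_iff_le_exp two_pos).1 hv
  rw [MertensSet, mem_ofPred_eq, mertensErr, mul_pos_iff_of_pos_right (by positivity), Real.log_exp,
    ← Real.log_lt_log_iff (by positivity) (mertensProd_pos _),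
    Real.log_mul (Real.exp_pos _).ne' hv0.ne', Real.log_exp, and_iff_right h2]
  constructor <;> intro h <;> linarith

/-- Assuming RH and LI, `M` has a logarithmic density `δ(M)`, the set
`N = {x ≥ 2 : π(x) > Li(x)}` has a logarithmic density `δ(N)`, and `δ(M) = 1 - δ(N)`. -/
theorem mertensSet_logDensity_eq_one_sub (hRH : RiemannHypothesis)
    (hLI : LinearIndependenceHypothesis) :
    ∃ dM dN : ℝ, HasLogDensity MertensSet dM ∧ HasLogDensity PiLiSet dN ∧
      dM = 1 - dN := by
  have h1 : Tendsto (fun u ↦ piErr u + 1 - psiErr u) atTop (nhds 0) := by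
    have := (tendsto_piErr_sub hRH).add (tendsto_thetaErr_sub hRH)
    rw [add_zero] at this
    exact this.congr fun u ↦ by ring
  have hpm := measurable_piErr
  have hmm := measurable_mertensErr eulerMascheroniConstant
  have htm := measurable_psiTailErr
  obtain ⟨G, hGm, hG, hGe⟩ := (isMeanSquareLimit_psiErr hRH).exists_eventuallyEq measurable_psiErr
    (hpm.add_const 1) h1
  obtain ⟨H, hHm, hH, hHe⟩ := (isMeanSquareLimit_psiTailErr hRH).exists_eventuallyEq htm
    (hmm.sub_const 1) (tendsto_mertensErr_sub hRH)
  obtain ⟨d, hd1, hd2⟩ := hG.exists_density hH hGm hHm hLI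
    (fun i ↦ ⟨tailMul (i : ℂ).im, norm_tailMul _, rfl⟩) one_ne_zero
  refine ⟨1 - d, d, ?_, ?_, rfl⟩
  · refine hasLogDensity_of_tendsto hmm (fun v ↦ exp_mem_mertensSet_iff) ?_ hd2
    filter_upwards [hHe] with u hu
    rw [hu]
    constructor <;> intro h <;> linarith
  · refine hasLogDensity_of_tendsto hpm (fun v ↦ exp_mem_piLiSet_iff) ?_ hd1
    filter_upwards [hGe] with u hu
    rw [hu]
    constructor <;> intro h <;> linarith
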